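/- arXiv:2306.07100 — 7 statements merged into one kernel-verified Lean document; each statement's English description precedes it below -/
import Mathlib

section
/- Subordination formula for the Euclidean fractional kernel: for every n ≥ 1, s ∈ (0,2) and x, y ∈ ℝ^n with x ≠ y, one has (s/2)/Γ(1-s/2) · ∫₀^∞ (4πt)^{-n/2} · exp(-|x-y|²/(4t)) · t^{-1-s/2} dt = α_{n,s} · |x-y|^{-(n+s)}, where α_{n,s} := s·2^{s-1}·Γ((n+s)/2)/(π^{n/2}·Γ(1-s/2)). -/
open MeasureTheory Real Set

/-- The normalizing constant `α_{n,s}` of the fractional Laplacian kernel. -/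
noncomputable def alphaC (n : ℕ) (s : ℝ) : ℝ :=
  s * 2 ^ (s - 1) * Real.Gamma (((n : ℝ) + s) / 2) /
    (Real.pi ^ ((n : ℝ) / 2) * Real.Gamma (1 - s / 2))

/-- The Gamma integral after the substitution `t ↦ t⁻¹`. -/
lemma integral_rpow_mul_exp_neg_div_Ioi {a r : ℝ} (ha : 0 < a) (hr : 0 < r) :
    ∫ t in Ioi (0 : ℝ), t ^ (-a - 1) * exp (-(r / t)) = (1 / r) ^ a * Gamma a := by
  rw [← integral_rpow_mul_exp_neg_mul_Ioi ha hr,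
    ← integral_comp_rpow_Ioi (fun t : ℝ => t ^ (a - 1) * exp (-(r * t)))
      (p := -1) (by norm_num)]
  refine setIntegral_congr_fun measurableSet_Ioi fun t ht => ?_
  have ht : 0 < t := ht
  simp only [abs_neg, abs_one, one_mul, smul_eq_mul]
  rw [← mul_assoc, ← rpow_mul ht.le, ← rpow_add ht, rpow_neg_one, div_eq_mul_inv]
  ring_nf

/-- Subordination formula: integrating the Euclidean heat kernel against `t^{-1-s/2}`
produces the fractional kernel `α_{n,s} |x-y|^{-(n+s)}`. -/
theorem subordination_formula (n : ℕ) (hn : 1 ≤ n) (s : ℝ) (hs : s ∈ Set.Ioo (0 : ℝ) 2)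
    (x y : EuclideanSpace ℝ (Fin n)) (hxy : x ≠ y) :
    (s / 2) / Real.Gamma (1 - s / 2) *
        ∫ t in Set.Ioi (0 : ℝ),
          (4 * Real.pi * t) ^ (-(n : ℝ) / 2) * Real.exp (-‖x - y‖ ^ 2 / (4 * t)) *
            t ^ (-1 - s / 2)
      = alphaC n s * ‖x - y‖ ^ (-((n : ℝ) + s)) := by
  obtain ⟨hs0, -⟩ := hs
  have hr : 0 < ‖x - y‖ := norm_pos_iff.2 (sub_ne_zero.2 hxy)
  generalize ‖x - y‖ = r at hr ⊢
  have ha : 0 < ((n : ℝ) + s) / 2 := by positivity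
  have hint : ∫ t in Ioi (0 : ℝ),
      (4 * π * t) ^ (-(n : ℝ) / 2) * exp (-r ^ 2 / (4 * t)) * t ^ (-1 - s / 2) =
      (4 * π) ^ (-(n : ℝ) / 2) *
        ((1 / (r ^ 2 / 4)) ^ (((n : ℝ) + s) / 2) * Gamma (((n : ℝ) + s) / 2)) := by
    rw [← integral_rpow_mul_exp_neg_div_Ioi ha (by positivity : 0 < r ^ 2 / 4),
      ← integral_const_mul]
    refine setIntegral_congr_fun measurableSet_Ioi fun t ht => ?_
    have ht : 0 < t := ht
    have h_pow : t ^ (-(((n : ℝ) + s) / 2) - 1) = t ^ (-(n : ℝ) / 2) * t ^ (-1 - s / 2) := by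
      rw [← rpow_add ht]
      ring_nf
    have h_exp : -r ^ 2 / (4 * t) = -(r ^ 2 / 4 / t) := by
      field_simp
    simp only [h_exp, h_pow]
    rw [mul_rpow (by positivity) ht.le]
    ring
  have h_pi : (4 * π) ^ (-(n : ℝ) / 2) = 2 ^ (-(n : ℝ)) * (π ^ ((n : ℝ) / 2))⁻¹ := by
    rw [mul_rpow (by norm_num) pi_pos.le, show (4 : ℝ) = 2 ^ (2 : ℝ) by norm_num,
      ← rpow_mul (by norm_num), ← rpow_neg pi_pos.le]
    ring_nf
  have h_r : (1 / (r ^ 2 / 4)) ^ (((n : ℝ) + s) / 2) =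
      2 ^ ((n : ℝ) + s) * r ^ (-((n : ℝ) + s)) := by
    rw [show 1 / (r ^ 2 / 4) = (2 * r⁻¹) ^ (2 : ℝ) by rw [rpow_two]; field_simp; norm_num,
      ← rpow_mul (by positivity), mul_div_cancel₀ _ two_ne_zero,
      mul_rpow (by norm_num) (by positivity), inv_rpow hr.le, rpow_neg hr.le]
  have h_two : (2 : ℝ) ^ (-(n : ℝ)) * 2 ^ ((n : ℝ) + s) = 2 * 2 ^ (s - 1) := by
    rw [← rpow_add two_pos, ← rpow_one_add' two_pos.le (by linarith)]
    ring_nf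
  rw [hint, h_pi, h_r, alphaC]
  linear_combination (s / 2 / Gamma (1 - s / 2) * (π ^ ((n : ℝ) / 2))⁻¹ *
    r ^ (-((n : ℝ) + s)) * Gamma (((n : ℝ) + s) / 2)) * h_two
end

section
/- Interpolation inequality for the Gagliardo seminorm: let n ≥ 1, s ∈ (0,1), and let u : B₁ → [-1,1] be a Lipschitz function on the unit ball B₁ ⊆ ℝ^n. Then ∬_{B₁×B₁} |u(x)-u(y)|²·|x-y|^{-(n+s)} dx dy ≤ C(n)/((1-s)·s) · (∫_{B₁} |∇u| dx)^s · (∫_{B₁} |u| dx)^{1-s}, for a constant C(n) depending only on n. -/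
open MeasureTheory Real Set Metric

/-- A Lipschitz function of one real variable is controlled by the integral of its derivative. -/
theorem LipschitzWith.enorm_sub_le_lintegral_enorm_deriv {f : ℝ → ℝ} {K : NNReal}
    (hf : LipschitzWith K f) :
    ‖f 1 - f 0‖ₑ ≤ ∫⁻ t in Ioc (0 : ℝ) 1, ‖deriv f t‖ₑ := by
  rw [← (hf.lipschitzOnWith (s := uIcc 0 1)).absolutelyContinuousOnInterval.integral_deriv_eq_sub,
    intervalIntegral.integral_of_le zero_le_one]
  exact enorm_integral_le_lintegral_enorm _

/-- The `L¹` norm on `S` of a difference of translates is at most twice the `L¹` norm. -/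
theorem lintegral_enorm_translate_sub_le_two_mul {E : Type*} [NormedAddCommGroup E]
    [MeasurableSpace E] [BorelSpace E] {μ : Measure E} [μ.IsAddHaarMeasure]
    {u : E → ℝ} (hu : Measurable u)
    {S : Set E} (hSm : MeasurableSet S) (h : E) :
    ∫⁻ x in S ∩ (fun x => x + h) ⁻¹' S, ‖u (x + h) - u x‖ₑ ∂μ
      ≤ 2 * ∫⁻ x in S, ‖u x‖ₑ ∂μ := by
  have hTm : MeasurableSet (S ∩ (fun x => x + h) ⁻¹' S) :=
    hSm.inter ((measurable_add_const h) hSm)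
  have hg : Measurable (S.indicator fun x => ‖u x‖ₑ) := hu.enorm.indicator hSm
  calc ∫⁻ x in S ∩ (fun x => x + h) ⁻¹' S, ‖u (x + h) - u x‖ₑ ∂μ
      ≤ ∫⁻ x in S ∩ (fun x => x + h) ⁻¹' S,
          (S.indicator (fun x => ‖u x‖ₑ) (x + h) + S.indicator (fun x => ‖u x‖ₑ) x) ∂μ := by
        refine setLIntegral_mono' hTm fun x hx => ?_
        rw [indicator_of_mem hx.1, indicator_of_mem (show x + h ∈ S from hx.2)]
        exact enorm_sub_le
    _ ≤ ∫⁻ x, (S.indicator (fun x => ‖u x‖ₑ) (x + h) + S.indicator (fun x => ‖u x‖ₑ) x) ∂μ :=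
        setLIntegral_le_lintegral _ _
    _ = 2 * ∫⁻ x in S, ‖u x‖ₑ ∂μ := by
        rw [lintegral_add_right _ hg, lintegral_add_right_eq_self, lintegral_indicator hSm, two_mul]

section Translation

variable {E : Type*} [NormedAddCommGroup E] [NormedSpace ℝ E] [FiniteDimensional ℝ E]
  [MeasurableSpace E] [BorelSpace E] {μ : Measure E} [μ.IsAddHaarMeasure]

/-- The `L¹` norm of a difference of translates of a Lipschitz function on a convex set is
controlled by the `L¹` norm of its gradient. -/
theorem LipschitzWith.lintegral_enorm_translate_sub_le {u : E → ℝ} {K : NNReal}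
    (hu : LipschitzWith K u) {S : Set E} (hS : Convex ℝ S) (hSm : MeasurableSet S) (h : E) :
    ∫⁻ x in S ∩ (fun x => x + h) ⁻¹' S, ‖u (x + h) - u x‖ₑ ∂μ
      ≤ ‖h‖ₑ * ∫⁻ x in S, ‖fderiv ℝ u x‖ₑ ∂μ := by
  have hTm : MeasurableSet (S ∩ (fun x => x + h) ⁻¹' S) :=
    hSm.inter ((measurable_add_const h) hSm)
  have hline : Measurable fun x => ‖lineDeriv ℝ u x h‖ₑ :=
    (measurable_lineDeriv (𝕜 := ℝ) hu.continuous).enorm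
  have hg : Measurable (S.indicator fun x => ‖lineDeriv ℝ u x h‖ₑ) := hline.indicator hSm
  calc ∫⁻ x in S ∩ (fun x => x + h) ⁻¹' S, ‖u (x + h) - u x‖ₑ ∂μ
      ≤ ∫⁻ x in S ∩ (fun x => x + h) ⁻¹' S, (∫⁻ t in Ioc (0 : ℝ) 1,
          S.indicator (fun x => ‖lineDeriv ℝ u x h‖ₑ) (x + t • h)) ∂μ := by
        refine setLIntegral_mono' hTm fun x hx => ?_
        have hf : LipschitzWith (K * ‖h‖₊) fun t : ℝ => u (x + t • h) := by
          refine hu.comp (LipschitzWith.of_dist_le_mul fun s t => ?_)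
          rw [dist_add_left, dist_eq_norm, ← sub_smul, norm_smul, mul_comm, dist_eq_norm]
          rfl
        have key := hf.enorm_sub_le_lintegral_enorm_deriv
        simp only [one_smul, zero_smul, add_zero] at key
        refine key.trans (setLIntegral_mono' measurableSet_Ioc fun t ht => ?_)
        have hmem : x + t • h ∈ S := by
          have := hS.add_smul_sub_mem hx.1 hx.2 ⟨ht.1.le, ht.2⟩
          simpa using this
        rw [indicator_of_mem hmem, lineDeriv]
        have : deriv (fun t : ℝ => u (x + t • h)) t
            = deriv (fun r : ℝ => u (x + t • h + r • h)) 0 := by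
          have := deriv_comp_const_add (fun t : ℝ => u (x + t • h)) t 0
          rw [add_zero] at this
          rw [← this]
          simp only [add_smul, add_assoc]
        rw [this]
    _ ≤ ∫⁻ x, (∫⁻ t in Ioc (0 : ℝ) 1,
          S.indicator (fun x => ‖lineDeriv ℝ u x h‖ₑ) (x + t • h)) ∂μ :=
        setLIntegral_le_lintegral _ _
    _ = ∫⁻ t in Ioc (0 : ℝ) 1, (∫⁻ x,
          S.indicator (fun x => ‖lineDeriv ℝ u x h‖ₑ) (x + t • h) ∂μ) := by
        refine lintegral_lintegral_swap (Measurable.aemeasurable ?_)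
        exact hg.comp (by fun_prop : Measurable fun p : E × ℝ => p.1 + p.2 • h)
    _ = ∫⁻ x in S, ‖lineDeriv ℝ u x h‖ₑ ∂μ := by
        simp only [lintegral_add_right_eq_self, lintegral_indicator hSm, lintegral_const]
        simp
    _ ≤ ∫⁻ x in S, ‖h‖ₑ * ‖fderiv ℝ u x‖ₑ ∂μ := by
        refine lintegral_mono_ae (ae_restrict_of_ae ?_)
        filter_upwards [hu.ae_differentiableAt (μ := μ)] with x hx
        rw [hx.lineDeriv_eq_fderiv, mul_comm]
        exact (fderiv ℝ u x).le_opENorm h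
    _ = ‖h‖ₑ * ∫⁻ x in S, ‖fderiv ℝ u x‖ₑ ∂μ :=
        lintegral_const_mul _ (measurable_fderiv ℝ u).enorm

/-- Change of variables `(x, y) = (x, x + h)` in an integral over `S × S`. -/
theorem setLIntegral_prod_self_eq_lintegral_translate {S : Set E} (hSm : MeasurableSet S)
    {F : E × E → ENNReal} (hF : Measurable F) :
    ∫⁻ p in S ×ˢ S, F p ∂(μ.prod μ)
      = ∫⁻ h, ∫⁻ x in S ∩ (fun x => x + h) ⁻¹' S, F (x, x + h) ∂μ ∂μ := by
  have hG : Measurable ((S ×ˢ S).indicator F) := hF.indicator (hSm.prod hSm)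
  rw [← lintegral_indicator (hSm.prod hSm), lintegral_prod _ hG.aemeasurable]
  calc ∫⁻ x, ∫⁻ y, (S ×ˢ S).indicator F (x, y) ∂μ ∂μ
      = ∫⁻ x, ∫⁻ h, (S ×ˢ S).indicator F (x, x + h) ∂μ ∂μ := by
        refine lintegral_congr fun x => ?_
        exact (lintegral_add_left_eq_self (fun y => (S ×ˢ S).indicator F (x, y)) x).symm
    _ = ∫⁻ h, ∫⁻ x, (S ×ˢ S).indicator F (x, x + h) ∂μ ∂μ := by
        refine lintegral_lintegral_swap (Measurable.aemeasurable ?_)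
        exact hG.comp (by fun_prop : Measurable fun p : E × E => (p.1, p.1 + p.2))
    _ = _ := by
        refine lintegral_congr fun h => ?_
        rw [← lintegral_indicator (hSm.inter ((measurable_add_const h) hSm))]
        rfl

variable (μ) in
/-- The integral of the kernel `‖h‖^{-(d+s)}` against `min (a‖h‖) b`, estimated by splitting at radius `r`. -/
theorem lintegral_rpow_norm_mul_min_le [Nontrivial E] {a b s : ℝ} (ha : 0 ≤ a) (hb : 0 ≤ b)
    (hs0 : 0 < s) (hs1 : s < 1) {r : ℝ} (hr : 0 < r) :
    ∫⁻ h : E, ENNReal.ofReal (‖h‖ ^ (-((Module.finrank ℝ E : ℝ) + s)) * min (a * ‖h‖) b) ∂μ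
      ≤ ENNReal.ofReal (Module.finrank ℝ E * μ.real (ball 0 1) *
          (a * (r ^ (1 - s) / (1 - s)) + b * (r ^ (-s) / s))) := by
  set d := Module.finrank ℝ E with hd
  have hdpos : 0 < d := Module.finrank_pos
  let f : ℝ → ℝ := fun t =>
    if t ≤ r then a * t ^ (-((d : ℝ) + s) + 1) else b * t ^ (-((d : ℝ) + s))
  have hf1 : ∀ y ∈ Ioc 0 r, y ^ (d - 1) • f y = a * y ^ (-s) := by
    intro y hy
    simp only [f, if_pos hy.2, smul_eq_mul]
    rw [← rpow_natCast, mul_left_comm, ← rpow_add hy.1, Nat.cast_sub hdpos]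
    congr 2; push_cast; ring
  have hf2 : ∀ y ∈ Ioi r, y ^ (d - 1) • f y = b * y ^ (-1 - s) := by
    intro y hy
    simp only [f, if_neg (not_le.2 (mem_Ioi.1 hy)), smul_eq_mul]
    rw [← rpow_natCast, mul_left_comm, ← rpow_add (hr.trans hy), Nat.cast_sub hdpos]
    congr 2; push_cast; ring
  have hi1 : IntegrableOn (fun y => y ^ (d - 1) • f y) (Ioc 0 r) := by
    rw [integrableOn_congr_fun hf1 measurableSet_Ioc]
    exact (((intervalIntegral.intervalIntegrable_rpow' (by linarith)).const_mul a).1)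
  have hi2 : IntegrableOn (fun y => y ^ (d - 1) • f y) (Ioi r) := by
    rw [integrableOn_congr_fun hf2 measurableSet_Ioi]
    exact (integrableOn_Ioi_rpow_of_lt (by linarith) hr).const_mul b
  have hI : Integrable (fun h : E => f ‖h‖) μ := by
    rw [integrable_fun_norm_addHaar, ← Ioc_union_Ioi_eq_Ioi hr.le]
    exact hi1.union hi2
  have hval : ∫ h : E, f ‖h‖ ∂μ = d * μ.real (ball 0 1) *
          (a * (r ^ (1 - s) / (1 - s)) + b * (r ^ (-s) / s)) := by
    rw [integral_fun_norm_addHaar, ← Ioc_union_Ioi_eq_Ioi hr.le,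
      setIntegral_union (Ioc_disjoint_Ioi le_rfl) measurableSet_Ioi hi1 hi2,
      setIntegral_congr_fun measurableSet_Ioc hf1, setIntegral_congr_fun measurableSet_Ioi hf2,
      integral_const_mul, integral_const_mul, integral_Ioi_rpow_of_lt (by linarith) hr,
      ← intervalIntegral.integral_of_le hr.le, integral_rpow (Or.inl (by linarith)),
      zero_rpow (by linarith), nsmul_eq_mul, smul_eq_mul, ← hd,
      show -1 - s + 1 = -s by ring, show -s + 1 = 1 - s by ring, neg_div_neg_eq, sub_zero,
      mul_assoc]
  have hf0 : ∀ t, 0 ≤ t → 0 ≤ f t := by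
    intro t ht
    simp only [f]
    split_ifs <;> positivity
  rw [← hval, ofReal_integral_eq_lintegral_ofReal hI (.of_forall fun h => hf0 _ (norm_nonneg h))]
  refine lintegral_mono_ae ?_
  have : ∀ᵐ h : E ∂μ, h ≠ 0 := by simp [ae_iff]
  filter_upwards [this] with h hh
  have hpos : 0 < ‖h‖ := norm_pos_iff.2 hh
  refine ENNReal.ofReal_le_ofReal ?_
  simp only [f]
  split_ifs
  · rw [rpow_add_one hpos.ne', mul_left_comm]
    gcongr
    exact min_le_left _ _
  · rw [mul_comm b]
    gcongr
    exact min_le_right _ _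

/-- The optimal radius `r = m / a` in the splitting estimate. -/
theorem mul_add_mul_rpow_div_le {a m s : ℝ} (ha : 0 < a) (hm : 0 < m) (hs0 : 0 < s) (hs1 : s < 1) :
    a * ((m / a) ^ (1 - s) / (1 - s)) + 2 * m * ((m / a) ^ (-s) / s)
      ≤ 2 / ((1 - s) * s) * a ^ s * m ^ (1 - s) := by
  have h1 : a * (m / a) ^ (1 - s) = a ^ s * m ^ (1 - s) := by
    rw [div_rpow hm.le ha.le, show s = 1 - (1 - s) by ring, rpow_sub ha, rpow_one, sub_sub_cancel]
    field_simp
  have h2 : m * (m / a) ^ (-s) = a ^ s * m ^ (1 - s) := by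
    rw [div_rpow hm.le ha.le, rpow_neg ha.le, sub_eq_add_neg, rpow_add hm, rpow_one, div_inv_eq_mul]
    ring
  have hs : 0 < 1 - s := by linarith
  have hX : 0 ≤ a ^ s * m ^ (1 - s) := by positivity
  calc a * ((m / a) ^ (1 - s) / (1 - s)) + 2 * m * ((m / a) ^ (-s) / s)
      = (a * (m / a) ^ (1 - s)) / (1 - s) + 2 * (m * (m / a) ^ (-s)) / s := by ring
    _ = (2 - s) / ((1 - s) * s) * (a ^ s * m ^ (1 - s)) := by
        rw [h1, h2]; field_simp; ring
    _ ≤ 2 / ((1 - s) * s) * (a ^ s * m ^ (1 - s)) := by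
        gcongr; linarith
    _ = _ := by ring

variable (μ) in
/-- Gagliardo interpolation for globally Lipschitz functions, on a convex set of finite measure. -/
theorem LipschitzWith.lintegral_gagliardo_le [Nontrivial E] {u : E → ℝ} {K : NNReal}
    (hu : LipschitzWith K u) {S : Set E} (hS : Convex ℝ S) (hSm : MeasurableSet S)
    (hSfin : μ S ≠ ⊤) (hu1 : ∀ x ∈ S, |u x| ≤ 1) {s : ℝ} (hs0 : 0 < s) (hs1 : s < 1) :
    ∫⁻ p in S ×ˢ S, ENNReal.ofReal
        (|u p.1 - u p.2| ^ 2 * ‖p.1 - p.2‖ ^ (-((Module.finrank ℝ E : ℝ) + s))) ∂(μ.prod μ)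
      ≤ ENNReal.ofReal (4 * Module.finrank ℝ E * μ.real (ball 0 1) / ((1 - s) * s) *
          (∫ x in S, ‖fderiv ℝ u x‖ ∂μ) ^ s * (∫ x in S, |u x| ∂μ) ^ (1 - s)) := by
  have hum : Measurable u := hu.continuous.measurable
  have : IsFiniteMeasure (μ.restrict S) := ⟨by simpa using hSfin.lt_top⟩
  have hDi : Integrable (fderiv ℝ u) (μ.restrict S) :=
    .of_bound (measurable_fderiv ℝ u).aestronglyMeasurable K
      (.of_forall fun x => norm_fderiv_le_of_lipschitz ℝ hu)
  have hui : Integrable u (μ.restrict S) :=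
    .of_bound hum.aestronglyMeasurable 1
      ((ae_restrict_iff' hSm).2 (.of_forall fun x hx => hu1 x hx))
  have hA := ofReal_integral_norm_eq_lintegral_enorm hDi
  have hM := ofReal_integral_norm_eq_lintegral_enorm hui
  simp only [Real.norm_eq_abs (u _)] at hM
  set a := ∫ x in S, ‖fderiv ℝ u x‖ ∂μ
  set m := ∫ x in S, |u x| ∂μ
  have ha0 : 0 ≤ a := integral_nonneg fun x => norm_nonneg _
  have hm0 : 0 ≤ m := integral_nonneg fun x => abs_nonneg _
  set q : ℝ := -((Module.finrank ℝ E : ℝ) + s)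
  have hF : Measurable fun p : E × E =>
      ENNReal.ofReal (|u p.1 - u p.2| ^ 2 * ‖p.1 - p.2‖ ^ q) := by fun_prop
  have hbound : ∫⁻ p in S ×ˢ S, ENNReal.ofReal
        (|u p.1 - u p.2| ^ 2 * ‖p.1 - p.2‖ ^ q) ∂(μ.prod μ)
      ≤ 2 * ∫⁻ h : E, ENNReal.ofReal (‖h‖ ^ q * min (a * ‖h‖) (2 * m)) ∂μ := by
    rw [setLIntegral_prod_self_eq_lintegral_translate hSm hF,
      ← lintegral_const_mul _ (by fun_prop)]
    refine lintegral_mono fun h => ?_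
    have hq : 0 ≤ ‖h‖ ^ q := by positivity
    calc ∫⁻ x in S ∩ (fun x => x + h) ⁻¹' S,
          ENNReal.ofReal (|u x - u (x + h)| ^ 2 * ‖x - (x + h)‖ ^ q) ∂μ
        ≤ ∫⁻ x in S ∩ (fun x => x + h) ⁻¹' S,
            ENNReal.ofReal (2 * ‖h‖ ^ q) * ‖u (x + h) - u x‖ₑ ∂μ := by
          refine setLIntegral_mono' (hSm.inter ((measurable_add_const h) hSm)) fun x hx => ?_
          rw [Real.enorm_eq_ofReal_abs, ← ENNReal.ofReal_mul (by positivity), abs_sub_comm,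
            sub_add_cancel_left, norm_neg]
          refine ENNReal.ofReal_le_ofReal ?_
          have h2 : |u (x + h) - u x| ≤ 2 :=
            (abs_sub _ _).trans (by linarith [hu1 x hx.1, hu1 (x + h) hx.2])
          have h0 := abs_nonneg (u (x + h) - u x)
          calc |u (x + h) - u x| ^ 2 * ‖h‖ ^ q
              ≤ (2 * |u (x + h) - u x|) * ‖h‖ ^ q := by gcongr; nlinarith
            _ = _ := by ring
      _ = ENNReal.ofReal (2 * ‖h‖ ^ q) *
            ∫⁻ x in S ∩ (fun x => x + h) ⁻¹' S, ‖u (x + h) - u x‖ₑ ∂μ :=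
          lintegral_const_mul _ (by fun_prop)
      _ ≤ ENNReal.ofReal (2 * ‖h‖ ^ q) * ENNReal.ofReal (min (a * ‖h‖) (2 * m)) := by
          gcongr
          rw [ENNReal.ofReal_min]
          refine le_min ?_ ?_
          · rw [ENNReal.ofReal_mul ha0, hA, ofReal_norm, mul_comm]
            exact hu.lintegral_enorm_translate_sub_le hS hSm h
          · rw [ENNReal.ofReal_mul two_pos.le, hM, ENNReal.ofReal_ofNat]
            exact lintegral_enorm_translate_sub_le_two_mul hum hSm h
      _ = 2 * ENNReal.ofReal (‖h‖ ^ q * min (a * ‖h‖) (2 * m)) := by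
          rw [ENNReal.ofReal_mul two_pos.le, ENNReal.ofReal_mul hq, ENNReal.ofReal_ofNat, mul_assoc]
  refine hbound.trans ?_
  rcases ha0.eq_or_lt with ha | ha
  · simp [← ha, hm0]
  rcases hm0.eq_or_lt with hm | hm
  · simp [← hm, mul_nonneg ha0]
  calc 2 * ∫⁻ h : E, ENNReal.ofReal (‖h‖ ^ q * min (a * ‖h‖) (2 * m)) ∂μ
      ≤ 2 * ENNReal.ofReal (Module.finrank ℝ E * μ.real (ball 0 1) *
          (a * ((m / a) ^ (1 - s) / (1 - s)) + 2 * m * ((m / a) ^ (-s) / s))) := by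
        gcongr
        exact lintegral_rpow_norm_mul_min_le μ ha0 (by positivity) hs0 hs1 (by positivity)
    _ ≤ _ := by
        rw [← ENNReal.ofReal_ofNat 2, ← ENNReal.ofReal_mul two_pos.le]
        refine ENNReal.ofReal_le_ofReal ?_
        calc 2 * (Module.finrank ℝ E * μ.real (ball 0 1) *
              (a * ((m / a) ^ (1 - s) / (1 - s)) + 2 * m * ((m / a) ^ (-s) / s)))
            ≤ 2 * (Module.finrank ℝ E * μ.real (ball 0 1) *
              (2 / ((1 - s) * s) * a ^ s * m ^ (1 - s))) := by
              gcongr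
              exact mul_add_mul_rpow_div_le ha hm hs0 hs1
          _ = _ := by ring

end Translation

/-- Interpolation inequality for the Gagliardo seminorm of a Lipschitz function
`u : B₁ → [-1,1]` on the unit ball of `ℝ^n`:
`∬_{B₁×B₁} |u(x)-u(y)|²|x-y|^{-(n+s)} ≤ C(n)/((1-s)s) · (∫_{B₁}|∇u|)^s (∫_{B₁}|u|)^{1-s}`. -/
theorem gagliardo_interpolation (n : ℕ) (hn : 1 ≤ n) :
    ∃ C : ℝ, 0 < C ∧
      ∀ s : ℝ, s ∈ Set.Ioo (0 : ℝ) 1 →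
      ∀ (u : EuclideanSpace ℝ (Fin n) → ℝ) (K : NNReal),
        LipschitzOnWith K u (Metric.ball 0 1) →
        (∀ x ∈ Metric.ball (0 : EuclideanSpace ℝ (Fin n)) 1, u x ∈ Set.Icc (-1 : ℝ) 1) →
        (∫⁻ p in (Metric.ball (0 : EuclideanSpace ℝ (Fin n)) 1) ×ˢ
              (Metric.ball (0 : EuclideanSpace ℝ (Fin n)) 1),
            ENNReal.ofReal (|u p.1 - u p.2| ^ 2 * ‖p.1 - p.2‖ ^ (-((n : ℝ) + s))))
          ≤ ENNReal.ofReal (C / ((1 - s) * s) *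
              (∫ x in Metric.ball (0 : EuclideanSpace ℝ (Fin n)) 1, ‖fderiv ℝ u x‖) ^ s *
              (∫ x in Metric.ball (0 : EuclideanSpace ℝ (Fin n)) 1, |u x|) ^ (1 - s)) := by
  have : Nonempty (Fin n) := ⟨⟨0, hn⟩⟩
  have hball : 0 < volume.real (ball (0 : EuclideanSpace ℝ (Fin n)) 1) :=
    ENNReal.toReal_pos (measure_ball_pos volume _ one_pos).ne' measure_ball_lt_top.ne
  have hn' : (0 : ℝ) < n := by exact_mod_cast hn
  refine ⟨4 * n * volume.real (ball (0 : EuclideanSpace ℝ (Fin n)) 1), by positivity, ?_⟩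
  rintro s ⟨hs0, hs1⟩ u K hu hu1
  obtain ⟨v, hv, huv⟩ := hu.extend_real
  have key := hv.lintegral_gagliardo_le volume (convex_ball 0 1) measurableSet_ball
    measure_ball_lt_top.ne (fun x hx => by rw [← huv hx]; exact abs_le.2 (hu1 x hx)) hs0 hs1
  have hD : ∫ x in ball 0 1, ‖fderiv ℝ u x‖ = ∫ x in ball 0 1, ‖fderiv ℝ v x‖ := by
    refine setIntegral_congr_fun measurableSet_ball fun x hx => ?_
    have := (huv.eventuallyEq_of_mem (isOpen_ball.mem_nhds hx)).fderiv_eq (𝕜 := ℝ)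
    simp only [this]
  have hM : ∫ x in ball 0 1, |u x| = ∫ x in ball 0 1, |v x| :=
    setIntegral_congr_fun measurableSet_ball fun x hx => by simp only [huv hx]
  rw [hD, hM]
  rw [finrank_euclideanSpace_fin] at key
  refine le_trans (le_of_eq ?_) key
  refine setLIntegral_congr_fun (measurableSet_ball.prod measurableSet_ball) fun p hp => ?_
  simp only [huv hp.1, huv hp.2]
end

section
/- Covering lemma for subadditive functions on cubes: let n ≥ 1, m ≥ 0, θ ∈ (0,1), D₀ > 0, β > 0 and M₀ > 0. Let 𝔅 be the family of open cubes Q_r(x) := x + (-r/2,r/2)^n contained in Q₁(0) ⊆ ℝ^n, and let S : 𝔅 → [0,∞) be subadditive for finite unions, i.e. S(Q) ≤ Σ_i S(Q_i) whenever Q ⊆ ∪_i Q_i is a finite union of cubes in 𝔅. Assume: (i) sup{S(Q_r(x)) : Q_r(x) ∈ 𝔅} → 0 as r → 0; (ii) whenever Q_r(x₀), Q_r(x₁), …, Q_r(x_m) ⊆ Q₁(0) are m+1 pairwise disjoint cubes of the same side r at pairwise distance at least D₀·r, there exists i ∈ {0,…,m} such that S(Q_{θr}(x_i)) ≤ r^β·M₀.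 Then S(Q_{1/2}(0)) ≤ C·M₀ for some constant C = C(n,θ,m,β,D₀) > 0. -/
open MeasureTheory Real Set Metric

noncomputable section

/-- Euclidean `n`-space. -/
abbrev Rn (n : ℕ) : Type := EuclideanSpace ℝ (Fin n)

/-- The open hypercube of center `x` and side length `r`. -/
def cube (n : ℕ) (x : Rn n) (r : ℝ) : Set (Rn n) := {y | ∀ i, |y i - x i| < r / 2}

/-- Distance between two subsets of a metric space. -/
def setDist {α : Type*} [PseudoMetricSpace α] (A B : Set α) : ℝ :=
  sInf (Set.image2 dist A B)

/-- A set contained in a cube of side `a` is covered by a number of cubes of side `b` centered in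
the set which depends only on `a / b` and the dimension. -/
lemma exists_finset_cover_cube {n : ℕ} (E : Set (Rn n)) (y : Rn n) {a b : ℝ} (hb : 0 < b)
    (hE : E ⊆ cube n y a) :
    ∃ T : Finset (Rn n), (T : Set (Rn n)) ⊆ E ∧ T.card ≤ (2 * ⌈a / b⌉₊ + 1) ^ n ∧
      E ⊆ ⋃ z ∈ T, cube n z b := by
  classical
  let φ : Rn n → Fin n → ℤ := fun x i => ⌊(x i - y i) * 2 / b⌋
  let I : Finset (Fin n → ℤ) :=
    Fintype.piFinset fun _ => Finset.Ico (-(⌈a / b⌉₊ : ℤ)) (⌈a / b⌉₊ + 1)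
  have hI : ∀ x ∈ E, φ x ∈ I := by
    intro x hx
    refine Fintype.mem_piFinset.2 fun i => ?_
    have h := abs_lt.1 (hE hx i)
    have hc := Nat.le_ceil (a / b)
    rw [div_le_iff₀ hb] at hc
    rw [Finset.mem_Ico]
    constructor
    · rw [Int.le_floor, le_div_iff₀ hb]
      push_cast
      linarith
    · rw [Int.floor_lt, div_lt_iff₀ hb]
      push_cast
      linarith
  let J := I.filter fun k => ∃ x ∈ E, φ x = k
  have hJ : ∀ k ∈ J, ∃ x ∈ E, φ x = k := fun k hk => (Finset.mem_filter.1 hk).2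
  choose! g hgE hgφ using hJ
  refine ⟨J.image g, ?_, ?_, ?_⟩
  · intro z hz
    obtain ⟨k, hk, rfl⟩ := Finset.mem_image.1 (Finset.mem_coe.1 hz)
    exact hgE k hk
  · calc (J.image g).card ≤ J.card := Finset.card_image_le
      _ ≤ I.card := Finset.card_filter_le _ _
      _ = (2 * ⌈a / b⌉₊ + 1) ^ n := by
        simp only [I, Fintype.card_piFinset, Int.card_Ico, Finset.prod_const, Finset.card_univ,
          Fintype.card_fin]
        congr 1
        omega
  · intro x hx
    have hk : φ x ∈ J := Finset.mem_filter.2 ⟨hI x hx, x, hx, rfl⟩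
    refine mem_biUnion (Finset.mem_coe.2 (Finset.mem_image_of_mem g hk)) fun i => ?_
    have h := Int.abs_sub_lt_one_of_floor_eq_floor (congrFun (hgφ _ hk) i)
    rw [← sub_div, ← sub_mul, abs_div, abs_mul, abs_of_pos hb, div_lt_one hb, abs_two,
      sub_sub_sub_cancel_right, abs_sub_comm] at h
    linarith

/-- A cube centered in `Q_{1/2}(0)` of side at most `1/2` is contained in `Q₁(0)`. -/
lemma cube_subset_unit_cube {n : ℕ} {x : Rn n} {r : ℝ} (hx : x ∈ cube n 0 (1 / 2))
    (hr : r ≤ 1 / 2) : cube n x r ⊆ cube n 0 1 := by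
  intro y hy i
  have h1 := abs_lt.1 (hx i)
  have h2 := abs_lt.1 (hy i)
  simp only [PiLp.zero_apply, sub_zero] at h1 ⊢
  rw [abs_lt]
  constructor <;> linarith

lemma self_mem_cube {n : ℕ} (x : Rn n) {r : ℝ} (hr : 0 < r) : x ∈ cube n x r := by
  intro i
  simpa using hr

/-- Points of two cubes of side `r` whose centers differ by `r + d` in some coordinate are at
distance at least `d`. -/
lemma le_dist_of_mem_cube {n : ℕ} {x y p q : Rn n} {r d : ℝ} {i : Fin n}
    (h : r + d ≤ |x i - y i|) (hp : p ∈ cube n x r) (hq : q ∈ cube n y r) : d ≤ dist p q := by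
  have h1 := hp i
  have h2 := hq i
  have h3 : |p i - q i| ≤ dist p q := by
    rw [← Real.dist_eq]
    exact PiLp.dist_apply_le p q i
  have h4 : |x i - y i| ≤ |p i - x i| + |p i - q i| + |q i - y i| := by
    rw [abs_sub_comm (p i) (x i)]
    exact (abs_sub_le _ (q i) _).trans (add_le_add_left (abs_sub_le _ _ _) _)
  linarith

/-- If among any `m + 1` points of a finite set two are not `R`-related, then at most `m` of them
suffice for every other point of the set not to be `R`-related to one of them. -/
lemma exists_small_dominating {α : Type*} (R : α → α → Prop) (hR : ∀ a b, R a b → R b a) (m : ℕ)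
    (B : Finset α)
    (h : ∀ x : Fin (m + 1) → α, (∀ i, x i ∈ B) → ¬ ∀ i j, i ≠ j → R (x i) (x j)) :
    ∃ F ⊆ B, F.card ≤ m ∧ ∀ z ∈ B, z ∈ F ∨ ∃ f ∈ F, ¬ R z f := by
  classical
  let P : Finset (Finset α) := B.powerset.filter fun F : Finset α => (F : Set α).Pairwise R
  have hP : P.Nonempty := ⟨∅, by simp [P]⟩
  obtain ⟨F, hF, hmax⟩ := P.exists_max_image Finset.card hP
  have hF' := Finset.mem_filter.1 hF
  have hFB := Finset.mem_powerset.1 hF'.1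
  refine ⟨F, hFB, ?_, ?_⟩
  · by_contra! hlt
    obtain ⟨F', hF'F, hcard⟩ := Finset.exists_subset_card_eq (Nat.succ_le_of_lt hlt)
    let e := F'.equivFinOfCardEq hcard
    refine h (fun i => (e.symm i : α)) (fun i => hFB (hF'F (e.symm i).2)) fun i j hij => ?_
    refine hF'.2 (hF'F (e.symm i).2) (hF'F (e.symm j).2) fun heq => hij ?_
    exact e.symm.injective (Subtype.ext heq)
  · intro z hz
    by_contra! hcon
    have hins : insert z F ∈ P := by
      refine Finset.mem_filter.2 ⟨Finset.mem_powerset.2 (Finset.insert_subset hz hFB), ?_⟩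
      intro a ha b hb hab
      rcases Finset.mem_insert.1 ha with rfl | haF <;>
        rcases Finset.mem_insert.1 hb with rfl | hbF
      · exact absurd rfl hab
      · exact hcon.2 b hbF
      · exact hR _ _ (hcon.2 a haF)
      · exact hF'.2 haF hbF hab
    have := hmax _ hins
    rw [Finset.card_insert_of_notMem hcon.1] at this
    omega

/-- One refinement of the covering of `Q_{1/2}(0)`: the cubes of side `2 K r` are replaced by
boundedly many cubes on which `S` is small and by at most `m` cubes of side `K r`. -/
lemma refine_cover {n m : ℕ} {θ D₀ t r : ℝ} {S : Rn n → ℝ → ℝ} (hθ : θ ∈ Set.Ioo (0 : ℝ) 1)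
    (hD₀ : 0 < D₀) (hr : 0 < r) (hr' : r ≤ 1 / 2)
    (hS : ∀ x : Fin (m + 1) → Rn n, (∀ i, cube n (x i) r ⊆ cube n 0 1) →
      (∀ i j, i ≠ j → Disjoint (cube n (x i) r) (cube n (x j) r)) →
      (∀ i j, i ≠ j → D₀ * r ≤ setDist (cube n (x i) r) (cube n (x j) r)) →
      ∃ i, S (x i) (θ * r) ≤ t)
    (U : Set (Rn n)) (V : Finset (Rn n)) (hVm : V.card ≤ m + 1)
    (hcov : cube n 0 (1 / 2) ⊆ U ∪ ⋃ y ∈ V, cube n y ((3 + 2 * D₀) * (2 * r))) :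
    ∃ T V' : Finset (Rn n), (∀ z ∈ T, z ∈ cube n 0 (1 / 2)) ∧ (∀ z ∈ T, S z (θ * r) ≤ t) ∧
      T.card ≤ (m + 1) * (2 * ⌈(3 + 2 * D₀) * 2 / θ⌉₊ + 1) ^ n ∧
      (∀ z ∈ V', z ∈ cube n 0 (1 / 2)) ∧ V'.card ≤ m + 1 ∧
      cube n 0 (1 / 2) ⊆ (U ∪ ⋃ z ∈ T, cube n z (θ * r)) ∪
        ⋃ y ∈ V', cube n y ((3 + 2 * D₀) * r) := by
  classical
  have hθr : 0 < θ * r := mul_pos hθ.1 hr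
  choose T hTE hTc hTcov using fun y : Rn n =>
    exists_finset_cover_cube (cube n 0 (1 / 2) ∩ cube n y ((3 + 2 * D₀) * (2 * r))) y hθr
      inter_subset_right
  have hratio : (3 + 2 * D₀) * (2 * r) / (θ * r) = (3 + 2 * D₀) * 2 / θ := by
    rw [← mul_assoc, mul_div_mul_right _ _ hr.ne']
  rw [hratio] at hTc
  let W := V.biUnion T
  have hW : ∀ z ∈ W, z ∈ cube n 0 (1 / 2) := by
    intro z hz
    obtain ⟨y, -, hzy⟩ := Finset.mem_biUnion.1 hz
    exact (hTE y hzy).1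
  let R : Rn n → Rn n → Prop := fun z w => ∃ i, r + D₀ * r ≤ |z i - w i|
  have hRsymm : ∀ z w, R z w → R w z := fun z w ⟨i, hi⟩ => ⟨i, by rwa [abs_sub_comm]⟩
  have hDr : 0 < D₀ * r := mul_pos hD₀ hr
  obtain ⟨F, hFB, hFm, hF⟩ := exists_small_dominating R hRsymm m
      (W.filter fun z => ¬ S z (θ * r) ≤ t) <| by
    intro x hx hsep
    obtain ⟨i, hi⟩ := hS x
      (fun i => cube_subset_unit_cube (hW _ (Finset.mem_filter.1 (hx i)).1) hr')
      (fun i j hij => by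
        obtain ⟨k, hk⟩ := hsep i j hij
        refine Set.disjoint_left.2 fun p hp hq => ?_
        have := le_dist_of_mem_cube hk hp hq
        rw [dist_self] at this
        exact absurd this (not_le.2 hDr))
      (fun i j hij => by
        obtain ⟨k, hk⟩ := hsep i j hij
        refine le_csInf ⟨_, mem_image2_of_mem (self_mem_cube _ hr) (self_mem_cube _ hr)⟩ ?_
        rintro _ ⟨p, hp, q, hq, rfl⟩
        exact le_dist_of_mem_cube hk hp hq)
    exact (Finset.mem_filter.1 (hx i)).2 hi
  refine ⟨W.filter fun z => S z (θ * r) ≤ t, F, fun z hz => hW z (Finset.mem_filter.1 hz).1,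
    fun z hz => (Finset.mem_filter.1 hz).2, ?_,
    fun z hz => hW z (Finset.mem_filter.1 (hFB hz)).1, hFm.trans (Nat.le_succ m), ?_⟩
  · calc _ ≤ W.card := Finset.card_filter_le _ _
      _ ≤ V.card * (2 * ⌈(3 + 2 * D₀) * 2 / θ⌉₊ + 1) ^ n :=
        Finset.card_biUnion_le_card_mul _ _ _ fun y _ => hTc y
      _ ≤ _ := Nat.mul_le_mul_right _ hVm
  · intro p hp
    rcases hcov hp with hU | hV
    · exact Or.inl (Or.inl hU)
    obtain ⟨y, hy, hpy⟩ := mem_iUnion₂.1 hV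
    obtain ⟨z, hz, hpz⟩ := mem_iUnion₂.1 (hTcov y ⟨hp, hpy⟩)
    have hzW : z ∈ W := Finset.mem_biUnion.2 ⟨y, hy, hz⟩
    by_cases hgood : S z (θ * r) ≤ t
    · exact Or.inl (Or.inr (mem_iUnion₂.2 ⟨z, Finset.mem_filter.2 ⟨hzW, hgood⟩, hpz⟩))
    have hnear : ∃ f ∈ F, ∀ i, |z i - f i| < r + D₀ * r := by
      rcases hF z (Finset.mem_filter.2 ⟨hzW, hgood⟩) with hzF | ⟨f, hf, hzf⟩
      · exact ⟨z, hzF, fun i => by rw [sub_self, abs_zero]; positivity⟩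
      · exact ⟨f, hf, fun i => not_le.1 fun hi => hzf ⟨i, hi⟩⟩
    obtain ⟨f, hf, hzf⟩ := hnear
    refine Or.inr (mem_iUnion₂.2 ⟨f, hf, fun i => ?_⟩)
    have h1 := hzf i
    have h2 := hpz i
    have h3 := abs_sub_le (p i) (z i) (f i)
    have h4 : θ * r ≤ r := mul_le_of_le_one_left hr.le hθ.2.le
    linarith

/-- Subadditivity over a cover by two finite families of cubes. -/
lemma le_sum_of_subset_union {n : ℕ} {S : Rn n → ℝ → ℝ}
    (hsub : ∀ (x : Rn n) (r : ℝ) (N : ℕ) (c : Fin N → Rn n) (ρ : Fin N → ℝ),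
      0 < r → cube n x r ⊆ cube n 0 1 → (∀ i, 0 < ρ i) →
      (∀ i, cube n (c i) (ρ i) ⊆ cube n 0 1) →
      cube n x r ⊆ ⋃ i, cube n (c i) (ρ i) →
      S x r ≤ ∑ i, S (c i) (ρ i))
    {x : Rn n} {r : ℝ} (hr : 0 < r) (hx : cube n x r ⊆ cube n 0 1)
    (G : Finset (Rn n × ℝ)) (hG : ∀ p ∈ G, 0 < p.2 ∧ cube n p.1 p.2 ⊆ cube n 0 1)
    (hcov : cube n x r ⊆ ⋃ p ∈ G, cube n p.1 p.2) :
    S x r ≤ ∑ p ∈ G, S p.1 p.2 := by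
  let e := G.equivFin
  have h := hsub x r G.card (fun i => (e.symm i).1.1) (fun i => (e.symm i).1.2) hr hx
    (fun i => (hG _ (e.symm i).2).1) (fun i => (hG _ (e.symm i).2).2) (fun y hy => by
      obtain ⟨p, hp, hyp⟩ := mem_iUnion₂.1 (hcov hy)
      refine mem_iUnion.2 ⟨e ⟨p, hp⟩, ?_⟩
      simpa using hyp)
  refine h.trans_eq ?_
  rw [e.symm.sum_comp (fun p : G => S p.1.1 p.1.2), Finset.sum_coe_sort G fun p => S p.1 p.2]

/-- Adding at most `N` cubes centered at `T` of side `ρ`, on each of which `S ≤ t`, increases the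
total by at most `N * t`. -/
lemma sum_union_image_le {n : ℕ} {S : Rn n → ℝ → ℝ} [DecidableEq (Rn n × ℝ)]
    (G : Finset (Rn n × ℝ)) (T : Finset (Rn n)) {ρ t : ℝ} {N : ℕ} (ht : 0 ≤ t)
    (hT : ∀ z ∈ T, S z ρ ≤ t)
    (hTN : T.card ≤ N) :
    ∑ p ∈ G ∪ T.image (fun z => (z, ρ)), S p.1 p.2 ≤ ∑ p ∈ G, S p.1 p.2 + N * t := by
  rw [← Finset.union_sdiff_self_eq_union, Finset.sum_union Finset.disjoint_sdiff]
  gcongr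
  calc ∑ p ∈ T.image (fun z => (z, ρ)) \ G, S p.1 p.2
      ≤ (T.image (fun z => (z, ρ)) \ G).card • t := by
        refine Finset.sum_le_card_nsmul _ _ _ fun p hp => ?_
        obtain ⟨z, hz, rfl⟩ := Finset.mem_image.1 (Finset.mem_sdiff.1 hp).1
        exact hT z hz
    _ ≤ N * t := by
        rw [nsmul_eq_mul]
        gcongr
        exact ((Finset.card_le_card Finset.sdiff_subset).trans Finset.card_image_le).trans hTN

/-- **Covering lemma for subadditive functions on cubes** (Lemma 3.19 of the paper):
if `S` is subadditive on cubes contained in `Q₁(0)`, vanishes uniformly at small scales,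
and among any `m+1` disjoint well-separated cubes of equal side `r` one of them satisfies
`S(Q_{θr}) ≤ r^β M₀`, then `S(Q_{1/2}(0)) ≤ C M₀` with `C = C(n,θ,m,β,D₀)`. -/
theorem covering_lemma_subadditive_cubes
    (n : ℕ) (hn : 1 ≤ n) (m : ℕ) (θ D₀ β : ℝ)
    (hθ : θ ∈ Set.Ioo (0 : ℝ) 1) (hD₀ : 0 < D₀) (hβ : 0 < β) :
    ∃ C : ℝ, 0 < C ∧
    ∀ M₀ : ℝ, 0 < M₀ →
    ∀ S : Rn n → ℝ → ℝ,
      -- nonnegativity on the family of cubes contained in `Q₁(0)`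
      (∀ x r, 0 < r → cube n x r ⊆ cube n 0 1 → 0 ≤ S x r) →
      -- subadditivity for finite unions
      (∀ (x : Rn n) (r : ℝ) (N : ℕ) (c : Fin N → Rn n) (ρ : Fin N → ℝ),
        0 < r → cube n x r ⊆ cube n 0 1 → (∀ i, 0 < ρ i) →
        (∀ i, cube n (c i) (ρ i) ⊆ cube n 0 1) →
        cube n x r ⊆ ⋃ i, cube n (c i) (ρ i) →
        S x r ≤ ∑ i, S (c i) (ρ i)) →
      -- (i) uniform vanishing at small scales
      (∀ δ : ℝ, 0 < δ → ∃ r₀ : ℝ, 0 < r₀ ∧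
        ∀ x r, 0 < r → r ≤ r₀ → cube n x r ⊆ cube n 0 1 → S x r ≤ δ) →
      -- (ii) smallness in one out of m+1 separated cubes of equal side
      (∀ r : ℝ, 0 < r → ∀ x : Fin (m + 1) → Rn n,
        (∀ i, cube n (x i) r ⊆ cube n 0 1) →
        (∀ i j, i ≠ j → Disjoint (cube n (x i) r) (cube n (x j) r)) →
        (∀ i j, i ≠ j → D₀ * r ≤ setDist (cube n (x i) r) (cube n (x j) r)) →
        ∃ i, S (x i) (θ * r) ≤ r ^ β * M₀) →
      S 0 (1 / 2) ≤ C * M₀ := by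
  classical
  obtain ⟨N, hN⟩ : ∃ N : ℕ, N = (m + 1) * (2 * ⌈(3 + 2 * D₀) * 2 / θ⌉₊ + 1) ^ n := ⟨_, rfl⟩
  obtain ⟨K, hK⟩ : ∃ K : ℝ, K = 3 + 2 * D₀ := ⟨_, rfl⟩
  obtain ⟨q, hq⟩ : ∃ q : ℝ, q = (1 / 2 : ℝ) ^ β := ⟨_, rfl⟩
  have hq0 : 0 < q := hq ▸ by positivity
  have hq1 : q < 1 := hq ▸ Real.rpow_lt_one (by norm_num) (by norm_num) hβ
  have hK3 : 3 < K := by linarith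
  have hgeom : ∀ k, ∑ j ∈ Finset.range k, q ^ j ≤ (1 - q)⁻¹ := fun k =>
    (summable_geometric_of_lt_one hq0.le hq1).sum_le_tsum _ (fun j _ => by positivity)
      |>.trans_eq (tsum_geometric_of_lt_one hq0.le hq1)
  have h1q : 0 < 1 - q := sub_pos.2 hq1
  refine ⟨N * (1 - q)⁻¹ + (m + 1), by positivity, ?_⟩
  intro M₀ hM₀ S hnonneg hsub hsmall hsep
  have key : ∀ k : ℕ, ∃ (G : Finset (Rn n × ℝ)) (V : Finset (Rn n)),
      (∀ p ∈ G, 0 < p.2 ∧ cube n p.1 p.2 ⊆ cube n 0 1) ∧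
      ∑ p ∈ G, S p.1 p.2 ≤ N * (∑ j ∈ Finset.range k, q ^ j) * M₀ ∧
      (∀ y ∈ V, y ∈ cube n 0 (1 / 2)) ∧ V.card ≤ m + 1 ∧
      cube n 0 (1 / 2) ⊆ (⋃ p ∈ G, cube n p.1 p.2) ∪
        ⋃ y ∈ V, cube n y (K * ((1 / 2) ^ k / (2 * K))) := by
    intro k
    induction k with
    | zero =>
      refine ⟨∅, {0}, by simp, by simp, ?_, by simp, ?_⟩
      · intro y hy
        rw [Finset.mem_singleton.1 hy]
        exact self_mem_cube _ (by norm_num)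
      · have : K * ((1 / 2) ^ 0 / (2 * K)) = 1 / 2 := by field_simp
        rw [this]
        simp
    | succ k ih =>
      obtain ⟨G, V, hG, hsum, -, hVm, hcov⟩ := ih
      obtain ⟨r, hr⟩ : ∃ r : ℝ, r = (1 / 2) ^ (k + 1) / (2 * K) := ⟨_, rfl⟩
      have hr0 : 0 < r := hr ▸ by positivity
      have hpow : (1 / 2 : ℝ) ^ (k + 1) ≤ 1 := pow_le_one₀ (by norm_num) (by norm_num)
      have hrle : r ≤ (1 / 2) ^ (k + 1) := hr ▸ div_le_self (by positivity) (by linarith)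
      have hrhalf : r ≤ 1 / 2 := by
        rw [hr, div_le_iff₀ (by positivity)]
        linarith
      have h2r : (1 / 2) ^ k / (2 * K) = 2 * r := by
        rw [hr, pow_succ]
        ring
      have hrβ : r ^ β ≤ q ^ k := by
        calc r ^ β ≤ ((1 / 2 : ℝ) ^ (k + 1)) ^ β := Real.rpow_le_rpow hr0.le hrle hβ.le
          _ = q ^ (k + 1) := by rw [hq, Real.rpow_pow_comm (by norm_num)]
          _ ≤ q ^ k := pow_le_pow_of_le_one hq0.le hq1.le (Nat.le_succ k)
      rw [h2r, hK] at hcov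
      obtain ⟨T, V', hTA, hTS, hTc, hV'A, hV'm, hcov'⟩ :=
        refine_cover hθ hD₀ hr0 hrhalf (hsep r hr0) _ V hVm hcov
      rw [← hN] at hTc
      have hθr : 0 < θ * r := mul_pos hθ.1 hr0
      refine ⟨G ∪ T.image (fun z => (z, θ * r)), V', ?_, ?_, hV'A, hV'm, ?_⟩
      · intro p hp
        rcases Finset.mem_union.1 hp with hp | hp
        · exact hG p hp
        · obtain ⟨z, hz, rfl⟩ := Finset.mem_image.1 hp
          exact ⟨hθr, cube_subset_unit_cube (hTA z hz)
            ((mul_le_of_le_one_left hr0.le hθ.2.le).trans hrhalf)⟩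
      · refine (sum_union_image_le G T (by positivity) hTS hTc).trans ?_
        rw [Finset.sum_range_succ]
        have : (N : ℝ) * (r ^ β * M₀) ≤ N * (q ^ k * M₀) := by gcongr
        linarith
      · rw [← hr, hK]
        refine hcov'.trans (union_subset_union_left _ (union_subset ?_ ?_))
        · exact biUnion_subset_biUnion_left fun p hp => Finset.mem_union_left _ hp
        · refine iUnion₂_subset fun z hz => ?_
          exact subset_biUnion_of_mem (u := fun p : Rn n × ℝ => cube n p.1 p.2)
            (x := (z, θ * r)) (Finset.mem_union_right _ (Finset.mem_image_of_mem _ hz))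
  obtain ⟨r₀, hr₀, hS₀⟩ := hsmall M₀ hM₀
  obtain ⟨k, hk⟩ := exists_pow_lt_of_lt_one hr₀ (by norm_num : (1 / 2 : ℝ) < 1)
  obtain ⟨G, V, hG, hsum, hVA, hVm, hcov⟩ := key k
  have hside : K * ((1 / 2) ^ k / (2 * K)) = (1 / 2) ^ k / 2 := by field_simp
  rw [hside] at hcov
  obtain ⟨s, hs⟩ : ∃ s : ℝ, s = (1 / 2) ^ k / 2 := ⟨_, rfl⟩
  rw [← hs] at hcov
  have hs0 : 0 < s := hs ▸ by positivity
  have hpow : (1 / 2 : ℝ) ^ k ≤ 1 := pow_le_one₀ (by norm_num) (by norm_num)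
  have hVQ : ∀ y ∈ V, cube n y s ⊆ cube n 0 1 := fun y hy =>
    cube_subset_unit_cube (hVA y hy) (by linarith)
  have hfin := le_sum_of_subset_union hsub (x := 0) (r := 1 / 2) (by norm_num)
    (cube_subset_unit_cube (self_mem_cube _ (by norm_num)) le_rfl)
    (G ∪ V.image (fun z => (z, s)))
    (fun p hp => by
      rcases Finset.mem_union.1 hp with hp | hp
      · exact hG p hp
      · obtain ⟨z, hz, rfl⟩ := Finset.mem_image.1 hp
        exact ⟨hs0, hVQ z hz⟩)
    (hcov.trans (union_subset
      (biUnion_subset_biUnion_left fun p hp => Finset.mem_union_left _ hp)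
      (iUnion₂_subset fun z hz =>
        subset_biUnion_of_mem (u := fun p : Rn n × ℝ => cube n p.1 p.2) (x := (z, s))
          (Finset.mem_union_right _ (Finset.mem_image_of_mem _ hz)))))
  have hV := sum_union_image_le G V hM₀.le
    (fun z hz => hS₀ z s hs0 (by linarith) (hVQ z hz)) hVm
  have hG' : (N : ℝ) * (∑ j ∈ Finset.range k, q ^ j) * M₀ ≤ N * (1 - q)⁻¹ * M₀ := by
    gcongr
    exact hgeom k
  push_cast at hV
  linarith

end
end

section
/- Borsuk–Ulam balancing lemma: let (X,μ) be a measure space, let 𝔭 ≥ 1 be a natural number, and let A₁,…,A_𝔭 ⊆ X be measurable sets of finite measure. Let f : 𝕊^𝔭 → L¹(μ) be a continuous map which is odd, i.e. f(-a) = -f(a) for all a ∈ 𝕊^𝔭. Then there exists a ∈ 𝕊^𝔭 such that ∫_{A_i} f(a) dμ = 0 for every i = 1,…,𝔭. -/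
open MeasureTheory Metric Set

namespace BorsukUlam

/-- Chains with coefficients in `ZMod 2`, generated by the ordered simplices (lists of vertices);
the empty list spans the augmentation. -/
abbrev Chain (E : Type*) := List E →₀ ZMod 2

section Chains

variable {E : Type*}

/-- The cone with apex `v`. -/
noncomputable def cone (v : E) : Chain E →ₗ[ZMod 2] Chain E :=
  Finsupp.lmapDomain (ZMod 2) (ZMod 2) (List.cons v)

/-- The boundary of an ordered simplex. -/
noncomputable def bdList : List E → Chain E
  | [] => 0
  | v :: l => Finsupp.single l 1 + cone v (bdList l)

/-- The (augmented) boundary operator. -/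
noncomputable def bd : Chain E →ₗ[ZMod 2] Chain E :=
  Finsupp.linearCombination (ZMod 2) bdList

lemma cone_single (v : E) (l : List E) (a : ZMod 2) :
    cone v (Finsupp.single l a) = Finsupp.single (v :: l) a := by
  simp [cone, Finsupp.mapDomain_single]

lemma bd_single (l : List E) : bd (Finsupp.single l 1) = bdList l := by
  simp [bd]

lemma chain_add_self (c : Chain E) : c + c = 0 := by
  ext l
  simpa using CharTwo.add_self_eq_zero (c l)

lemma bd_cone (v : E) (c : Chain E) : bd (cone v c) = c + cone v (bd c) := by
  have h : bd ∘ₗ cone v = LinearMap.id + cone v ∘ₗ bd := by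
    apply Finsupp.lhom_ext'
    intro l
    ext1
    simp [cone_single, bd_single, bdList]
  exact LinearMap.congr_fun h c

lemma bd_bd (c : Chain E) : bd (bd c) = 0 := by
  have h : (bd ∘ₗ bd : Chain E →ₗ[ZMod 2] Chain E) = 0 := by
    apply Finsupp.lhom_ext'
    intro l
    ext1
    simp only [LinearMap.coe_comp, Function.comp_apply, Finsupp.lsingle_apply, bd_single,
      LinearMap.zero_apply, LinearMap.zero_comp]
    induction l with
    | nil => simp [bdList]
    | cons v l ih => simp [bdList, bd_cone, bd_single, ih, chain_add_self]
  exact LinearMap.congr_fun h c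

/-- Chains all of whose simplices satisfy `P`. -/
abbrev chainsOn (P : List E → Prop) : Submodule (ZMod 2) (Chain E) :=
  Finsupp.supported (ZMod 2) (ZMod 2) {l | P l}

lemma map_mem_of_single {M : Type*} [AddCommGroup M] [Module (ZMod 2) M] {P : List E → Prop}
    (φ : Chain E →ₗ[ZMod 2] M) (S : Submodule (ZMod 2) M)
    (h : ∀ l, P l → φ (Finsupp.single l 1) ∈ S) {c : Chain E} (hc : c ∈ chainsOn P) :
    φ c ∈ S := by
  rw [chainsOn, Finsupp.supported_eq_span_single] at hc
  have : Submodule.span (ZMod 2) ((fun i => Finsupp.single i (1 : ZMod 2)) '' {l | P l}) ≤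
      S.comap φ := by
    rw [Submodule.span_le]
    rintro _ ⟨l, hl, rfl⟩
    exact h l hl
  exact this hc

lemma eqOn_of_single {M : Type*} [AddCommGroup M] [Module (ZMod 2) M] {P : List E → Prop}
    (φ ψ : Chain E →ₗ[ZMod 2] M)
    (h : ∀ l, P l → φ (Finsupp.single l 1) = ψ (Finsupp.single l 1)) {c : Chain E}
    (hc : c ∈ chainsOn P) : φ c = ψ c := by
  have := map_mem_of_single (φ - ψ) ⊥ (fun l hl => by simp [h l hl]) hc
  simpa [sub_eq_zero] using this

lemma single_mem_chainsOn {P : List E → Prop} {l : List E} (h : P l) :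
    Finsupp.single l 1 ∈ chainsOn P :=
  Finsupp.single_mem_supported _ _ h

lemma chainsOn_mono {P Q : List E → Prop} (h : ∀ l, P l → Q l) {c : Chain E}
    (hc : c ∈ chainsOn P) : c ∈ chainsOn Q :=
  Finsupp.supported_mono (fun l hl => h l hl) hc

lemma cone_mem_chainsOn {P Q : List E → Prop} {v : E} (h : ∀ l, P l → Q (v :: l)) {c : Chain E}
    (hc : c ∈ chainsOn P) : cone v c ∈ chainsOn Q :=
  map_mem_of_single (cone v) _
    (fun l hl => by rw [cone_single]; exact single_mem_chainsOn (h l hl)) hc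

lemma bdList_mem (l : List E) :
    bdList l ∈ chainsOn fun m => m.Sublist l ∧ m.length + 1 = l.length := by
  induction l with
  | nil => exact Submodule.zero_mem _
  | cons v l ih =>
    refine Submodule.add_mem _ (single_mem_chainsOn ⟨List.sublist_cons_self v l, rfl⟩) ?_
    exact cone_mem_chainsOn (fun m hm => ⟨hm.1.cons_cons v, by simpa using hm.2⟩) ih

/-- The cochain `(v₀, …, vₙ) ↦ ∏ (s vᵢ - s vᵢ₊₁)`, a cup product of `n` coboundaries. -/
def cup (s : ℕ → E → ZMod 2) : ℕ → List E → ZMod 2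
  | 0, [_] => 1
  | n + 1, v :: w :: l => (s n v + s n w) * cup s n (w :: l)
  | _, _ => 0

/-- The cup product of the `0`-cochain `s n` with `cup s n`. -/
def headCup (s : ℕ → E → ZMod 2) (n : ℕ) : List E → ZMod 2
  | [] => 0
  | v :: l => s n v * cup s n (v :: l)

/-- Evaluation of a cochain on chains. -/
noncomputable abbrev eval (u : List E → ZMod 2) : Chain E →ₗ[ZMod 2] ZMod 2 :=
  Finsupp.linearCombination (ZMod 2) u

lemma eval_single (u : List E → ZMod 2) (l : List E) : eval u (Finsupp.single l 1) = u l := by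
  simp

lemma eval_cone (u : List E → ZMod 2) (v : E) (c : Chain E) :
    eval u (cone v c) = eval (fun l => u (v :: l)) c := by
  simp [eval, cone, Finsupp.linearCombination_mapDomain, Function.comp_def]

lemma eval_smul (a : ZMod 2) (u : List E → ZMod 2) (c : Chain E) :
    eval (fun l => a * u l) c = a * eval u c := by
  simp only [eval, Finsupp.linearCombination_apply, Finsupp.sum, Finset.mul_sum, smul_eq_mul]
  exact Finset.sum_congr rfl fun _ _ => by ring

lemma eval_headCup_bdList_of_closed (s : ℕ → E → ZMod 2) (n : ℕ)
    (h : ∀ l, eval (cup s n) (bdList l) = 0) (l : List E) :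
    eval (headCup s n) (bdList l) = cup s (n + 1) l := by
  match l with
  | [] => simp [bdList, cup]
  | [v] => simp [bdList, cup, headCup]
  | v :: w :: l =>
    have h1 := h (v :: w :: l)
    simp only [bdList, map_add, cone_single, eval_single, eval_cone] at h1 ⊢
    simp only [headCup, cup, eval_smul]
    generalize eval (fun l => cup s n (v :: w :: l)) (bdList l) = x at *
    generalize cup s n (w :: l) = y at *
    generalize cup s n (v :: l) = z at *
    generalize s n v = a at *
    generalize s n w = b at *
    revert h1
    revert a b x y z
    decide

lemma eval_headCup_bd_of_closed (s : ℕ → E → ZMod 2) (n : ℕ)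
    (h : ∀ l, eval (cup s n) (bdList l) = 0) (c : Chain E) :
    eval (headCup s n) (bd c) = eval (cup s (n + 1)) c := by
  have h' : eval (headCup s n) ∘ₗ bd = eval (cup s (n + 1)) := by
    apply Finsupp.lhom_ext'
    intro l
    ext1
    simp [bd_single, eval_headCup_bdList_of_closed s n h]
  exact LinearMap.congr_fun h' c

lemma eval_cup_bdList (s : ℕ → E → ZMod 2) (n : ℕ) (l : List E) :
    eval (cup s n) (bdList l) = 0 := by
  induction n generalizing l with
  | zero =>
    match l with
    | [] => simp [bdList]
    | [v] => simp [bdList, cup]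
    | [v, w] => simp [bdList, cone_single, cup, CharTwo.add_self_eq_zero]
    | v :: w :: x :: l =>
      simp only [bdList, map_add, cone_single, eval_single, eval_cone, cup]
      simp [eval, Finsupp.linearCombination_apply]
  | succ n ih =>
    rw [← eval_headCup_bd_of_closed s n ih, ← bd_single, bd_bd, map_zero]

lemma eval_headCup_bd (s : ℕ → E → ZMod 2) (n : ℕ) (c : Chain E) :
    eval (headCup s n) (bd c) = eval (cup s (n + 1)) c :=
  eval_headCup_bd_of_closed s n (eval_cup_bdList s n) c

lemma cup_eq_zero (s : ℕ → E → ZMod 2) {n k : ℕ} (hk : k < n) {l : List E}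
    (h : ∀ v ∈ l, ∀ w ∈ l, s k v = s k w) : cup s n l = 0 := by
  induction n generalizing l with
  | zero => omega
  | succ n ih =>
    match l with
    | [] => rfl
    | [v] => rfl
    | v :: w :: l =>
      rcases Nat.lt_succ_iff_lt_or_eq.1 hk with hk | rfl
      · rw [cup, ih hk fun a ha b hb => h a (List.mem_cons_of_mem _ ha) b
          (List.mem_cons_of_mem _ hb), mul_zero]
      · rw [cup, h v (by simp) w (by simp), CharTwo.add_self_eq_zero, zero_mul]

end Chains

section Antipode

variable {E : Type*} [AddCommGroup E]

/-- The antipodal action on chains. -/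
noncomputable def antipode : Chain E →ₗ[ZMod 2] Chain E :=
  Finsupp.lmapDomain (ZMod 2) (ZMod 2) (List.map Neg.neg)

lemma antipode_single (l : List E) (a : ZMod 2) :
    antipode (Finsupp.single l a) = Finsupp.single (l.map Neg.neg) a := by
  simp [antipode, Finsupp.mapDomain_single]

lemma antipode_cone (v : E) (c : Chain E) :
    antipode (cone v c) = cone (-v) (antipode c) := by
  have h : antipode ∘ₗ cone v = cone (-v) ∘ₗ antipode := by
    apply Finsupp.lhom_ext'
    intro l
    ext1
    simp [cone_single, antipode_single]
  exact LinearMap.congr_fun h c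

lemma antipode_antipode (c : Chain E) : antipode (antipode c) = c := by
  have h : (antipode ∘ₗ antipode : Chain E →ₗ[ZMod 2] Chain E) = LinearMap.id := by
    apply Finsupp.lhom_ext'
    intro l
    ext1
    simp [antipode_single]
  exact LinearMap.congr_fun h c

lemma antipode_bdList (l : List E) : antipode (bdList l) = bdList (l.map Neg.neg) := by
  induction l with
  | nil => simp [bdList]
  | cons v l ih => simp [bdList, antipode_single, antipode_cone, ih]

lemma antipode_bd (c : Chain E) : antipode (bd c) = bd (antipode c) := by
  have h : (antipode ∘ₗ bd : Chain E →ₗ[ZMod 2] Chain E) = bd ∘ₗ antipode := by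
    apply Finsupp.lhom_ext'
    intro l
    ext1
    simp [bd_single, antipode_single, antipode_bdList]
  exact LinearMap.congr_fun h c

lemma antipode_mem_chainsOn {P : List E → Prop} (h : ∀ l, P l → P (l.map Neg.neg)) {c : Chain E}
    (hc : c ∈ chainsOn P) : antipode c ∈ chainsOn P :=
  map_mem_of_single antipode _
    (fun l hl => by rw [antipode_single]; exact single_mem_chainsOn (h l hl)) hc

lemma cup_map_neg (s : ℕ → E → ZMod 2) {n : ℕ} {l : List E}
    (h : ∀ k < n, ∀ v ∈ l, s k (-v) = s k v + 1) : cup s n (l.map Neg.neg) = cup s n l := by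
  induction n generalizing l with
  | zero =>
    match l with
    | [] => rfl
    | [v] => rfl
    | v :: w :: l => rfl
  | succ n ih =>
    match l with
    | [] => rfl
    | [v] => rfl
    | v :: w :: l =>
      have h1 := ih (l := w :: l) fun k hk a ha => h k (by omega) a (List.mem_cons_of_mem _ ha)
      simp only [List.map_cons] at h1
      simp only [List.map_cons, cup, h1, h n (by omega) v (by simp), h n (by omega) w (by simp)]
      congr 1
      generalize s n v = a
      generalize s n w = b
      revert a b
      decide

lemma eval_headCup_add_antipode (s : ℕ → E → ZMod 2) {n : ℕ} {c : Chain E}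
    (hc : c ∈ chainsOn fun l => l ≠ [] ∧ ∀ v ∈ l, ∀ k ≤ n, s k (-v) = s k v + 1) :
    eval (headCup s n) (c + antipode c) = eval (cup s n) c := by
  have := eqOn_of_single (eval (headCup s n) ∘ₗ (LinearMap.id + antipode)) (eval (cup s n))
    (P := fun l => l ≠ [] ∧ ∀ v ∈ l, ∀ k ≤ n, s k (-v) = s k v + 1) ?_ hc
  · simpa using this
  rintro l ⟨hl, h⟩
  match l, hl with
  | v :: l, _ =>
    have h1 := cup_map_neg s (n := n) (l := v :: l) fun k hk w hw => h w hw k hk.le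
    simp only [List.map_cons] at h1
    simp only [LinearMap.coe_comp, Function.comp_apply, LinearMap.add_apply, LinearMap.id_apply,
      map_add, antipode_single, List.map_cons, eval_single, headCup, h1, h v (by simp) n le_rfl]
    generalize s n v = a
    generalize cup s n (v :: l) = b
    revert a b
    decide

/-- A sequence of chains behaving like hemispheres of dimensions `0, …, p`: each has as boundary
the union of the preceding one and of its antipode, and the simplices in dimension `k` have the
property `P k`. -/
structure IsHemispheres (p : ℕ) (P : ℕ → List E → Prop) (c : ℕ → Chain E) : Prop where
  zero : ∃ v, c 0 = Finsupp.single [v] 1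
  bd_succ : ∀ k < p, bd (c (k + 1)) = c k + antipode (c k)
  mem : ∀ k ≤ p, c k ∈ chainsOn (P k)

lemma IsHemispheres.eval_cup {p : ℕ} {P : ℕ → List E → Prop} {c : ℕ → Chain E}
    (hc : IsHemispheres p P c) (s : ℕ → E → ZMod 2)
    (hP : ∀ k ≤ p, ∀ l, P k l → l ≠ [] ∧ ∀ v ∈ l, ∀ j < p, s j (-v) = s j v + 1) :
    ∀ k ≤ p, eval (cup s k) (c k) = 1 := by
  intro k hk
  induction k with
  | zero =>
    obtain ⟨v, hv⟩ := hc.zero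
    rw [hv, eval_single, cup]
  | succ k ih =>
    rw [← eval_headCup_bd, hc.bd_succ k (by omega), eval_headCup_add_antipode, ih (by omega)]
    refine chainsOn_mono (fun l hl => ?_) (hc.mem k (by omega))
    obtain ⟨h1, h2⟩ := hP k (by omega) l hl
    exact ⟨h1, fun v hv j hj => h2 v hv j (by omega)⟩

end Antipode

section Subdivision

variable {E : Type*} [NormedAddCommGroup E] [NormedSpace ℝ E]

/-- The barycenter of the vertices of a simplex. -/
noncomputable def barycenter (l : List E) : E := (l.length : ℝ)⁻¹ • l.sum

/-- Barycentric subdivision of simplices with `n` vertices. -/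
noncomputable def subdiv : ℕ → Chain E →ₗ[ZMod 2] Chain E
  | 0 => LinearMap.id
  | n + 1 => Finsupp.linearCombination (ZMod 2) fun l => cone (barycenter l) (subdiv n (bdList l))

lemma subdiv_succ_single (n : ℕ) (l : List E) :
    subdiv (n + 1) (Finsupp.single l 1) = cone (barycenter l) (subdiv n (bdList l)) := by
  simp [subdiv]

lemma barycenter_map_neg (l : List E) : barycenter (l.map Neg.neg) = -barycenter l := by
  have : (l.map Neg.neg).sum = -l.sum := by
    induction l with
    | nil => simp
    | cons v l ih => simp only [List.map_cons, List.sum_cons, ih]; abel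
  simp [barycenter, this]

lemma antipode_subdiv (n : ℕ) (c : Chain E) :
    antipode (subdiv n c) = subdiv n (antipode c) := by
  induction n generalizing c with
  | zero => rfl
  | succ n ih =>
    have h : (antipode ∘ₗ subdiv (n + 1) : Chain E →ₗ[ZMod 2] Chain E) =
        subdiv (n + 1) ∘ₗ antipode := by
      apply Finsupp.lhom_ext'
      intro l
      ext1
      simp [subdiv_succ_single, antipode_single, antipode_cone, ih, antipode_bdList,
        barycenter_map_neg]
    exact LinearMap.congr_fun h c

lemma bd_subdiv (n : ℕ) {c : Chain E} (hc : c ∈ chainsOn fun l => l.length = n + 1) :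
    bd (subdiv (n + 1) c) = subdiv n (bd c) := by
  have hsingle : ∀ l : List E, l.length = n + 1 →
      bd (subdiv (n + 1) (Finsupp.single l 1)) = subdiv n (bdList l) := by
    induction n generalizing c with
    | zero =>
      intro l hl
      obtain ⟨v, rfl⟩ := List.length_eq_one_iff.1 hl
      simp [bd_cone, bd_single, subdiv, bdList]
    | succ n ih =>
      intro l hl
      have hmem : bdList l ∈ chainsOn fun m => m.length = n + 1 :=
        chainsOn_mono (fun m hm => by have := hm.2; omega) (bdList_mem l)
      have h1 := eqOn_of_single (bd.comp (subdiv (n + 1))) ((subdiv n).comp bd)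
          (P := fun m => m.length = n + 1) (fun m hm => by
            rw [LinearMap.comp_apply, LinearMap.comp_apply, bd_single]; exact ih hmem m hm) hmem
      rw [LinearMap.comp_apply, LinearMap.comp_apply] at h1
      rw [subdiv_succ_single, bd_cone, h1, ← bd_single l, bd_bd, map_zero, map_zero, add_zero]
  have h := eqOn_of_single (bd.comp (subdiv (n + 1))) ((subdiv n).comp bd)
    (P := fun l => l.length = n + 1) (fun l hl => by
      rw [LinearMap.comp_apply, LinearMap.comp_apply, bd_single]; exact hsingle l hl) hc
  rwa [LinearMap.comp_apply, LinearMap.comp_apply] at h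

lemma barycenter_mem_convexHull {l : List E} (hl : l ≠ []) :
    barycenter l ∈ convexHull ℝ {v | v ∈ l} := by
  have hpos : (0 : ℝ) < l.length := by
    exact_mod_cast List.length_pos_iff.2 hl
  have h : barycenter l = ∑ i : Fin l.length, (l.length : ℝ)⁻¹ • l.get i := by
    rw [barycenter, ← Finset.smul_sum]
    congr 1
    conv_lhs => rw [← List.ofFn_get l, List.sum_ofFn]
  rw [h]
  refine (convex_convexHull ℝ _).sum_mem (fun _ _ => by positivity) ?_
    fun i _ => subset_convexHull ℝ _ (List.get_mem l i)
  simp [hpos.ne']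

lemma norm_list_sum_sub_le {δ : ℝ} {l : List E} {w : E} (h : ∀ v ∈ l, dist v w ≤ δ) :
    ‖l.sum - (l.length : ℝ) • w‖ ≤ l.length * δ := by
  induction l with
  | nil => simp
  | cons v l ih =>
    have h1 := ih fun u hu => h u (List.mem_cons_of_mem _ hu)
    have h2 := h v (by simp)
    rw [dist_eq_norm] at h2
    have : (v :: l).sum - ((v :: l).length : ℝ) • w =
        (v - w) + (l.sum - (l.length : ℝ) • w) := by
      simp only [List.sum_cons, List.length_cons, Nat.cast_add, Nat.cast_one, add_smul, one_smul]
      abel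
    rw [this]
    refine (norm_add_le _ _).trans ?_
    push_cast [List.length_cons]
    linarith

lemma dist_barycenter_le {δ : ℝ} (hδ : 0 ≤ δ) {N : ℕ} {l : List E} (hN : l.length ≤ N + 1)
    (h : ∀ v ∈ l, ∀ w ∈ l, dist v w ≤ δ) {w : E} (hw : w ∈ l) :
    dist w (barycenter l) ≤ N / (N + 1) * δ := by
  obtain ⟨l₁, l₂, rfl⟩ := List.append_of_mem hw
  set m := l₁ ++ l₂ with hm
  have hlen : (l₁ ++ w :: l₂).length = m.length + 1 := by simp [hm]; omega
  have hsum : (l₁ ++ w :: l₂).sum = w + m.sum := by simp [hm]; abel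
  have hbound := norm_list_sum_sub_le (l := m) (w := w) (δ := δ) fun v hv =>
    h v (by simp [hm] at hv ⊢; tauto) w (by simp)
  have hn : (m.length : ℝ) ≤ N := by
    rw [hlen] at hN
    exact_mod_cast Nat.le_of_succ_le_succ hN
  have hpos : (0 : ℝ) < (m.length : ℝ) + 1 := by positivity
  have key : barycenter (l₁ ++ w :: l₂) - w =
      ((m.length : ℝ) + 1)⁻¹ • (m.sum - (m.length : ℝ) • w) := by
    rw [barycenter, hlen, hsum]
    push_cast
    rw [eq_inv_smul_iff₀ hpos.ne', smul_sub, smul_inv_smul₀ hpos.ne', add_smul, one_smul]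
    abel
  rw [dist_comm, dist_eq_norm, key, norm_smul, norm_inv, Real.norm_of_nonneg hpos.le]
  calc ((m.length : ℝ) + 1)⁻¹ * ‖m.sum - (m.length : ℝ) • w‖
      ≤ ((m.length : ℝ) + 1)⁻¹ * (m.length * δ) := by gcongr
    _ = (m.length : ℝ) / (m.length + 1) * δ := by field_simp
    _ ≤ N / (N + 1) * δ := by
      gcongr ?_ * δ
      rw [div_le_div_iff₀ hpos (by positivity)]
      nlinarith

lemma subdiv_single_mem {δ : ℝ} (hδ : 0 ≤ δ) {N n : ℕ} (hN : n ≤ N + 1) {l : List E}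
    (hn : l.length = n) (h : ∀ v ∈ l, ∀ w ∈ l, dist v w ≤ δ) :
    subdiv n (Finsupp.single l 1) ∈ chainsOn fun m => m.length = n ∧
      (∀ v ∈ m, v ∈ convexHull ℝ {v | v ∈ l}) ∧
      ∀ v ∈ m, ∀ w ∈ m, dist v w ≤ N / (N + 1) * δ := by
  induction n generalizing l with
  | zero =>
    obtain rfl := List.length_eq_zero_iff.1 hn
    exact single_mem_chainsOn (by simp)
  | succ n ih =>
    have hl : l ≠ [] := by rintro rfl; simp at hn
    have hsub : subdiv n (bdList l) ∈ chainsOn fun m => m.length = n ∧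
        (∀ v ∈ m, v ∈ convexHull ℝ {v | v ∈ l}) ∧
        ∀ v ∈ m, ∀ w ∈ m, dist v w ≤ N / (N + 1) * δ := by
      refine map_mem_of_single (subdiv n) _ (fun m hm => ?_) (bdList_mem l)
      have hml := hm.1.subset
      refine chainsOn_mono (fun q hq => ⟨hq.1, fun v hv => ?_, hq.2.2⟩)
        (ih (by omega) (by have := hm.2; omega) fun v hv w hw => h v (hml hv) w (hml hw))
      exact convexHull_mono (fun _ hx => hml hx) (hq.2.1 v hv)
    rw [subdiv_succ_single]
    refine cone_mem_chainsOn (fun m hm => ?_) hsub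
    obtain ⟨hm1, hm2, hm3⟩ := hm
    have hball : ∀ v ∈ convexHull ℝ {v | v ∈ l}, dist v (barycenter l) ≤ N / (N + 1) * δ := by
      intro v hv
      exact convexHull_min (t := closedBall (barycenter l) (N / (N + 1) * δ))
        (fun w hw => dist_barycenter_le hδ (by omega) h hw) (convex_closedBall _ _) hv
    refine ⟨by simp [hm1], ?_, ?_⟩
    · simpa using ⟨barycenter_mem_convexHull hl, hm2⟩
    · intro v hv w hw
      rcases List.mem_cons.1 hv with rfl | hv <;> rcases List.mem_cons.1 hw with rfl | hw
      · rw [dist_self]; positivity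
      · rw [dist_comm]; exact hball w (hm2 w hw)
      · exact hball v (hm2 v hv)
      · exact hm3 v hv w hw

/-- Simplices of dimension `k` with vertices in a common member of `𝒞` and edges of length at
most `δ`. -/
def IsSmall (𝒞 : Set (Set E)) (δ : ℝ) (k : ℕ) (l : List E) : Prop :=
  l.length = k + 1 ∧ (∃ C ∈ 𝒞, ∀ v ∈ l, v ∈ C) ∧ ∀ v ∈ l, ∀ w ∈ l, dist v w ≤ δ

lemma IsHemispheres.subdiv {p : ℕ} {𝒞 : Set (Set E)} (h𝒞 : ∀ C ∈ 𝒞, Convex ℝ C) {δ : ℝ}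
    (hδ : 0 ≤ δ) {c : ℕ → Chain E} (hc : IsHemispheres p (IsSmall 𝒞 δ) c) :
    IsHemispheres p (IsSmall 𝒞 (p / (p + 1) * δ)) fun k => subdiv (k + 1) (c k) where
  zero := by
    obtain ⟨v, hv⟩ := hc.zero
    refine ⟨v, ?_⟩
    simp [hv, BorsukUlam.subdiv, bdList, cone_single, barycenter]
  bd_succ k hk := by
    rw [bd_subdiv _ (chainsOn_mono (fun l hl => hl.1) (hc.mem (k + 1) hk)), hc.bd_succ k hk,
      map_add, antipode_subdiv]
  mem k hk := by
    refine map_mem_of_single (BorsukUlam.subdiv (k + 1)) _ (fun l hl => ?_) (hc.mem k hk)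
    obtain ⟨h1, ⟨C, hC, h2⟩, h3⟩ := hl
    refine chainsOn_mono (fun m hm => ⟨hm.1, ⟨C, hC, fun v hv => ?_⟩, hm.2.2⟩)
      (subdiv_single_mem hδ (by omega) h1 h3)
    exact convexHull_min (fun w hw => h2 w hw) (h𝒞 C hC) (hm.2.1 v hv)

lemma IsHemispheres.exists_small {p : ℕ} {𝒞 : Set (Set E)} (h𝒞 : ∀ C ∈ 𝒞, Convex ℝ C) {δ : ℝ}
    (hδ : 0 ≤ δ) {c : ℕ → Chain E} (hc : IsHemispheres p (IsSmall 𝒞 δ) c) {ε : ℝ} (hε : 0 < ε) :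
    ∃ c', IsHemispheres p (IsSmall 𝒞 ε) c' := by
  have hr : (p : ℝ) / (p + 1) < 1 := by
    rw [div_lt_one (by positivity)]; linarith
  have iter : ∀ N : ℕ, ∃ c', IsHemispheres p (IsSmall 𝒞 (((p : ℝ) / (p + 1)) ^ N * δ)) c' := by
    intro N
    induction N with
    | zero => exact ⟨c, by simpa using hc⟩
    | succ N ih =>
      obtain ⟨c', hc'⟩ := ih
      have := hc'.subdiv h𝒞 (by positivity)
      rw [← mul_assoc, ← pow_succ'] at this
      exact ⟨_, this⟩
  have hlim : Filter.Tendsto (fun N : ℕ => ((p : ℝ) / (p + 1)) ^ N * δ) Filter.atTop (nhds 0) := by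
    simpa using (tendsto_pow_atTop_nhds_zero_of_lt_one (by positivity) hr).mul_const δ
  obtain ⟨N, hN⟩ := (hlim.eventually_lt_const hε).exists
  obtain ⟨c', hc'⟩ := iter N
  refine ⟨c', hc'.zero, hc'.bd_succ, fun k hk => chainsOn_mono (fun l hl => ?_) (hc'.mem k hk)⟩
  exact ⟨hl.1, hl.2.1, fun v hv w hw => (hl.2.2 v hv w hw).trans hN.le⟩

end Subdivision

section CrossPolytope

variable {p : ℕ}

/-- The facet of the cross-polytope with sign vector `σ`. -/
def facet (σ : Fin (p + 1) → ℝ) : Set (Fin (p + 1) → ℝ) :=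
  {v | (∀ i, 0 ≤ σ i * v i) ∧ ∑ i, σ i * v i = 1}

/-- The facets of the cross-polytope. -/
def facets (p : ℕ) : Set (Set (Fin (p + 1) → ℝ)) :=
  {C | ∃ σ : Fin (p + 1) → ℝ, (∀ i, |σ i| = 1) ∧ C = facet σ}

/-- The boundary of the cross-polytope. -/
def crossSphere (p : ℕ) : Set (Fin (p + 1) → ℝ) := {v | ∑ i, |v i| = 1}

lemma convex_facet (σ : Fin (p + 1) → ℝ) : Convex ℝ (facet σ) := by
  rintro v ⟨hv, hv'⟩ w ⟨hw, hw'⟩ a b ha hb hab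
  have h : ∀ i, σ i * (a • v + b • w) i = a * (σ i * v i) + b * (σ i * w i) := by
    intro i
    simp only [Pi.add_apply, Pi.smul_apply, smul_eq_mul]
    ring
  refine ⟨fun i => ?_, ?_⟩
  · rw [h]
    exact add_nonneg (mul_nonneg ha (hv i)) (mul_nonneg hb (hw i))
  · simp only [h, Finset.sum_add_distrib, ← Finset.mul_sum, hv', hw', mul_one, hab]

lemma facet_subset_crossSphere {σ : Fin (p + 1) → ℝ} (hσ : ∀ i, |σ i| = 1) :
    facet σ ⊆ crossSphere p := by
  rintro v ⟨hv, hv'⟩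
  change ∑ i, |v i| = 1
  rw [← hv']
  refine Finset.sum_congr rfl fun i _ => ?_
  rw [← abs_of_nonneg (hv i), abs_mul, hσ, one_mul]

lemma ne_zero_of_mem_crossSphere {v : Fin (p + 1) → ℝ} (hv : v ∈ crossSphere p) : v ≠ 0 := by
  rintro rfl
  simp [crossSphere] at hv

lemma norm_le_one_of_mem_crossSphere {v : Fin (p + 1) → ℝ} (hv : v ∈ crossSphere p) :
    ‖v‖ ≤ 1 := by
  rw [pi_norm_le_iff_of_nonneg zero_le_one]
  intro i
  rw [Real.norm_eq_abs, ← show ∑ i, |v i| = 1 from hv]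
  exact Finset.single_le_sum (f := fun i => |v i|) (fun _ _ => abs_nonneg _) (Finset.mem_univ i)

lemma isCompact_crossSphere : IsCompact (crossSphere p) := by
  refine Metric.isCompact_of_isClosed_isBounded ?_ ?_
  · exact isClosed_eq (by fun_prop) continuous_const
  · exact isBounded_closedBall.subset fun v hv =>
      mem_closedBall_zero_iff.2 (norm_le_one_of_mem_crossSphere hv)

/-- The standard basis vectors, indexed by `ℕ`. -/
def basisVec (p k : ℕ) : Fin (p + 1) → ℝ := fun i => if (i : ℕ) = k then 1 else 0

/-- The standard hemispheres of the cross-polytope. -/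
noncomputable def hemisphere (p : ℕ) : ℕ → Chain (Fin (p + 1) → ℝ)
  | 0 => Finsupp.single [basisVec p 0] 1
  | k + 1 => cone (basisVec p (k + 1)) (hemisphere p k + antipode (hemisphere p k))

lemma bd_hemisphere_add_antipode (p k : ℕ) :
    bd (hemisphere p k) + antipode (bd (hemisphere p k)) = 0 := by
  induction k with
  | zero => simp [hemisphere, bd_single, bdList, antipode_single, chain_add_self]
  | succ k ih =>
    rw [hemisphere, bd_cone, map_add bd, ← antipode_bd, ih, map_zero, add_zero, map_add,
      antipode_antipode, add_comm (antipode _), chain_add_self]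

/-- Simplices of dimension `k` in a facet of the cross-polytope, spanned by vectors supported on
the first `k + 1` coordinates. -/
def IsCoordSimplex (p k : ℕ) (l : List (Fin (p + 1) → ℝ)) : Prop :=
  l.length = k + 1 ∧ ∃ σ : Fin (p + 1) → ℝ, (∀ i, |σ i| = 1) ∧
    ∀ v ∈ l, v ∈ facet σ ∧ ∀ i : Fin (p + 1), k < i → v i = 0

lemma basisVec_mem_facet {k : ℕ} (hk : k < p + 1) {σ : Fin (p + 1) → ℝ} (hσ : σ ⟨k, hk⟩ = 1) :
    basisVec p k ∈ facet σ := by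
  have h : ∀ i : Fin (p + 1), σ i * basisVec p k i = if i = ⟨k, hk⟩ then 1 else 0 := by
    intro i
    by_cases hi : i = ⟨k, hk⟩
    · simp [hi, basisVec, hσ]
    · have : (i : ℕ) ≠ k := fun h => hi (Fin.ext h)
      simp [basisVec, hi, this]
  refine ⟨fun i => ?_, ?_⟩
  · rw [h]; split_ifs <;> norm_num
  · simp [h]

lemma hemisphere_mem {k : ℕ} (hk : k ≤ p) : hemisphere p k ∈ chainsOn (IsCoordSimplex p k) := by
  induction k with
  | zero =>
    refine single_mem_chainsOn ⟨rfl, 1, by simp, ?_⟩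
    intro v hv
    obtain rfl := List.mem_singleton.1 hv
    exact ⟨basisVec_mem_facet (by omega) rfl, fun i hi => if_neg (by omega)⟩
  | succ k ih =>
    have h1 := ih (by omega)
    have h2 : antipode (hemisphere p k) ∈ chainsOn (IsCoordSimplex p k) := by
      refine antipode_mem_chainsOn (fun l hl => ?_) h1
      obtain ⟨hl, σ, hσ, h⟩ := hl
      refine ⟨by simpa using hl, -σ, by simpa using hσ, fun v hv => ?_⟩
      obtain ⟨w, hw, rfl⟩ := List.mem_map.1 hv
      obtain ⟨⟨h3, h4⟩, h5⟩ := h w hw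
      exact ⟨⟨by simpa using h3, by simpa using h4⟩, fun i hi => by simp [h5 i hi]⟩
    refine cone_mem_chainsOn (fun l hl => ?_) (Submodule.add_mem _ h1 h2)
    obtain ⟨hl, σ, hσ, h⟩ := hl
    have hk' : k + 1 < p + 1 := by omega
    refine ⟨by simp [hl], Function.update σ ⟨k + 1, hk'⟩ 1, fun i => ?_, fun v hv => ?_⟩
    · by_cases hi : i = ⟨k + 1, hk'⟩
      · subst hi; simp
      · simp [hi, hσ]
    rcases List.mem_cons.1 hv with rfl | hv
    · exact ⟨basisVec_mem_facet hk' (by simp), fun i hi => if_neg (by omega)⟩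
    · obtain ⟨⟨h3, h4⟩, h5⟩ := h v hv
      have h6 : ∀ i, Function.update σ ⟨k + 1, hk'⟩ 1 i * v i = σ i * v i := by
        intro i
        by_cases hi : i = ⟨k + 1, hk'⟩
        · subst hi
          simp [h5 ⟨k + 1, hk'⟩ (Nat.lt_succ_self k)]
        · simp [hi]
      exact ⟨⟨fun i => by rw [h6]; exact h3 i, by simpa only [h6] using h4⟩,
        fun i hi => h5 i (by omega)⟩

lemma isHemispheres_hemisphere (p : ℕ) :
    IsHemispheres p (IsSmall (facets p) 2) (hemisphere p) where
  zero := ⟨_, rfl⟩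
  bd_succ k _ := by
    rw [hemisphere, bd_cone, map_add, ← antipode_bd, bd_hemisphere_add_antipode, map_zero,
      add_zero]
  mem k hk := by
    refine chainsOn_mono (fun l hl => ?_) (hemisphere_mem hk)
    obtain ⟨hl, σ, hσ, h⟩ := hl
    refine ⟨hl, ⟨facet σ, ⟨σ, hσ, rfl⟩, fun v hv => (h v hv).1⟩, fun v hv w hw => ?_⟩
    have hv' := norm_le_one_of_mem_crossSphere (facet_subset_crossSphere hσ (h v hv).1)
    have hw' := norm_le_one_of_mem_crossSphere (facet_subset_crossSphere hσ (h w hw).1)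
    rw [dist_eq_norm]
    linarith [norm_sub_le v w]

end CrossPolytope

open Classical in
/-- An antipodal `ZMod 2`-valued function on nonzero vectors that refines the sign of `g`. -/
noncomputable def signBit {E : Type*} [Neg E] (g : E → ℝ) (v : E) : ZMod 2 :=
  if 0 < g v then 1 else if g v < 0 then 0 else if WellOrderingRel v (-v) then 1 else 0

lemma signBit_neg {E : Type*} [AddCommGroup E] [Module ℝ E] {g : E → ℝ} {v : E} (hv : v ≠ 0)
    (hg : g (-v) = -g v) : signBit g (-v) = signBit g v + 1 := by
  have h11 : (1 : ZMod 2) + 1 = 0 := by decide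
  have hne : v ≠ -v := fun h => hv (by
    have h2 : (2 : ℝ) • v = 0 := by rw [two_smul]; nth_rewrite 2 [h]; exact add_neg_cancel v
    exact (smul_eq_zero.1 h2).resolve_left two_ne_zero)
  rcases lt_trichotomy (g v) 0 with h | h | h
  · simp [signBit, hg, h, h.not_gt]
  · rcases trichotomous_of WellOrderingRel v (-v) with h' | h' | h'
    · simp [signBit, hg, h, h', asymm_of WellOrderingRel h', h11]
    · exact absurd h' hne
    · simp [signBit, hg, h, h', asymm_of WellOrderingRel h']
  · simp [signBit, hg, h, h.not_gt, h11]

lemma signBit_eq_of_abs_sub_lt {E : Type*} [Neg E] {g : E → ℝ} {u v : E}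
    (h : |g v - g u| < |g u|) : signBit g v = signBit g u := by
  rcases lt_trichotomy (g u) 0 with hu | hu | hu
  · rw [abs_of_neg hu, abs_lt] at h
    have hv : g v < 0 := by linarith
    simp [signBit, hu, hv, hu.not_gt, hv.not_gt]
  · rw [hu, abs_zero] at h
    exact absurd h (abs_nonneg _).not_gt
  · rw [abs_of_pos hu, abs_lt] at h
    have hv : 0 < g v := by linarith
    simp [signBit, hu, hv]

/-- The Borsuk–Ulam theorem on the boundary of the cross-polytope. -/
theorem exists_eq_zero_of_crossSphere {p : ℕ} (g : (Fin (p + 1) → ℝ) → Fin p → ℝ)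
    (hg : ContinuousOn g (crossSphere p)) (hodd : ∀ v ∈ crossSphere p, g (-v) = -g v) :
    ∃ v ∈ crossSphere p, g v = 0 := by
  by_contra! hne
  have hnonempty : (crossSphere p).Nonempty :=
    ⟨basisVec p 0, facet_subset_crossSphere (σ := 1) (by simp)
      (basisVec_mem_facet (Nat.succ_pos p) rfl)⟩
  obtain ⟨v₀, hv₀, hmin⟩ := isCompact_crossSphere.exists_isMinOn hnonempty hg.norm
  have hδ : 0 < ‖g v₀‖ := norm_pos_iff.2 (hne v₀ hv₀)
  obtain ⟨ε, hε, hunif⟩ := Metric.uniformContinuousOn_iff.1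
    (isCompact_crossSphere.uniformContinuousOn_of_continuous hg) _ hδ
  have hfacets : ∀ C ∈ facets p, Convex ℝ C ∧ C ⊆ crossSphere p := by
    rintro C ⟨σ, hσ, rfl⟩
    exact ⟨convex_facet σ, facet_subset_crossSphere hσ⟩
  obtain ⟨c, hc⟩ := (isHemispheres_hemisphere p).exists_small (fun C hC => (hfacets C hC).1)
    zero_le_two (half_pos hε)
  let s : ℕ → (Fin (p + 1) → ℝ) → ZMod 2 := fun k =>
    if hk : k < p then signBit fun v => g v ⟨k, hk⟩ else 0
  have hone := hc.eval_cup s (fun k _ l hl => ?_) p le_rfl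
  · have hzero := eqOn_of_single (eval (cup s p)) 0 (fun l hl => ?_) (hc.mem p le_rfl)
    · rw [hzero] at hone
      exact zero_ne_one hone
    obtain ⟨hl, ⟨C, hC, hlC⟩, hdist⟩ := hl
    obtain ⟨u, hu⟩ : ∃ u, u ∈ l := List.exists_mem_of_length_pos (by omega)
    have hmem : ∀ v ∈ l, v ∈ crossSphere p := fun v hv => (hfacets C hC).2 (hlC v hv)
    obtain ⟨i, hi⟩ : ∃ i, ‖g v₀‖ ≤ |g u i| := by
      by_contra! h
      have : ‖g u‖ < ‖g v₀‖ := (pi_norm_lt_iff hδ).2 h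
      exact absurd (hmin (hmem u hu)) this.not_ge
    have hconst : ∀ v ∈ l, s i v = s i u := by
      intro v hv
      simp only [s, i.2, dif_pos]
      refine signBit_eq_of_abs_sub_lt (lt_of_lt_of_le ?_ hi)
      refine lt_of_le_of_lt ?_
        (hunif v (hmem v hv) u (hmem u hu) ((hdist v hv u hu).trans_lt (half_lt_self hε)))
      simpa [Real.dist_eq] using dist_le_pi_dist (g v) (g u) i
    rw [eval_single, LinearMap.zero_apply]
    exact cup_eq_zero s i.2 fun v hv w hw => (hconst v hv).trans (hconst w hw).symm
  · obtain ⟨hl, ⟨C, hC, hlC⟩, -⟩ := hl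
    refine ⟨by rintro rfl; simp at hl, fun v hv j hj => ?_⟩
    have hv' := (hfacets C hC).2 (hlC v hv)
    simp only [s, hj, dif_pos]
    exact signBit_neg (ne_zero_of_mem_crossSphere hv') (by rw [hodd v hv']; rfl)

/-- The **Borsuk–Ulam theorem**. -/
theorem exists_eq_zero_of_odd {p : ℕ} (g : EuclideanSpace ℝ (Fin (p + 1)) → Fin p → ℝ)
    (hg : ContinuousOn g (sphere 0 1)) (hodd : ∀ a ∈ sphere 0 1, g (-a) = -g a) :
    ∃ a ∈ sphere 0 1, g a = 0 := by
  let r : (Fin (p + 1) → ℝ) → EuclideanSpace ℝ (Fin (p + 1)) := fun v =>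
    ‖WithLp.toLp 2 v‖⁻¹ • WithLp.toLp 2 v
  have hne : ∀ v ∈ crossSphere p, ‖WithLp.toLp 2 v‖ ≠ 0 := fun v hv => by
    simpa using ne_zero_of_mem_crossSphere hv
  have hr : ∀ v ∈ crossSphere p, r v ∈ sphere 0 1 := fun v hv => by
    simp [r, norm_smul, inv_mul_cancel₀ (hne v hv)]
  have hcont : Continuous fun v : Fin (p + 1) → ℝ => WithLp.toLp 2 v := PiLp.continuous_toLp 2 _
  have hrc : ContinuousOn r (crossSphere p) :=
    (hcont.norm.continuousOn.inv₀ hne).smul hcont.continuousOn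
  obtain ⟨v, hv, h⟩ := exists_eq_zero_of_crossSphere (g ∘ r) (hg.comp hrc hr) fun v hv => by
    have : r (-v) = -r v := by simp [r]
    simp only [Function.comp_apply, this, hodd _ (hr v hv)]
  exact ⟨r v, hr v hv, h⟩

end BorsukUlam

/-- **Borsuk–Ulam balancing lemma** (Lemma 3.8 of the paper): given measurable sets
`A₁,…,A_𝔭` of finite measure and a continuous odd map `f : 𝕊^𝔭 → L¹(μ)`, there is a point
`a` of the sphere such that `f a` has zero integral over every `A_i`. -/
theorem borsuk_ulam_balancing
    {α : Type*} [MeasurableSpace α] (μ : MeasureTheory.Measure α)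
    (p : ℕ) (hp : 1 ≤ p)
    (A : Fin p → Set α) (hA : ∀ i, MeasurableSet (A i)) (hAfin : ∀ i, μ (A i) < ⊤)
    (f : EuclideanSpace ℝ (Fin (p + 1)) → MeasureTheory.Lp ℝ 1 μ)
    (hf : ContinuousOn f (Metric.sphere 0 1))
    (hodd : ∀ a ∈ Metric.sphere (0 : EuclideanSpace ℝ (Fin (p + 1))) 1, f (-a) = -f a) :
    ∃ a ∈ Metric.sphere (0 : EuclideanSpace ℝ (Fin (p + 1))) 1,
      ∀ i, ∫ x in A i, (f a : α → ℝ) x ∂μ = 0 := by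
  have hcont : ContinuousOn (fun a i => ∫ x in A i, (f a : α → ℝ) x ∂μ) (Metric.sphere 0 1) :=
    continuousOn_pi.2 fun i => (continuous_setIntegral (A i)).comp_continuousOn hf
  obtain ⟨a, ha, h⟩ := BorsukUlam.exists_eq_zero_of_odd _ hcont fun a ha => by
    funext i
    rw [hodd a ha, Pi.neg_apply, ← integral_neg]
    exact integral_congr_ae (ae_restrict_of_ae (Lp.coeFn_neg (f a)))
  exact ⟨a, ha, fun i => congrFun h i⟩
end

section
/- Energy lower bound for balanced functions: let n ≥ 1, s ∈ (0,1) and C > 1. Then there exist ε₀ > 0 and c > 0, depending only on n, s and C, such that for every ε ∈ (0,ε₀] and every measurable function v : B₁ → [-1,1] on the unit ball B₁ ⊆ ℝ^n whose average satisfies |⨍_{B₁} v dx| ≤ 1 - 1/C, one has (1/4)·∬_{B₁×B₁} |v(x)-v(y)|²·|x-y|^{-(n+s)} dx dy + ε^{-s}·∫_{B₁} W(v) dx ≥ c, where W(v) := (1-v²)²/4. -/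
open MeasureTheory Real Set Metric

noncomputable section

/-- The double-well potential `W(t) = (1-t²)²/4`. -/
def Wpot (t : ℝ) : ℝ := (1 - t ^ 2) ^ 2 / 4

/-- Expanding the square: the double integral of `(v x - v y)²` is twice the (unnormalized)
variance. -/
lemma integral_prod_sub_sq {α : Type*} [MeasurableSpace α] (μ : Measure α) [IsFiniteMeasure μ]
    {v : α → ℝ} (h1 : Integrable v μ) (h2 : Integrable (fun x => v x ^ 2) μ) :
    Integrable (fun p : α × α => (v p.1 - v p.2) ^ 2) (μ.prod μ) ∧
      ∫ p, (v p.1 - v p.2) ^ 2 ∂(μ.prod μ) =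
        2 * (μ.real univ * ∫ x, v x ^ 2 ∂μ - (∫ x, v x ∂μ) ^ 2) := by
  have hc : Integrable (fun _ : α => (1 : ℝ)) μ := integrable_const 1
  have i1 := h2.mul_prod hc
  have i2 := hc.mul_prod h2
  have i12 : Integrable (fun p : α × α => v p.1 ^ 2 * 1 + 1 * v p.2 ^ 2) (μ.prod μ) := i1.add i2
  have i3 := (h1.mul_prod h1).const_mul 2
  have e : (fun p : α × α => (v p.1 - v p.2) ^ 2) =
      fun p => (v p.1 ^ 2 * 1 + 1 * v p.2 ^ 2) - 2 * (v p.1 * v p.2) := by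
    funext p
    ring
  rw [e]
  refine ⟨i12.sub i3, ?_⟩
  rw [integral_sub i12 i3, integral_add i1 i2,
    integral_prod_mul (fun x => v x ^ 2) (fun _ => (1 : ℝ)),
    integral_prod_mul (fun _ => (1 : ℝ)) (fun x => v x ^ 2),
    integral_const_mul 2 (fun p : α × α => v p.1 * v p.2), integral_prod_mul v v]
  simp only [integral_const, smul_eq_mul]
  ring

/-- Young's inequality controlling `1 - t²` by the double-well potential. -/
lemma one_sub_sq_le_Wpot {δ : ℝ} (hδ : 0 < δ) (t : ℝ) :
    1 - t ^ 2 ≤ δ / 2 + 2 / δ * Wpot t := by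
  have h : δ / 2 + 2 / δ * Wpot t - (1 - t ^ 2) = (δ - (1 - t ^ 2)) ^ 2 / (2 * δ) := by
    unfold Wpot
    field_simp
    ring
  have : 0 ≤ (δ - (1 - t ^ 2)) ^ 2 / (2 * δ) := by positivity
  linarith

/-- On the unit ball the kernel `|x - y|^(-a)` is bounded below by `2^(-a)`. -/
lemma sq_sub_mul_two_rpow_le {E : Type*} [NormedAddCommGroup E] (v : E → ℝ) {a : ℝ} (ha : 0 ≤ a)
    {x y : E} (hx : x ∈ ball (0 : E) 1) (hy : y ∈ ball (0 : E) 1) :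
    (2 : ℝ) ^ (-a) * (v x - v y) ^ 2 ≤ (v x - v y) ^ 2 * ‖x - y‖ ^ (-a) := by
  rcases eq_or_ne x y with rfl | hxy
  · simp
  · rw [mul_comm]
    rw [mem_ball_zero_iff] at hx hy
    have h0 : 0 < ‖x - y‖ := norm_pos_iff.2 (sub_ne_zero.2 hxy)
    have h2 : ‖x - y‖ ≤ 2 := by linarith [norm_sub_le x y]
    exact mul_le_mul_of_nonneg_left (rpow_le_rpow_of_nonpos h0 h2 (by linarith)) (sq_nonneg _)

/-- **Energy lower bound for balanced functions** (Lemma 3.6 of the paper, Euclidean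
version): if `v : B₁ → [-1,1]` has average bounded away from `±1`, then for `ε ≤ ε₀` the
fractional Allen–Cahn energy of `v` in `B₁` is at least a positive constant `c(n,s,C)`. -/
theorem energy_lower_bound_balanced
    (n : ℕ) (hn : 1 ≤ n) (s : ℝ) (hs : s ∈ Set.Ioo (0 : ℝ) 1) (C : ℝ) (hC : 1 < C) :
    ∃ ε₀ c : ℝ, 0 < ε₀ ∧ 0 < c ∧
    ∀ ε : ℝ, 0 < ε → ε ≤ ε₀ →
    ∀ v : EuclideanSpace ℝ (Fin n) → ℝ, Measurable v →
      (∀ x ∈ Metric.ball (0 : EuclideanSpace ℝ (Fin n)) 1, v x ∈ Set.Icc (-1 : ℝ) 1) →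
      |⨍ x in Metric.ball (0 : EuclideanSpace ℝ (Fin n)) 1, v x| ≤ 1 - 1 / C →
      ENNReal.ofReal c ≤
        (1 / 4) * (∫⁻ p in (Metric.ball (0 : EuclideanSpace ℝ (Fin n)) 1) ×ˢ
              (Metric.ball (0 : EuclideanSpace ℝ (Fin n)) 1),
            ENNReal.ofReal ((v p.1 - v p.2) ^ 2 * ‖p.1 - p.2‖ ^ (-((n : ℝ) + s)))) +
          ENNReal.ofReal (ε ^ (-s) *
            ∫ x in Metric.ball (0 : EuclideanSpace ℝ (Fin n)) 1, Wpot (v x)) := by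
  obtain ⟨hs0, -⟩ := hs
  set B := Metric.ball (0 : EuclideanSpace ℝ (Fin n)) 1 with hB
  set μ : Measure (EuclideanSpace ℝ (Fin n)) := volume.restrict B with hμ
  have : IsFiniteMeasure μ := ⟨by
    rw [hμ, Measure.restrict_apply_univ]
    exact measure_ball_lt_top⟩
  have hMB : μ.real univ = volume.real B := by simp [hμ, Measure.real]
  have hM : 0 < μ.real univ := by
    rw [hMB]
    exact ENNReal.toReal_pos (measure_ball_pos volume _ one_pos).ne' measure_ball_lt_top.ne
  set M := μ.real univ
  set k : ℝ := 2 ^ (-((n : ℝ) + s)) with hk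
  have hk0 : 0 < k := by positivity
  set δ : ℝ := 1 - (1 - 1 / C) ^ 2 with hδ
  have hC0 : 0 < 1 / C := by positivity
  have hC1 : 1 / C < 1 := (div_lt_one (by linarith)).2 hC
  have hδ0 : 0 < δ := by
    rw [hδ]
    nlinarith
  refine ⟨1, min (k * δ * M ^ 2 / 8) (δ ^ 2 * M / 8), one_pos, by positivity, ?_⟩
  intro ε hε hε1 v hv hvB havg
  have hae : ∀ᵐ x ∂μ, v x ∈ Set.Icc (-1 : ℝ) 1 :=
    (ae_restrict_mem measurableSet_ball).mono hvB
  have iv : Integrable v μ := Integrable.of_bound hv.aestronglyMeasurable 1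
    (hae.mono fun x hx => abs_le.2 hx)
  have iv2 : Integrable (fun x => v x ^ 2) μ :=
    Integrable.of_bound (hv.pow_const 2).aestronglyMeasurable 1 <| hae.mono fun x hx => by
      rw [Real.norm_eq_abs, abs_of_nonneg (sq_nonneg _)]
      nlinarith [hx.1, hx.2]
  have iW : Integrable (fun x => Wpot (v x)) μ := by
    refine Integrable.of_bound (C := 1) ?_ (hae.mono fun x hx => ?_)
    · unfold Wpot
      exact Measurable.aestronglyMeasurable (by fun_prop)
    · have h : v x ^ 2 ≤ 1 := by nlinarith [hx.1, hx.2]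
      unfold Wpot
      rw [Real.norm_eq_abs, abs_of_nonneg (by positivity)]
      nlinarith [sq_nonneg (v x)]
  obtain ⟨iP, hP⟩ := integral_prod_sub_sq μ iv iv2
  set A := ∫ x, v x ∂μ
  set Q := ∫ x, v x ^ 2 ∂μ
  set F := ∫ x, Wpot (v x) ∂μ
  have hF0 : 0 ≤ F := integral_nonneg fun x => by
    simp only [Wpot, Pi.zero_apply]
    positivity
  have hA : A ^ 2 ≤ (1 - δ) * M ^ 2 := by
    rw [setAverage_eq, smul_eq_mul, ← hMB, abs_mul, abs_of_pos (inv_pos.2 hM),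
      inv_mul_le_iff₀ hM] at havg
    have := pow_le_pow_left₀ (abs_nonneg _) havg 2
    rw [sq_abs] at this
    rw [hδ]
    linarith [mul_pow M (1 - 1 / C) 2]
  have hQ : M - Q ≤ δ / 2 * M + 2 / δ * F := by
    have h := integral_mono ((integrable_const (1 : ℝ)).sub iv2)
      ((integrable_const (δ / 2)).add (iW.const_mul (2 / δ)))
      (fun x => one_sub_sq_le_Wpot hδ0 (v x))
    simp only [Pi.sub_apply, Pi.add_apply] at h
    rw [integral_sub (integrable_const (1 : ℝ)) iv2,
      integral_add (integrable_const (δ / 2)) (iW.const_mul (2 / δ)), integral_const_mul,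
      integral_const, integral_const, smul_eq_mul, smul_eq_mul] at h
    linarith
  have hεs : 1 ≤ ε ^ (-s) := one_le_rpow_of_pos_of_le_one_of_nonpos hε hε1 (by linarith)
  by_cases hF : δ ^ 2 * M / 8 ≤ F
  · refine le_add_left (ENNReal.ofReal_le_ofReal ?_)
    exact (min_le_right _ _).trans (hF.trans (le_mul_of_one_le_left hF0 hεs))
  · push Not at hF
    refine le_add_right ?_
    have hprod : (volume : Measure (EuclideanSpace ℝ (Fin n) × EuclideanSpace ℝ (Fin n))).restrict
        (B ×ˢ B) = μ.prod μ := by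
      rw [hμ, Measure.prod_restrict, Measure.volume_eq_prod]
    have hlow : ENNReal.ofReal (k * (2 * (M * Q - A ^ 2))) ≤
        ∫⁻ p in B ×ˢ B,
          ENNReal.ofReal ((v p.1 - v p.2) ^ 2 * ‖p.1 - p.2‖ ^ (-((n : ℝ) + s))) := by
      rw [← hP, ← integral_const_mul, ofReal_integral_eq_lintegral_ofReal (iP.const_mul k)
        (Filter.Eventually.of_forall fun p => by positivity), ← hprod]
      refine setLIntegral_mono_ae' (measurableSet_ball.prod measurableSet_ball)
        (Filter.Eventually.of_forall fun p hp => ENNReal.ofReal_le_ofReal ?_)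
      exact sq_sub_mul_two_rpow_le v (by positivity) hp.1 hp.2
    have h4 : (1 / 4 : ENNReal) = ENNReal.ofReal (1 / 4) := by
      rw [ENNReal.ofReal_div_of_pos (by norm_num)]
      norm_num
    calc ENNReal.ofReal (min (k * δ * M ^ 2 / 8) (δ ^ 2 * M / 8))
        ≤ ENNReal.ofReal (1 / 4 * (k * (2 * (M * Q - A ^ 2)))) := by
          refine ENNReal.ofReal_le_ofReal ((min_le_left _ _).trans ?_)
          have hF' : 2 / δ * F ≤ δ / 4 * M := by
            rw [div_mul_eq_mul_div, div_le_iff₀ hδ0]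
            nlinarith
          have hvar : δ * M ^ 2 / 4 ≤ M * Q - A ^ 2 := by
            nlinarith [mul_le_mul_of_nonneg_left (hQ.trans (add_le_add_right hF' _)) hM.le]
          nlinarith [mul_le_mul_of_nonneg_left hvar hk0.le]
      _ = 1 / 4 * ENNReal.ofReal (k * (2 * (M * Q - A ^ 2))) := by
          rw [h4, ENNReal.ofReal_mul (by norm_num)]
      _ ≤ _ := by gcongr

end
end

section
/- Weighted gradient estimate for the degenerate extension equation with vanishing trace: let n ≥ 1 and s ∈ (0,2). There exists C = C(n) > 0 such that the following holds. Let U : {(x,z) ∈ ℝ^n×[0,∞) : |x|²+z² ≤ 4} → ℝ be continuous and bounded, smooth on the open set B₂^+ := {(x,z) : |x|²+z² < 4, z > 0}, satisfying the degenerate equation z·ΔU(x,z) + (1-s)·∂_z U(x,z) = 0 on B₂^+ (equivalently div(z^{1-s}∇U) = 0), and such that U(x,0) = 0 for all |x| ≤ 3/2. Then for every (x,z) ∈ B₁^+ := {(x,z) : |x|²+z² < 1, z > 0}, z^{1-s}·|∇U(x,z)| ≤ (C/s)·sup_{B_{6/5}^+} |U|, where ∇ and Δ denote the full gradient and Laplacian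 in the n+1 variables (x,z). -/
open MeasureTheory Real Set Metric

noncomputable section

/-- First `n` coordinates of a point of `ℝ^{n+1}`. -/
def xpart (n : ℕ) (v : Rn (n + 1)) : Rn n :=
  (EuclideanSpace.equiv (Fin n) ℝ).symm (fun i => v i.castSucc)

/-- Last coordinate ("`z`-variable") of a point of `ℝ^{n+1}`. -/
def zpart (n : ℕ) (v : Rn (n + 1)) : ℝ := v (Fin.last n)

/-- Normalizing constant `σ_{n,s}` of the fractional Poisson kernel, chosen so that
`∫_{ℝ^n} P_s(x,1) dx = 1`. -/
def sigmaC (n : ℕ) (s : ℝ) : ℝ :=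
  (∫ y : Rn n, (‖y‖ ^ 2 + 1) ^ (-((n : ℝ) + s) / 2))⁻¹

/-- The fractional Poisson kernel `P_s(x,z) = σ_{n,s} z^s (|x|²+z²)^{-(n+s)/2}`. -/
def poissonKer (n : ℕ) (s : ℝ) (x : Rn n) (z : ℝ) : ℝ :=
  sigmaC n s * z ^ s * (‖x‖ ^ 2 + z ^ 2) ^ (-((n : ℝ) + s) / 2)

/-- The Caffarelli–Silvestre extension of `u : ℝ^n → ℝ`, viewed as a function on
`ℝ^{n+1}` (with last coordinate the extension variable `z`). -/
def csExt (n : ℕ) (s : ℝ) (u : Rn n → ℝ) (v : Rn (n + 1)) : ℝ :=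
  ∫ y, poissonKer n s (xpart n v - y) (zpart n v) * u y

/-- Squared Euclidean length of the full gradient of `F : ℝ^{n+1} → ℝ`. -/
def gradSq (n : ℕ) (F : Rn (n + 1) → ℝ) (v : Rn (n + 1)) : ℝ :=
  ∑ i, (fderiv ℝ F v (EuclideanSpace.single i 1)) ^ 2

/-- The constant `β_s = Γ(1-s/2)/(2^{s-1} Γ(s/2))`. -/
def betaS (s : ℝ) : ℝ := Real.Gamma (1 - s / 2) / (2 ^ (s - 1) * Real.Gamma (s / 2))

/-- The open upper half-ball `B_R^+ ⊆ ℝ^{n+1}`. -/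
def halfBall (n : ℕ) (R : ℝ) : Set (Rn (n + 1)) := {v | ‖v‖ < R ∧ 0 < zpart n v}

end

noncomputable section

/-- Second partial derivative of `F` in the `i`-th coordinate direction. -/
def secondPartial (n : ℕ) (F : Rn (n + 1) → ℝ) (v : Rn (n + 1)) (i : Fin (n + 1)) : ℝ :=
  fderiv ℝ (fun w => fderiv ℝ F w (EuclideanSpace.single i 1)) v (EuclideanSpace.single i 1)

/-- The Laplacian of `F : ℝ^{n+1} → ℝ` in all `n+1` variables. -/
def lap (n : ℕ) (F : Rn (n + 1) → ℝ) (v : Rn (n + 1)) : ℝ := ∑ i, secondPartial n F v i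

section

open Filter Topology

/-- First and second derivative tests at a local maximum. -/
theorem IsLocalMax.deriv_tests {f f' : ℝ → ℝ} {c : ℝ} (hmax : IsLocalMax f 0)
    (hf : ∀ᶠ τ in 𝓝 0, HasDerivAt f (f' τ) τ) (hf' : HasDerivAt f' c 0) :
    f' 0 = 0 ∧ c ≤ 0 := by
  have h0 : f' 0 = 0 := hmax.hasDerivAt_eq_zero hf.self_of_nhds
  refine ⟨h0, ?_⟩
  by_contra! hc
  have hd : deriv f =ᶠ[𝓝 0] f' := hf.mono fun τ h => h.deriv
  have hdd : deriv (deriv f) 0 = c := by rw [hd.deriv_eq, hf'.deriv]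
  have hmin : IsLocalMin f 0 := isLocalMin_of_deriv_deriv_pos (by rw [hdd]; exact hc)
    (by rw [hf.self_of_nhds.deriv, h0]) hf.self_of_nhds.continuousAt
  have hconst : f =ᶠ[𝓝 0] fun _ => f 0 := by
    filter_upwards [hmax, hmin] with τ h1 h2 using le_antisymm h1 h2
  have hz : deriv f =ᶠ[𝓝 0] fun _ => (0 : ℝ) := by
    simpa using hconst.deriv
  have : deriv (deriv f) 0 = 0 := by rw [hz.deriv_eq]; simp
  linarith

/-- Derivatives of a smooth function along a line. -/
theorem ContDiffAt.hasDerivAt_slice {E : Type*} [NormedAddCommGroup E] [NormedSpace ℝ E]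
    {U : E → ℝ} {v : E} (hU : ContDiffAt ℝ (⊤ : ℕ∞) U v) (e : E) :
    (∀ᶠ τ : ℝ in 𝓝 0, HasDerivAt (fun τ : ℝ => U (v + τ • e)) (fderiv ℝ U (v + τ • e) e) τ) ∧
    HasDerivAt (fun τ : ℝ => fderiv ℝ U (v + τ • e) e)
      (fderiv ℝ (fun w => fderiv ℝ U w e) v e) 0 := by
  have hline : ∀ τ : ℝ, HasDerivAt (fun τ : ℝ => v + τ • e) e τ := fun τ => by
    simpa using ((hasDerivAt_id τ).smul_const e).const_add v
  have hc : Tendsto (fun τ : ℝ => v + τ • e) (𝓝 0) (𝓝 v) := by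
    simpa using (hline 0).continuousAt.tendsto
  constructor
  · have h1 : ∀ᶠ w in 𝓝 v, ContDiffAt ℝ 1 U w :=
      (hU.of_le (by exact_mod_cast le_top)).eventually (by simp)
    filter_upwards [hc.eventually h1] with τ hτ
    exact (hτ.differentiableAt (by simp)).hasFDerivAt.comp_hasDerivAt τ (hline τ)
  · have h2 : ContDiffAt ℝ 1 (fun w => fderiv ℝ U w e) v :=
      (hU.fderiv_right (m := 1) (by norm_cast)).clm_apply contDiffAt_const
    have h3 : HasFDerivAt (fun w => fderiv ℝ U w e) (fderiv ℝ (fun w => fderiv ℝ U w e) v)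
      (v + (0 : ℝ) • e) := by
      simpa using (h2.differentiableAt (by simp)).hasFDerivAt
    exact h3.comp_hasDerivAt 0 (hline 0)

theorem zpart_add_smul_single (n : ℕ) (v : Rn (n + 1)) (τ : ℝ) (k : Fin (n + 1)) :
    zpart n (v + τ • EuclideanSpace.single k 1) =
      zpart n v + if k = Fin.last n then τ else 0 := by
  by_cases h : k = Fin.last n
  · simp [zpart, h]
  · simp [zpart, h, Ne.symm h]

theorem norm_add_smul_single_sub_sq (n : ℕ) (v v₀ : Rn (n + 1)) (τ : ℝ) (k : Fin (n + 1)) :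
    ‖v + τ • EuclideanSpace.single k 1 - v₀‖ ^ 2 =
      ‖v - v₀‖ ^ 2 + 2 * τ * (v k - v₀ k) + τ ^ 2 := by
  have : v + τ • EuclideanSpace.single k (1 : ℝ) - v₀ =
      (v - v₀) + τ • EuclideanSpace.single k (1 : ℝ) := by abel
  rw [this, norm_add_sq_real, inner_smul_right, EuclideanSpace.inner_single_right, norm_smul]
  simp
  ring

theorem continuous_zpart (n : ℕ) : Continuous (zpart n) := by
  unfold zpart; fun_prop

theorem abs_zpart_sub_le (n : ℕ) (v w : Rn (n + 1)) : |zpart n v - zpart n w| ≤ ‖v - w‖ := by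
  simpa [zpart] using PiLp.norm_apply_le (v - w) (Fin.last n)

theorem add_smul_tendsto {E : Type*} [NormedAddCommGroup E] [NormedSpace ℝ E] (v e : E) :
    Tendsto (fun τ : ℝ => v + τ • e) (𝓝 0) (𝓝 v) := by
  have : Continuous fun τ : ℝ => v + τ • e := by fun_prop
  simpa using this.tendsto 0

/-- Solutions of the degenerate equation on `B₂⁺`, continuous up to the boundary, with zero
trace on `{|x| ≤ 3/2, z = 0}`. -/
structure IsZeroTraceSolution (n : ℕ) (s : ℝ) (U : Rn (n + 1) → ℝ) : Prop where
  continuousOn : ContinuousOn U {v | ‖v‖ ≤ 2 ∧ 0 ≤ zpart n v}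
  smooth : ∀ v ∈ halfBall n 2, ContDiffAt ℝ (⊤ : ℕ∞) U v
  equation : ∀ v ∈ halfBall n 2, zpart n v * lap n U v +
    (1 - s) * fderiv ℝ U v (EuclideanSpace.single (Fin.last n) 1) = 0
  trace : ∀ v : Rn (n + 1), ‖v‖ ≤ 3 / 2 → zpart n v = 0 → U v = 0

theorem lap_const_mul {n : ℕ} {U : Rn (n + 1) → ℝ} (c : ℝ) (v : Rn (n + 1)) :
    lap n (fun w => c * U w) v = c * lap n U v := by
  have h : ∀ w, fderiv ℝ (fun w => c * U w) w = c • fderiv ℝ U w := fun w =>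
    congrFun (fderiv_const_smul_field (𝕜 := ℝ) (f := U) c) w
  have h2 : ∀ e : Rn (n + 1), fderiv ℝ (fun w => c * fderiv ℝ U w e) v
      = c • fderiv ℝ (fun w => fderiv ℝ U w e) v := fun e =>
    congrFun (fderiv_const_smul_field (𝕜 := ℝ) (f := fun w => fderiv ℝ U w e) c) v
  simp [lap, secondPartial, h, h2, Finset.mul_sum]

theorem IsZeroTraceSolution.const_mul {n : ℕ} {s : ℝ} {U : Rn (n + 1) → ℝ}
    (hU : IsZeroTraceSolution n s U) (c : ℝ) : IsZeroTraceSolution n s (fun v => c * U v) where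
  continuousOn := continuousOn_const.mul hU.continuousOn
  smooth v hv := contDiffAt_const.mul (hU.smooth v hv)
  equation v hv := by
    have h : fderiv ℝ (fun w => c * U w) v = c • fderiv ℝ U v :=
      congrFun (fderiv_const_smul_field (𝕜 := ℝ) (f := U) c) v
    rw [lap_const_mul, h]
    have := hU.equation v hv
    simp only [FunLike.coe_smul, Pi.smul_apply, smul_eq_mul]
    linear_combination c * this
  trace v h1 h2 := by simp [hU.trace v h1 h2]

theorem abs_div_sub_div_le {a b P Q ρ A B : ℝ} (hρ : 0 < ρ) (hP : 19 * ρ ≤ P) (hQ : 19 * ρ ≤ Q)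
    (hA : |a - b| ≤ A * ρ) (hB : |(a + b) * (Q - P)| ≤ B * ρ ^ 2) :
    |a / P - b / Q| ≤ (A + B) / 19 := by
  have hP0 : 0 < P := by linarith
  have hQ0 : 0 < Q := by linarith
  have hA0 : 0 ≤ A := nonneg_of_mul_nonneg_left ((abs_nonneg _).trans hA) hρ
  have hB0 : 0 ≤ B := nonneg_of_mul_nonneg_left ((abs_nonneg _).trans hB) (by positivity)
  have e1 : a / P - b / Q = ((a - b) * (P + Q) + (a + b) * (Q - P)) / (2 * (P * Q)) := by
    field_simp; ring
  rw [e1, abs_div, abs_of_pos (by positivity : 0 < 2 * (P * Q)), div_le_iff₀ (by positivity)]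
  have h1 : |(a - b) * (P + Q)| ≤ A * ρ * (P + Q) := by
    rw [abs_mul, abs_of_pos (by positivity : 0 < P + Q)]
    gcongr
  have h2 : ρ * (P + Q) ≤ 2 * (P * Q) / 19 := by
    nlinarith [mul_le_mul_of_nonneg_left hP hQ0.le, mul_le_mul_of_nonneg_left hQ hP0.le]
  have h3 : ρ ^ 2 ≤ 2 * (P * Q) / 19 := by
    nlinarith [mul_le_mul hP hQ (by positivity) hP0.le, sq_nonneg ρ]
  calc _ ≤ |(a - b) * (P + Q)| + |(a + b) * (Q - P)| := abs_add_le _ _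
    _ ≤ A * (ρ * (P + Q)) + B * ρ ^ 2 := by linarith
    _ ≤ A * (2 * (P * Q) / 19) + B * (2 * (P * Q) / 19) := by gcongr
    _ = _ := by ring

set_option maxHeartbeats 1000000 in
/-- Interior estimate for a partial derivative away from the flat boundary, by
doubling of variables. -/
theorem partial_le_of_equation {n : ℕ} {s ρ m : ℝ} {U : Rn (n + 1) → ℝ} {v₀ : Rn (n + 1)}
    (hs : s ∈ Set.Ioo (0 : ℝ) 2) (hρ : 0 < ρ) (hz : 20 * ρ ≤ zpart n v₀)
    (hsm : ∀ v ∈ closedBall v₀ ρ, ContDiffAt ℝ (⊤ : ℕ∞) U v)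
    (heq : ∀ v ∈ closedBall v₀ ρ, zpart n v * lap n U v +
      (1 - s) * fderiv ℝ U v (EuclideanSpace.single (Fin.last n) 1) = 0)
    (hm : 0 < m) (hU : ∀ v ∈ closedBall v₀ ρ, |U v| ≤ m) (j : Fin (n + 1)) :
    fderiv ℝ U v₀ (EuclideanSpace.single j 1) ≤ 8 * (n + 1) * m / ρ := by
  set e : Fin (n + 1) → Rn (n + 1) := fun k => EuclideanSpace.single k (1 : ℝ) with he
  have hnorm : ‖e j‖ = 1 := by simp [he]
  set A : ℝ := 8 * m / ρ ^ 2 with hA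
  have hApos : 0 < A := by positivity
  have hAρ : A * ρ ^ 2 = 8 * m := by rw [hA]; field_simp
  set B : ℝ := 2 * A * (n + 1) with hB
  have hBpos : 0 < B := by positivity
  have hBA : 2 * A ≤ B := by
    rw [hB]; nlinarith [mul_nonneg hApos.le (Nat.cast_nonneg (α := ℝ) n)]
  have hmem : ∀ v t, ‖v - v₀‖ ≤ ρ / 2 → |t| ≤ ρ / 2 → v + t • e j ∈ closedBall v₀ ρ := by
    intro v t hv ht
    rw [mem_closedBall, dist_eq_norm]
    calc ‖v + t • e j - v₀‖ = ‖(v - v₀) + t • e j‖ := by congr 1; abel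
      _ ≤ ‖v - v₀‖ + |t| * 1 := by
        simpa [norm_smul, hnorm] using norm_add_le (v - v₀) (t • e j)
      _ ≤ ρ := by linarith
  have hzp : ∀ v ∈ closedBall v₀ ρ, 19 * ρ ≤ zpart n v := by
    intro v hv
    rw [mem_closedBall, dist_eq_norm] at hv
    have := (abs_le.mp ((abs_zpart_sub_le n v v₀).trans hv)).1
    linarith
  let Φ : Rn (n + 1) × ℝ → ℝ := fun x => U (x.1 + x.2 • e j) - U (x.1 + (-x.2) • e j)
    - A * ‖x.1 - v₀‖ ^ 2 - (B * ρ * x.2 - B * x.2 ^ 2)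
  let S : Set (Rn (n + 1) × ℝ) := closedBall v₀ (ρ / 2) ×ˢ Icc 0 (ρ / 2)
  have hS : ∀ x ∈ S, ‖x.1 - v₀‖ ≤ ρ / 2 ∧ 0 ≤ x.2 ∧ x.2 ≤ ρ / 2 := by
    rintro x ⟨h1, h2⟩
    exact ⟨by rwa [mem_closedBall, dist_eq_norm] at h1, h2⟩
  have hSc : IsCompact S := (isCompact_closedBall _ _).prod isCompact_Icc
  have hSne : S.Nonempty := ⟨(v₀, 0), mem_closedBall_self (by positivity), by simp; positivity⟩
  have hUc : ContinuousOn U (closedBall v₀ ρ) :=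
    fun v hv => (hsm v hv).continuousAt.continuousWithinAt
  have hΦc : ContinuousOn Φ S := by
    refine ((((hUc.comp (f := fun x : Rn (n + 1) × ℝ => x.1 + x.2 • e j) (by fun_prop) ?_).sub
      (hUc.comp (f := fun x : Rn (n + 1) × ℝ => x.1 + (-x.2) • e j) (by fun_prop) ?_)).sub
      (by fun_prop)).sub (by fun_prop))
    · intro x hx
      obtain ⟨h1, h2, h3⟩ := hS x hx
      exact hmem _ _ h1 (by rwa [abs_of_nonneg h2])
    · intro x hx
      obtain ⟨h1, h2, h3⟩ := hS x hx
      exact hmem _ _ h1 (by rwa [abs_neg, abs_of_nonneg h2])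
  obtain ⟨⟨v, t⟩, hx, hmax⟩ := hSc.exists_isMaxOn hSne hΦc
  obtain ⟨hv, ht0, htρ⟩ := hS _ hx
  simp only at hv ht0 htρ
  have hp := hmem v t hv (by rwa [abs_of_nonneg ht0])
  have hq := hmem v (-t) hv (by rwa [abs_neg, abs_of_nonneg ht0])
  have key : Φ (v, t) ≤ 0 := by
    by_contra! hpos
    have hΦ : 0 < U (v + t • e j) - U (v + (-t) • e j)
      - A * ‖v - v₀‖ ^ 2 - (B * ρ * t - B * t ^ 2) := hpos
    have hF : U (v + t • e j) - U (v + (-t) • e j) ≤ 2 * m := by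
      have h1 := (abs_le.mp (hU _ hp)).2
      have h2 := (abs_le.mp (hU _ hq)).1
      linarith
    have hT : 0 ≤ B * ρ * t - B * t ^ 2 := by
      have : B * ρ * t - B * t ^ 2 = B * (t * (ρ - t)) := by ring
      rw [this]
      exact mul_nonneg hBpos.le (mul_nonneg ht0 (by linarith))
    have ht0' : 0 < t := by
      rcases ht0.lt_or_eq with h | h
      · exact h
      · subst h
        simp at hΦ
        nlinarith [mul_nonneg hApos.le (sq_nonneg ‖v - v₀‖)]
    have hv' : ‖v - v₀‖ < ρ / 2 := by
      rcases hv.lt_or_eq with h | h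
      · exact h
      · rw [h] at hΦ
        nlinarith
    have htρ' : t < ρ / 2 := by
      rcases htρ.lt_or_eq with h | h
      · exact h
      · have h2 : B * ρ * t - B * t ^ 2 = B * ρ ^ 2 / 4 := by rw [h]; ring
        nlinarith [mul_nonneg hApos.le (sq_nonneg ‖v - v₀‖), mul_le_mul_of_nonneg_right hBA (sq_nonneg ρ)]
    have hvn : ∀ᶠ w in 𝓝 v, w ∈ closedBall v₀ (ρ / 2) := by
      refine Filter.mem_of_superset (isOpen_ball.mem_nhds ?_) ball_subset_closedBall
      rwa [mem_ball, dist_eq_norm]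
    -- slices in the space directions
    have hspace : ∀ k, fderiv ℝ U (v + t • e j) (e k) - fderiv ℝ U (v + (-t) • e j) (e k)
          = 2 * A * (v k - v₀ k) ∧
        secondPartial n U (v + t • e j) k - secondPartial n U (v + (-t) • e j) k ≤ 2 * A := by
      intro k
      obtain ⟨p1, p2⟩ := (hsm _ hp).hasDerivAt_slice (e k)
      obtain ⟨q1, q2⟩ := (hsm _ hq).hasDerivAt_slice (e k)
      have hloc : IsLocalMax (fun τ : ℝ => U (v + t • e j + τ • e k)
          - U (v + (-t) • e j + τ • e k) - A * (2 * τ * (v k - v₀ k) + τ ^ 2)) 0 := by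
        filter_upwards [(add_smul_tendsto v (e k)).eventually hvn] with τ hτ
        have := hmax (show (v + τ • e k, t) ∈ S from ⟨hτ, ht0, htρ⟩)
        simp only [Φ, mem_ofPred_eq] at this
        rw [norm_add_smul_single_sub_sq, add_right_comm v (τ • e k), add_right_comm v (τ • e k)] at this
        simp only [zero_smul, add_zero, mul_zero, zero_mul]
        linarith
      obtain ⟨r1, r2⟩ := hloc.deriv_tests
        (f' := fun τ => fderiv ℝ U (v + t • e j + τ • e k) (e k)
          - fderiv ℝ U (v + (-t) • e j + τ • e k) (e k) - A * (2 * (v k - v₀ k) + 2 * τ))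
        (c := secondPartial n U (v + t • e j) k - secondPartial n U (v + (-t) • e j) k - A * 2)
        (by
          filter_upwards [p1, q1] with τ h1 h2
          refine (h1.sub h2).sub (HasDerivAt.const_mul A ?_)
          refine (((hasDerivAt_id τ).const_mul 2).mul_const (v k - v₀ k) |>.add
            (hasDerivAt_pow 2 τ)).congr_deriv ?_
          simp)
        (by
          refine (p2.sub q2).sub (HasDerivAt.const_mul A ?_)
          simpa using ((hasDerivAt_id (0 : ℝ)).const_mul 2).const_add (2 * (v k - v₀ k)))
      simp only [zero_smul, add_zero, mul_zero] at r1
      exact ⟨by linarith, by linarith⟩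
    -- slice in the doubling parameter
    have htime : fderiv ℝ U (v + t • e j) (e j) + fderiv ℝ U (v + (-t) • e j) (e j)
          = B * ρ - 2 * B * t ∧
        secondPartial n U (v + t • e j) j - secondPartial n U (v + (-t) • e j) j ≤ -(2 * B) := by
      obtain ⟨p1, p2⟩ := (hsm _ hp).hasDerivAt_slice (e j)
      obtain ⟨q1, q2⟩ := (hsm _ hq).hasDerivAt_slice (-e j)
      have htn : ∀ᶠ τ : ℝ in 𝓝 0, t + τ ∈ Icc 0 (ρ / 2) := by
        have hc : Tendsto (fun τ : ℝ => t + τ) (𝓝 0) (𝓝 t) := by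
          have : Continuous fun τ : ℝ => t + τ := by fun_prop
          simpa using this.tendsto 0
        exact hc.eventually (Icc_mem_nhds ht0' htρ')
      have hloc : IsLocalMax (fun τ : ℝ => U (v + t • e j + τ • e j)
          - U (v + (-t) • e j + τ • (-e j)) - (B * ρ * τ - B * (2 * t * τ + τ ^ 2))) 0 := by
        filter_upwards [htn] with τ hτ
        have := hmax (show (v, t + τ) ∈ S from ⟨hx.1, hτ⟩)
        simp only [Φ, mem_ofPred_eq] at this
        have e1 : v + (t + τ) • e j = v + t • e j + τ • e j := by module
        have e2 : v + (-(t + τ)) • e j = v + (-t) • e j + τ • (-e j) := by module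
        rw [e1, e2] at this
        simp only [zero_smul, add_zero]
        linarith
      obtain ⟨r1, r2⟩ := hloc.deriv_tests
        (f' := fun τ => fderiv ℝ U (v + t • e j + τ • e j) (e j)
          - fderiv ℝ U (v + (-t) • e j + τ • (-e j)) (-e j) - (B * ρ - B * (2 * t + 2 * τ)))
        (c := secondPartial n U (v + t • e j) j - secondPartial n U (v + (-t) • e j) j
          - -(B * 2))
        (by
          filter_upwards [p1, q1] with τ h1 h2
          refine (h1.sub h2).sub ?_
          refine (((hasDerivAt_id τ).const_mul (B * ρ)).sub ((((hasDerivAt_id τ).const_mul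
            (2 * t)).add (hasDerivAt_pow 2 τ)).const_mul B)).congr_deriv ?_
          simp)
        (by
          refine (p2.sub (q2.congr_deriv ?_)).sub ?_
          · simp [secondPartial, he]
          · simpa using ((((hasDerivAt_id (0 : ℝ)).const_mul 2).const_add (2 * t)).const_mul
              B).const_sub (B * ρ))
      simp only [zero_smul, add_zero, mul_zero, map_neg] at r1
      exact ⟨by linarith, by linarith⟩
    have hlap : lap n U (v + t • e j) - lap n U (v + (-t) • e j) ≤ 2 * A * n - 2 * B := by
      calc lap n U (v + t • e j) - lap n U (v + (-t) • e j)
          = ∑ k, (secondPartial n U (v + t • e j) k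
              - secondPartial n U (v + (-t) • e j) k) := by simp [lap]
        _ ≤ ∑ k, (2 * A + if k = j then -(2 * B) - 2 * A else 0) := by
          refine Finset.sum_le_sum fun k _ => ?_
          by_cases hk : k = j
          · subst hk; simpa using htime.2
          · simpa [hk] using (hspace k).2
        _ = _ := by
          simp [Finset.sum_add_distrib]
          ring
    have hP := hzp _ hp
    have hQ := hzp _ hq
    have eP := heq _ hp
    have eQ := heq _ hq
    have hD := (hspace (Fin.last n)).1
    have habs := abs_div_sub_div_le (A := A) (B := B) hρ hP hQ
      (a := fderiv ℝ U (v + t • e j) (e (Fin.last n)))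
      (b := fderiv ℝ U (v + (-t) • e j) (e (Fin.last n)))
      (by
        rw [hD, abs_mul, abs_of_pos (by positivity : 0 < 2 * A)]
        have h1 := (abs_zpart_sub_le n v v₀).trans hv
        calc _ ≤ 2 * A * (ρ / 2) := mul_le_mul_of_nonneg_left h1 (by positivity)
          _ = _ := by ring)
      (by
        rw [zpart_add_smul_single, zpart_add_smul_single]
        by_cases hj : j = Fin.last n
        · rw [← hj, htime.1]
          simp only [if_true]
          rw [abs_mul]
          have h1 : |B * ρ - 2 * B * t| ≤ B * ρ := by
            have h3 : 0 ≤ B * t := by positivity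
            have h4 : B * t ≤ B * (ρ / 2) := mul_le_mul_of_nonneg_left htρ hBpos.le
            rw [abs_le]; constructor <;> linarith
          have h2 : |zpart n v + -t - (zpart n v + t)| ≤ ρ := by
            rw [abs_le]; constructor <;> linarith
          calc _ ≤ (B * ρ) * ρ := by gcongr
            _ = _ := by ring
        · simp only [hj, if_false, sub_self, mul_zero, abs_zero]
          positivity)
    have hP0 : 0 < zpart n (v + t • e j) := by linarith
    have hQ0 : 0 < zpart n (v + (-t) • e j) := by linarith
    have lP : lap n U (v + t • e j) = -((1 - s) *
        (fderiv ℝ U (v + t • e j) (e (Fin.last n)) / zpart n (v + t • e j))) := by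
      field_simp
      linarith
    have lQ : lap n U (v + (-t) • e j) = -((1 - s) *
        (fderiv ℝ U (v + (-t) • e j) (e (Fin.last n)) / zpart n (v + (-t) • e j))) := by
      field_simp
      linarith
    rw [lP, lQ] at hlap
    have hs1 : |1 - s| ≤ 1 := by rw [abs_le]; constructor <;> linarith [hs.1, hs.2]
    have hfin : |(1 - s) * (fderiv ℝ U (v + t • e j) (e (Fin.last n)) / zpart n (v + t • e j) -
        fderiv ℝ U (v + (-t) • e j) (e (Fin.last n)) / zpart n (v + (-t) • e j))|
        ≤ (A + B) / 19 := by
      rw [abs_mul]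
      calc _ ≤ 1 * ((A + B) / 19) := by gcongr
        _ = _ := one_mul _
    have := (abs_le.mp hfin).2
    have hnA : 0 ≤ A * n := by positivity
    have hBn : B = 2 * (A * n) + 2 * A := by rw [hB]; ring
    linarith
  have hbound : ∀ τ ∈ Ioc (0 : ℝ) (ρ / 2), U (v₀ + τ • e j) - U (v₀ + τ • (-e j)) ≤ B * ρ * τ := by
    intro τ hτ
    have h1 := (hmax (show (v₀, τ) ∈ S from
      ⟨mem_closedBall_self (by positivity), hτ.1.le, hτ.2⟩)).trans key
    simp only [Φ, sub_self, norm_zero] at h1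
    rw [smul_neg, ← neg_smul]
    nlinarith [mul_nonneg hBpos.le (sq_nonneg τ)]
  have hv₀ : v₀ ∈ closedBall v₀ ρ := mem_closedBall_self hρ.le
  have hd := ((hsm _ hv₀).hasDerivAt_slice (e j)).1.self_of_nhds.sub
    ((hsm _ hv₀).hasDerivAt_slice (-e j)).1.self_of_nhds
  have hlim := hd.tendsto_slope_zero_right
  have hle : fderiv ℝ U (v₀ + (0 : ℝ) • e j) (e j) - fderiv ℝ U (v₀ + (0 : ℝ) • (-e j)) (-e j)
      ≤ B * ρ := by
    refine le_of_tendsto hlim ?_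
    filter_upwards [Ioc_mem_nhdsGT (show (0 : ℝ) < ρ / 2 by positivity)] with τ hτ
    have := hbound τ hτ
    have hτ0 := hτ.1
    simp only [zero_smul, add_zero, zero_add, Pi.sub_apply, sub_self, sub_zero, smul_eq_mul]
    rw [inv_mul_le_iff₀ hτ0]
    linarith
  simp only [zero_smul, add_zero, map_neg] at hle
  have : B * ρ = 2 * (8 * (n + 1) * m / ρ) := by
    rw [hB, hA]; field_simp
  linarith

set_option maxHeartbeats 1000000 in
/-- Comparison of a zero-trace solution with a supersolution `|v - v₀|² g(z) + H(z)` on a half-ball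
centred at a point `v₀` of the flat boundary. -/
theorem IsZeroTraceSolution.le_barrier {n : ℕ} {s r : ℝ} {U : Rn (n + 1) → ℝ} {v₀ : Rn (n + 1)}
    (hU : IsZeroTraceSolution n s U) (hr : 0 < r) (hr1 : r ≤ 1 / 20)
    (hv₀ : ‖v₀‖ ≤ 11 / 10) (hz₀ : zpart n v₀ = 0) {g g₁ g₂ H H₁ H₂ : ℝ → ℝ}
    (hgc : ContinuousOn g (Icc 0 r)) (hHc : ContinuousOn H (Icc 0 r))
    (hg0 : ∀ z ∈ Icc 0 r, 0 ≤ g z) (hH0 : ∀ z ∈ Icc 0 r, 0 ≤ H z)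
    (hg₁ : ∀ z, 0 < z → HasDerivAt g (g₁ z) z) (hg₂ : ∀ z, 0 < z → HasDerivAt g₁ (g₂ z) z)
    (hH₁ : ∀ z, 0 < z → HasDerivAt H (H₁ z) z) (hH₂ : ∀ z, 0 < z → HasDerivAt H₁ (H₂ z) z)
    (hsuper : ∀ z ∈ Ioo 0 r, ∀ R ∈ Icc 0 (r ^ 2),
      z * (2 * (n + 1) * g z + 4 * z * g₁ z + R * g₂ z + H₂ z) +
        (1 - s) * (2 * z * g z + R * g₁ z + H₁ z) < 0)
    (hbd : ∀ v, ‖v - v₀‖ = r → 0 < zpart n v → U v ≤ r ^ 2 * g (zpart n v)) :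
    ∀ v, ‖v - v₀‖ ≤ r → 0 ≤ zpart n v →
      U v ≤ ‖v - v₀‖ ^ 2 * g (zpart n v) + H (zpart n v) := by
  set e : Fin (n + 1) → Rn (n + 1) := fun k => EuclideanSpace.single k (1 : ℝ) with he
  let S : Set (Rn (n + 1)) := closedBall v₀ r ∩ {v | 0 ≤ zpart n v}
  have hzr : ∀ v ∈ S, zpart n v ∈ Icc 0 r := by
    rintro v ⟨h1, h2⟩
    rw [mem_closedBall, dist_eq_norm] at h1
    refine ⟨h2, ?_⟩
    have := (abs_le.mp ((abs_zpart_sub_le n v v₀).trans h1)).2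
    linarith
  have hnorm : ∀ v ∈ S, ‖v‖ ≤ 23 / 20 := by
    rintro v ⟨h1, -⟩
    rw [mem_closedBall, dist_eq_norm] at h1
    have := norm_add_le (v - v₀) v₀
    rw [sub_add_cancel] at this
    linarith
  let Φ : Rn (n + 1) → ℝ := fun v => U v - (‖v - v₀‖ ^ 2 * g (zpart n v) + H (zpart n v))
  have hSc : IsCompact S := (isCompact_closedBall _ _).inter_right
    (isClosed_le continuous_const (continuous_zpart n))
  have hSne : S.Nonempty := ⟨v₀, mem_closedBall_self hr.le, hz₀.ge⟩
  have hΦc : ContinuousOn Φ S := by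
    refine (hU.continuousOn.mono fun v hv => ⟨(hnorm v hv).trans (by norm_num), hv.2⟩).sub
      ((ContinuousOn.mul (by fun_prop) ?_).add ?_)
    · exact hgc.comp (continuous_zpart n).continuousOn hzr
    · exact hHc.comp (continuous_zpart n).continuousOn hzr
  obtain ⟨v, hvS, hmax⟩ := hSc.exists_isMaxOn hSne hΦc
  have key : Φ v ≤ 0 := by
    by_contra! hpos
    have hpos' : ‖v - v₀‖ ^ 2 * g (zpart n v) + H (zpart n v) < U v := sub_pos.mp hpos
    have hgv := hg0 _ (hzr v hvS)
    have hHv := hH0 _ (hzr v hvS)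
    have hvr : ‖v - v₀‖ ≤ r := by simpa [dist_eq_norm] using hvS.1
    have hz : 0 < zpart n v := by
      rcases (hzr v hvS).1.lt_or_eq with h | h
      · exact h
      · have := hU.trace v ((hnorm v hvS).trans (by norm_num)) h.symm
        have := mul_nonneg (sq_nonneg ‖v - v₀‖) hgv
        linarith
    have hvr' : ‖v - v₀‖ < r := by
      rcases hvr.lt_or_eq with h | h
      · exact h
      · have := hbd v h hz
        rw [h] at hpos'
        linarith
    have hzlt : zpart n v < r := by
      have := (abs_le.mp (abs_zpart_sub_le n v v₀)).2
      linarith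
    have hvB : v ∈ halfBall n 2 := ⟨(hnorm v hvS).trans_lt (by norm_num), hz⟩
    have hvn : ∀ᶠ w in 𝓝 v, w ∈ S := by
      have h1 : ∀ᶠ w in 𝓝 v, w ∈ ball v₀ r :=
        isOpen_ball.mem_nhds (by rwa [mem_ball, dist_eq_norm])
      have h2 : ∀ᶠ w in 𝓝 v, 0 < zpart n w := (continuous_zpart n).continuousAt.eventually
        (lt_mem_nhds hz)
      filter_upwards [h1, h2] with w h1 h2 using ⟨ball_subset_closedBall h1, h2.le⟩
    have hside : ∀ k, k ≠ Fin.last n → secondPartial n U v k ≤ 2 * g (zpart n v) := by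
      intro k hk
      obtain ⟨p1, p2⟩ := (hU.smooth v hvB).hasDerivAt_slice (e k)
      have hloc : IsLocalMax (fun τ : ℝ => U (v + τ • e k)
          - (2 * τ * (v k - v₀ k) + τ ^ 2) * g (zpart n v)) 0 := by
        filter_upwards [(add_smul_tendsto v (e k)).eventually hvn] with τ hτ
        have := hmax hτ
        simp only [Φ, mem_ofPred_eq] at this
        rw [norm_add_smul_single_sub_sq, zpart_add_smul_single, if_neg hk, add_zero] at this
        simp only [zero_smul, add_zero, mul_zero, zero_mul]
        linarith
      have r2 := (hloc.deriv_tests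
        (f' := fun τ => fderiv ℝ U (v + τ • e k) (e k)
          - (2 * (v k - v₀ k) + 2 * τ) * g (zpart n v))
        (c := secondPartial n U v k - 2 * g (zpart n v))
        (by
          filter_upwards [p1] with τ h1
          refine h1.sub (HasDerivAt.mul_const ?_ _)
          refine (((hasDerivAt_id τ).const_mul 2).mul_const (v k - v₀ k) |>.add
            (hasDerivAt_pow 2 τ)).congr_deriv ?_
          simp)
        (by
          refine p2.sub (HasDerivAt.mul_const ?_ _)
          simpa using ((hasDerivAt_id (0 : ℝ)).const_mul 2).const_add (2 * (v k - v₀ k)))).2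
      linarith
    have hlast : fderiv ℝ U v (e (Fin.last n)) = 2 * zpart n v * g (zpart n v)
          + ‖v - v₀‖ ^ 2 * g₁ (zpart n v) + H₁ (zpart n v) ∧
        secondPartial n U v (Fin.last n) ≤ 2 * g (zpart n v) + 4 * zpart n v * g₁ (zpart n v)
          + ‖v - v₀‖ ^ 2 * g₂ (zpart n v) + H₂ (zpart n v) := by
      obtain ⟨p1, p2⟩ := (hU.smooth v hvB).hasDerivAt_slice (e (Fin.last n))
      set ζ := zpart n v with hζ
      set R := ‖v - v₀‖ ^ 2 with hR
      have hv0 : v₀ (Fin.last n) = 0 := hz₀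
      have hvl : v (Fin.last n) = ζ := rfl
      have hloc : IsLocalMax (fun τ : ℝ => U (v + τ • e (Fin.last n))
          - ((R + 2 * τ * ζ + τ ^ 2) * g (ζ + τ) + H (ζ + τ))) 0 := by
        filter_upwards [(add_smul_tendsto v (e (Fin.last n))).eventually hvn] with τ hτ
        have := hmax hτ
        simp only [Φ, mem_ofPred_eq] at this
        rw [norm_add_smul_single_sub_sq, zpart_add_smul_single, if_pos rfl, hv0, hvl,
          sub_zero] at this
        simpa using this
      have hshift : ∀ {f f' : ℝ → ℝ}, (∀ z, 0 < z → HasDerivAt f (f' z) z) → ∀ τ, 0 < ζ + τ →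
          HasDerivAt (fun τ => f (ζ + τ)) (f' (ζ + τ)) τ := by
        intro f f' h τ hτ
        exact (h _ hτ).comp_const_add ζ τ
      have hζτ : ∀ᶠ τ : ℝ in 𝓝 0, 0 < ζ + τ := by
        filter_upwards [lt_mem_nhds (show -ζ < 0 by linarith)] with τ hτ
        linarith
      have hquad : ∀ τ : ℝ, HasDerivAt (fun τ : ℝ => R + 2 * τ * ζ + τ ^ 2)
          (2 * ζ + 2 * τ) τ := by
        intro τ
        refine ((((hasDerivAt_id τ).const_mul 2).mul_const ζ |>.const_add R).add
          (hasDerivAt_pow 2 τ)).congr_deriv ?_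
        simp
      have hlin : HasDerivAt (fun τ : ℝ => 2 * ζ + 2 * τ) 2 0 := by
        simpa using ((hasDerivAt_id (0 : ℝ)).const_mul 2).const_add (2 * ζ)
      have h00 : 0 < ζ + 0 := by linarith
      obtain ⟨r1, r2⟩ := hloc.deriv_tests
        (f' := fun τ => fderiv ℝ U (v + τ • e (Fin.last n)) (e (Fin.last n))
          - (((2 * ζ + 2 * τ) * g (ζ + τ) + (R + 2 * τ * ζ + τ ^ 2) * g₁ (ζ + τ)) + H₁ (ζ + τ)))
        (by
          filter_upwards [p1, hζτ] with τ h1 h2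
          exact h1.sub (((hquad τ).mul (hshift hg₁ τ h2)).add (hshift hH₁ τ h2)))
        (p2.sub (((hlin.mul (hshift hg₁ 0 h00)).add ((hquad 0).mul (hshift hg₂ 0 h00))).add
          (hshift hH₂ 0 h00)))
      simp only [zero_smul, add_zero, mul_zero, zero_mul, ne_eq, OfNat.ofNat_ne_zero,
        not_false_eq_true, zero_pow] at r1 r2
      refine ⟨by linarith, ?_⟩
      simp only [secondPartial]
      linarith
    have hlap : lap n U v ≤ 2 * (n + 1) * g (zpart n v) + 4 * zpart n v * g₁ (zpart n v)
          + ‖v - v₀‖ ^ 2 * g₂ (zpart n v) + H₂ (zpart n v) := by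
      have h1 : ∑ i : Fin n, secondPartial n U v i.castSucc
          ≤ ∑ _i : Fin n, 2 * g (zpart n v) :=
        Finset.sum_le_sum fun i _ => hside _ (Fin.castSucc_lt_last i).ne
      rw [lap, Fin.sum_univ_castSucc]
      simp only [Finset.sum_const, Finset.card_univ, Fintype.card_fin, nsmul_eq_mul] at h1
      linarith [hlast.2]
    have heq := hU.equation v hvB
    have hs := hsuper (zpart n v) ⟨hz, hzlt⟩ (‖v - v₀‖ ^ 2) ⟨by positivity, by gcongr⟩
    rw [← hlast.1] at hs
    have := mul_le_mul_of_nonneg_left hlap hz.le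
    linarith
  intro w hw hwz
  have hwS : w ∈ S := ⟨by rwa [mem_closedBall, dist_eq_norm], hwz⟩
  have := (hmax hwS).trans key
  simp only [Φ] at this
  linarith

theorem norm_sub_zpart_smul_le (n : ℕ) (v : Rn (n + 1)) :
    ‖v + (-zpart n v) • EuclideanSpace.single (Fin.last n) 1‖ ≤ ‖v‖ := by
  have h := norm_add_smul_single_sub_sq n v 0 (-zpart n v) (Fin.last n)
  simp only [sub_zero, PiLp.zero_apply] at h
  have hv : v (Fin.last n) = zpart n v := rfl
  rw [hv] at h
  refine (sq_le_sq₀ (norm_nonneg _) (norm_nonneg _)).mp ?_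
  nlinarith [sq_nonneg (zpart n v)]

/-- A barrier with boundary value `g` transferred to all points of height at most `1/20`. -/
theorem IsZeroTraceSolution.le_barrier_above {n : ℕ} {s ϱ : ℝ} {U : Rn (n + 1) → ℝ}
    (hU : IsZeroTraceSolution n s U) (hϱ : ϱ ≤ 11 / 10) {g g₁ g₂ H H₁ H₂ : ℝ → ℝ}
    (hgc : ContinuousOn g (Icc 0 (1 / 20))) (hHc : ContinuousOn H (Icc 0 (1 / 20)))
    (hg0 : ∀ z ∈ Icc (0 : ℝ) (1 / 20), 0 ≤ g z) (hH0 : ∀ z ∈ Icc (0 : ℝ) (1 / 20), 0 ≤ H z)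
    (hg₁ : ∀ z, 0 < z → HasDerivAt g (g₁ z) z) (hg₂ : ∀ z, 0 < z → HasDerivAt g₁ (g₂ z) z)
    (hH₁ : ∀ z, 0 < z → HasDerivAt H (H₁ z) z) (hH₂ : ∀ z, 0 < z → HasDerivAt H₁ (H₂ z) z)
    (hsuper : ∀ z ∈ Ioo (0 : ℝ) (1 / 20), ∀ R, 0 ≤ R →
      z * (2 * (n + 1) * g z + 4 * z * g₁ z + R * g₂ z + H₂ z) +
        (1 - s) * (2 * z * g z + R * g₁ z + H₁ z) < 0)
    (hbd : ∀ v ∈ halfBall n (ϱ + 1 / 20), 400 * U v ≤ g (zpart n v)) :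
    ∀ v ∈ halfBall n ϱ, zpart n v ≤ 1 / 20 →
      U v ≤ zpart n v ^ 2 * g (zpart n v) + H (zpart n v) := by
  rintro v ⟨hv, hz⟩ hz1
  set v₀ := v + (-zpart n v) • EuclideanSpace.single (Fin.last n) (1 : ℝ) with hv₀
  have hn : ‖v₀‖ < ϱ := (norm_sub_zpart_smul_le n v).trans_lt hv
  have hd : ‖v - v₀‖ = zpart n v := by
    rw [hv₀, sub_add_cancel_left, norm_neg, norm_smul]
    simp [abs_of_pos hz]
  have h := hU.le_barrier (r := 1 / 20) (v₀ := v₀) (by norm_num) le_rfl (by linarith)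
    (by rw [hv₀, zpart_add_smul_single]; simp) hgc hHc hg0 hH0 hg₁ hg₂ hH₁ hH₂
    (fun z hz R hR => hsuper z hz R hR.1)
    (by
      intro w hw hwz
      have hwn := norm_add_le (w - v₀) v₀
      rw [sub_add_cancel, hw] at hwn
      have := hbd w ⟨by linarith, hwz⟩
      linarith)
    v (hd.trans_le hz1) hz.le
  rwa [hd] at h

theorem hasDerivAt_const_mul_rpow_sub (K s c : ℝ) (m : ℕ) {z : ℝ} (hz : 0 < z) :
    HasDerivAt (fun z : ℝ => K * (z ^ s - c * z ^ m))
      (K * (s * z ^ (s - 1) - c * (m * z ^ (m - 1)))) z :=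
  ((Real.hasDerivAt_rpow_const (Or.inl hz.ne')).sub ((hasDerivAt_pow m z).const_mul c)).const_mul K

theorem sq_le_rpow_of_mem_Icc {s z : ℝ} (hs : s ∈ Set.Ioo (0 : ℝ) 2) (hz : z ∈ Icc (0 : ℝ) 1) :
    z ^ 2 ≤ z ^ s := by
  rcases hz.1.lt_or_eq with h | h
  · rw [← Real.rpow_natCast]
    exact Real.rpow_le_rpow_of_exponent_ge h hz.2 (by exact_mod_cast hs.2.le)
  · rw [← h, Real.zero_rpow hs.1.ne']
    norm_num

/-- Decay of order `z ^ s` when `s ≤ 3 / 2`. -/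
theorem IsZeroTraceSolution.le_rpow_of_le {n : ℕ} {s : ℝ} {U : Rn (n + 1) → ℝ}
    (hU : IsZeroTraceSolution n s U) (hs : s ∈ Set.Ioo (0 : ℝ) 2) (hs' : s ≤ 3 / 2)
    (hN : ∀ v ∈ halfBall n (6 / 5), 400 * U v ≤ 1) :
    ∀ v ∈ halfBall n (21 / 20), zpart n v ≤ 1 / 20 →
      U v ≤ (4 * n + 10) * zpart n v ^ s := by
  intro v hv hz1
  have hz : 0 < zpart n v := hv.2
  have hs0 := hs.1
  have h := hU.le_barrier_above (ϱ := 21 / 20) (by norm_num) (g := fun _ => 1) (g₁ := fun _ => 0)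
    (g₂ := fun _ => 0) (H := fun z => (4 * n + 9) * (z ^ s - 1 / 2 * z ^ 2))
    (H₁ := fun z => (4 * n + 9) * (s * z ^ (s - 1) - 1 / 2 * (2 * z)))
    (H₂ := fun z => (4 * n + 9) * (s * ((s - 1) * z ^ (s - 1 - 1)) - 1))
    continuousOn_const
    ((((Real.continuous_rpow_const hs0.le).sub (by fun_prop)).const_mul _).continuousOn)
    (fun _ _ => zero_le_one)
    (fun z hz => by
      have := sq_le_rpow_of_mem_Icc hs ⟨hz.1, hz.2.trans (by norm_num)⟩
      have : 0 ≤ z ^ s - 1 / 2 * z ^ 2 := by nlinarith [sq_nonneg z]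
      positivity)
    (fun z _ => hasDerivAt_const z _) (fun z _ => hasDerivAt_const z _)
    (fun z hz => by simpa using hasDerivAt_const_mul_rpow_sub (4 * n + 9) s (1 / 2) 2 hz)
    (fun z hz => by
      refine (((Real.hasDerivAt_rpow_const (Or.inl hz.ne')).const_mul s).sub
        (((hasDerivAt_id z).const_mul 2).const_mul (1 / 2))).const_mul _ |>.congr_deriv ?_
      norm_num)
    (fun z ⟨hz, _⟩ R _ => by
      have hp : z * z ^ (s - 1 - 1) = z ^ (s - 1) := by
        rw [Real.rpow_sub_one hz.ne']; field_simp
      have e1 : z * (2 * (n + 1) * 1 + 4 * z * 0 + R * 0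
            + (4 * n + 9) * (s * ((s - 1) * z ^ (s - 1 - 1)) - 1)) +
          (1 - s) * (2 * z * 1 + R * 0 + (4 * n + 9) * (s * z ^ (s - 1) - 1 / 2 * (2 * z)))
          = z * (2 * (n + 1) + 2 * (1 - s) - (4 * n + 9) * (2 - s)) := by
        linear_combination (4 * n + 9) * s * (s - 1) * hp
      rw [e1]
      refine mul_neg_of_pos_of_neg hz ?_
      nlinarith [Nat.cast_nonneg (α := ℝ) n])
    (fun w hw => hN w ⟨hw.1.trans (by norm_num), hw.2⟩) v hv hz1
  have h2 := sq_le_rpow_of_mem_Icc hs ⟨hz.le, hz1.trans (by norm_num)⟩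
  nlinarith [mul_nonneg (Nat.cast_nonneg (α := ℝ) n) (sq_nonneg (zpart n v)),
    sq_nonneg (zpart n v)]

/-- Linear decay when `3 / 2 ≤ s`. -/
theorem IsZeroTraceSolution.le_linear_of_ge {n : ℕ} {s : ℝ} {U : Rn (n + 1) → ℝ}
    (hU : IsZeroTraceSolution n s U) (hs' : 3 / 2 ≤ s)
    (hN : ∀ v ∈ halfBall n (6 / 5), 400 * U v ≤ 1) :
    ∀ v ∈ halfBall n (11 / 10), U v ≤ (4 * n + 10) * zpart n v := by
  intro v hv
  have hz : 0 < zpart n v := hv.2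
  have hnz : 0 ≤ n * zpart n v := by positivity
  rcases le_or_gt (zpart n v) (1 / 20) with hz1 | hz1
  · have h := hU.le_barrier_above (ϱ := 11 / 10) (by norm_num) (g := fun _ => 1)
      (g₁ := fun _ => 0) (g₂ := fun _ => 0) (H := fun z => (4 * n + 9) * z)
      (H₁ := fun _ => (4 * n + 9)) (H₂ := fun _ => 0)
      continuousOn_const (by fun_prop) (fun _ _ => zero_le_one)
      (fun z hz => mul_nonneg (by positivity) hz.1)
      (fun z _ => hasDerivAt_const z _) (fun z _ => hasDerivAt_const z _)
      (fun z _ => by simpa using (hasDerivAt_id z).const_mul (4 * n + 9 : ℝ))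
      (fun z _ => hasDerivAt_const z _)
      (fun z ⟨hz, hz1⟩ R _ => by
        nlinarith [mul_nonneg (sub_nonneg.mpr hs') (Nat.cast_nonneg (α := ℝ) n),
          mul_nonneg (sub_nonneg.mpr hz1.le) (Nat.cast_nonneg (α := ℝ) n),
          mul_nonneg (sub_nonneg.mpr hs') hz.le])
      (fun w hw => hN w ⟨hw.1.trans_le (by norm_num), hw.2⟩) v hv hz1
    nlinarith
  · have := hN v ⟨hv.1.trans (by norm_num), hv.2⟩
    linarith

/-- Decay of order `z ^ s` when `3 / 2 ≤ s`. -/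
theorem IsZeroTraceSolution.le_rpow_of_ge {n : ℕ} {s : ℝ} {U : Rn (n + 1) → ℝ}
    (hU : IsZeroTraceSolution n s U) (hs : s ∈ Set.Ioo (0 : ℝ) 2) (hs' : 3 / 2 ≤ s)
    (hN : ∀ v ∈ halfBall n (6 / 5), 400 * U v ≤ 1) :
    ∀ v ∈ halfBall n (21 / 20), zpart n v ≤ 1 / 20 →
      U v ≤ 400 * (4 * n + 10) ^ 2 * zpart n v ^ s := by
  intro v hv hz1
  have hz : 0 < zpart n v := hv.2
  have hs0 := hs.1
  have hlin := hU.le_linear_of_ge hs' hN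
  set c : ℝ := (400 * (4 * n + 10))⁻¹ with hc
  have hcpos : 0 < c := by positivity
  have hcK : c * (400 * (4 * n + 10)) = 1 := inv_mul_cancel₀ (by positivity)
  have h := (hU.const_mul c).le_barrier_above (ϱ := 21 / 20) (by norm_num) (g := fun z => z)
    (g₁ := fun _ => 1) (g₂ := fun _ => 0) (H := fun z => (4 * n + 9) * (z ^ s - 1 / 2 * z ^ 3))
    (H₁ := fun z => (4 * n + 9) * (s * z ^ (s - 1) - 1 / 2 * (3 * z ^ 2)))
    (H₂ := fun z => (4 * n + 9) * (s * ((s - 1) * z ^ (s - 1 - 1)) - 1 / 2 * (3 * (2 * z))))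
    continuousOn_id
    ((((Real.continuous_rpow_const hs0.le).sub (by fun_prop)).const_mul _).continuousOn)
    (fun _ hz => hz.1)
    (fun z hz => by
      have h1 := sq_le_rpow_of_mem_Icc hs ⟨hz.1, hz.2.trans (by norm_num)⟩
      have : 0 ≤ z ^ s - 1 / 2 * z ^ 3 := by
        nlinarith [mul_nonneg (sub_nonneg.mpr hz.2) (sq_nonneg z), sq_nonneg z]
      positivity)
    (fun z _ => hasDerivAt_id z) (fun z _ => hasDerivAt_const z _)
    (fun z hz => by simpa using hasDerivAt_const_mul_rpow_sub (4 * n + 9) s (1 / 2) 3 hz)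
    (fun z hz => by
      refine (((Real.hasDerivAt_rpow_const (Or.inl hz.ne')).const_mul s).sub
        (((hasDerivAt_pow 2 z).const_mul 3).const_mul (1 / 2))).const_mul _ |>.congr_deriv ?_
      norm_num)
    (fun z ⟨hz, _⟩ R hR => by
      have hp : z * z ^ (s - 1 - 1) = z ^ (s - 1) := by
        rw [Real.rpow_sub_one hz.ne']; field_simp
      have e1 : z * (2 * (n + 1) * z + 4 * z * 1 + R * 0
            + (4 * n + 9) * (s * ((s - 1) * z ^ (s - 1 - 1)) - 1 / 2 * (3 * (2 * z)))) +
          (1 - s) * (2 * z * z + R * 1 + (4 * n + 9) * (s * z ^ (s - 1) - 1 / 2 * (3 * z ^ 2)))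
          = z ^ 2 * (2 * n + 6 + 2 * (1 - s) - (4 * n + 9) * (3 / 2) * (3 - s)) + (1 - s) * R := by
        linear_combination (4 * n + 9) * s * (s - 1) * hp
      rw [e1]
      have h1 : z ^ 2 * (2 * n + 6 + 2 * (1 - s) - (4 * n + 9) * (3 / 2) * (3 - s)) < 0 := by
        refine mul_neg_of_pos_of_neg (by positivity) ?_
        nlinarith [Nat.cast_nonneg (α := ℝ) n, hs.2,
          mul_nonneg (sub_nonneg.mpr hs.2.le) (Nat.cast_nonneg (α := ℝ) n)]
      nlinarith [mul_nonneg (sub_nonneg.mpr hs') hR])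
    (fun w hw => by
      have h1 := mul_le_mul_of_nonneg_left (hlin w ⟨hw.1.trans_le (by norm_num), hw.2⟩) hcpos.le
      have : c * ((4 * n + 10) * zpart n w) * 400 = zpart n w := by
        linear_combination zpart n w * hcK
      linarith) v hv hz1
  have h2 := sq_le_rpow_of_mem_Icc hs ⟨hz.le, hz1.trans (by norm_num)⟩
  have h3 : c * U v ≤ (4 * n + 10) * zpart n v ^ s := by
    nlinarith [mul_nonneg (sub_nonneg.mpr hz1) (sq_nonneg (zpart n v)),
      mul_nonneg (Nat.cast_nonneg (α := ℝ) n) (pow_pos hz 3).le, sq_nonneg (zpart n v), pow_pos hz 3]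
  have h4 := mul_le_mul_of_nonneg_left h3 (by positivity : (0 : ℝ) ≤ 400 * (4 * n + 10))
  calc U v = 400 * (4 * n + 10) * (c * U v) := by linear_combination -(U v) * hcK
    _ ≤ _ := h4
    _ = _ := by ring

/-- Decay of order `z ^ s` at the flat boundary. -/
theorem IsZeroTraceSolution.abs_le_rpow {n : ℕ} {s N : ℝ} {U : Rn (n + 1) → ℝ}
    (hU : IsZeroTraceSolution n s U) (hs : s ∈ Set.Ioo (0 : ℝ) 2) (hN0 : 0 < N)
    (hN : ∀ v ∈ halfBall n (6 / 5), |U v| ≤ N) :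
    ∀ v ∈ halfBall n (21 / 20),
      |U v| ≤ 160000 * (4 * n + 10) ^ 2 * N * zpart n v ^ s := by
  intro v hv
  have hz : 0 < zpart n v := hv.2
  have hzs : 0 < zpart n v ^ s := Real.rpow_pos_of_pos hz s
  have hn1 : (1 : ℝ) ≤ (4 * n + 10) ^ 2 := by nlinarith [Nat.cast_nonneg (α := ℝ) n]
  have hn2 : (4 * n + 10 : ℝ) ≤ 400 * (4 * n + 10) ^ 2 := by
    nlinarith [Nat.cast_nonneg (α := ℝ) n]
  rcases le_or_gt (zpart n v) (1 / 20) with hz1 | hz1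
  · have hone : ∀ c : ℝ, 400 * N * |c| = 1 →
        c * U v ≤ 400 * (4 * n + 10) ^ 2 * zpart n v ^ s := by
      intro c hc
      have hb : ∀ w ∈ halfBall n (6 / 5), 400 * (c * U w) ≤ 1 := by
        intro w hw
        calc 400 * (c * U w) ≤ 400 * (|c| * |U w|) := by
              rw [← abs_mul]; gcongr; exact le_abs_self _
          _ ≤ 400 * (|c| * N) := by gcongr; exact hN w hw
          _ = 1 := by linarith
      rcases le_total s (3 / 2) with h | h
      · exact ((hU.const_mul c).le_rpow_of_le hs h hb v hv hz1).trans (by gcongr)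
      · exact (hU.const_mul c).le_rpow_of_ge hs h hb v hv hz1
    have h1 := hone (400 * N)⁻¹ (by rw [abs_of_pos (by positivity)]; field_simp)
    have h2 := hone (-(400 * N)⁻¹) (by rw [abs_neg, abs_of_pos (by positivity)]; field_simp)
    rw [neg_mul, neg_le] at h2
    rw [inv_mul_le_iff₀ (by positivity)] at h1
    rw [le_inv_mul_iff₀ (by positivity)] at h2
    rw [abs_le]
    constructor <;> linarith
  · have hbig : 1 ≤ 400 * zpart n v ^ s := by
      rcases le_total (zpart n v) 1 with h | h
      · have := sq_le_rpow_of_mem_Icc hs ⟨hz.le, h⟩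
        nlinarith
      · have := Real.one_le_rpow h hs.1.le
        linarith
    calc |U v| ≤ N := hN v ⟨hv.1.trans (by norm_num), hv.2⟩
      _ ≤ N * (400 * zpart n v ^ s * (400 * (4 * n + 10) ^ 2)) :=
        le_mul_of_one_le_right hN0.le (one_le_mul_of_one_le_of_one_le hbig (by linarith))
      _ = _ := by ring

/-- The weighted gradient estimate in terms of an upper bound for `|U|` on `B_{6/5}⁺`. -/
theorem IsZeroTraceSolution.weighted_gradient_le {n : ℕ} {s N : ℝ} {U : Rn (n + 1) → ℝ}
    (hU : IsZeroTraceSolution n s U) (hs : s ∈ Set.Ioo (0 : ℝ) 2) (hN0 : 0 < N)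
    (hN : ∀ v ∈ halfBall n (6 / 5), |U v| ≤ N) {v : Rn (n + 1)} (hv : v ∈ halfBall n 1) :
    zpart n v ^ (1 - s) * Real.sqrt (gradSq n U v) ≤
      51200000 * (n + 1) ^ 2 * (4 * n + 10) ^ 2 * N := by
  have hz : 0 < zpart n v := hv.2
  have hzv : zpart n v ≤ ‖v‖ := by
    simpa [zpart] using (le_abs_self _).trans (PiLp.norm_apply_le v (Fin.last n))
  have hv1 : ‖v‖ < 1 := hv.1
  set ρ := zpart n v / 20 with hρ
  have hρ0 : 0 < ρ := by positivity
  have hzs : 0 < zpart n v ^ s := Real.rpow_pos_of_pos hz s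
  set m : ℝ := 320000 * (4 * n + 10) ^ 2 * N * zpart n v ^ s with hm
  have hm0 : 0 < m := by positivity
  have hsub : ∀ w ∈ closedBall v ρ, w ∈ halfBall n (21 / 20) ∧ zpart n w ≤ 21 / 20 * zpart n v := by
    intro w hw
    rw [mem_closedBall, dist_eq_norm] at hw
    have h1 := norm_add_le (w - v) v
    rw [sub_add_cancel] at h1
    have h2 := abs_le.mp ((abs_zpart_sub_le n w v).trans hw)
    exact ⟨⟨by linarith, by linarith⟩, by linarith⟩
  have hsub2 : ∀ w ∈ closedBall v ρ, w ∈ halfBall n 2 := fun w hw =>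
    ⟨(hsub w hw).1.1.trans (by norm_num), (hsub w hw).1.2⟩
  have hUm : ∀ w ∈ closedBall v ρ, |U w| ≤ m := by
    intro w hw
    obtain ⟨hw1, hw2⟩ := hsub w hw
    have h1 : zpart n w ^ s ≤ 2 * zpart n v ^ s := by
      calc zpart n w ^ s ≤ (21 / 20 * zpart n v) ^ s :=
            Real.rpow_le_rpow hw1.2.le hw2 hs.1.le
        _ = (21 / 20) ^ s * zpart n v ^ s := Real.mul_rpow (by norm_num) hz.le
        _ ≤ 2 * zpart n v ^ s := by
          gcongr
          calc (21 / 20 : ℝ) ^ s ≤ (21 / 20) ^ (2 : ℝ) :=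
                Real.rpow_le_rpow_of_exponent_le (by norm_num) hs.2.le
            _ ≤ 2 := by norm_num
    calc |U w| ≤ 160000 * (4 * n + 10) ^ 2 * N * zpart n w ^ s := hU.abs_le_rpow hs hN0 hN w hw1
      _ ≤ 160000 * (4 * n + 10) ^ 2 * N * (2 * zpart n v ^ s) := by gcongr
      _ = m := by rw [hm]; ring
  set P : ℝ := 8 * (n + 1) * m / ρ with hP
  have hP0 : 0 < P := by positivity
  have hpart : ∀ j, |fderiv ℝ U v (EuclideanSpace.single j 1)| ≤ P := by
    intro j
    have h1 := partial_le_of_equation hs hρ0 (by rw [hρ]; linarith)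
      (fun w hw => hU.smooth w (hsub2 w hw)) (fun w hw => hU.equation w (hsub2 w hw)) hm0 hUm j
    have hU' := hU.const_mul (-1)
    have h2 := partial_le_of_equation hs hρ0 (by rw [hρ]; linarith)
      (fun w hw => hU'.smooth w (hsub2 w hw)) (fun w hw => hU'.equation w (hsub2 w hw)) hm0
      (fun w hw => by simpa using hUm w hw) j
    simp only [neg_mul, one_mul, fderiv_fun_neg, FunLike.coe_neg, Pi.neg_apply] at h2
    exact abs_le.mpr ⟨by linarith, h1⟩
  have hgrad : Real.sqrt (gradSq n U v) ≤ (n + 1) * P := by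
    rw [Real.sqrt_le_left (by positivity)]
    calc gradSq n U v ≤ ∑ _i : Fin (n + 1), P ^ 2 :=
          Finset.sum_le_sum fun i _ => sq_le_sq' (abs_le.mp (hpart i)).1 (abs_le.mp (hpart i)).2
      _ = (n + 1) * P ^ 2 := by simp
      _ ≤ (n + 1) * ((n + 1) * P ^ 2) := by
        refine mul_le_mul_of_nonneg_left (le_mul_of_one_le_left (by positivity) ?_) (by positivity)
        linarith [Nat.cast_nonneg (α := ℝ) n]
      _ = _ := by ring
  have hpow : zpart n v ^ (1 - s) * zpart n v ^ s = zpart n v := by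
    rw [← Real.rpow_add hz]; simp
  calc zpart n v ^ (1 - s) * Real.sqrt (gradSq n U v)
      ≤ zpart n v ^ (1 - s) * ((n + 1) * P) := by gcongr
    _ = 51200000 * (n + 1) ^ 2 * (4 * n + 10) ^ 2 * N *
        ((zpart n v ^ (1 - s) * zpart n v ^ s) / zpart n v) := by
      rw [hP, hm, hρ]; field_simp; ring
    _ = _ := by rw [hpow, div_self hz.ne', mul_one]

end

/-- **Weighted gradient estimate for the degenerate extension equation with vanishing
trace** (Lemma B.1 of the paper): a bounded solution of `div(z^{1-s}∇U)=0` on `B₂⁺` with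
zero trace on `{|x| ≤ 3/2, z = 0}` satisfies `z^{1-s}|∇U| ≤ (C/s) sup_{B_{6/5}⁺}|U|`
on `B₁⁺`, with `C = C(n)`. -/
theorem weighted_gradient_estimate_extension (n : ℕ) (hn : 1 ≤ n) :
    ∃ C : ℝ, 0 < C ∧
    ∀ s : ℝ, s ∈ Set.Ioo (0 : ℝ) 2 →
    ∀ U : Rn (n + 1) → ℝ,
      ContinuousOn U {v | ‖v‖ ≤ 2 ∧ 0 ≤ zpart n v} →
      (∃ M : ℝ, ∀ v ∈ {v : Rn (n + 1) | ‖v‖ ≤ 2 ∧ 0 ≤ zpart n v}, |U v| ≤ M) →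
      (∀ v ∈ halfBall n 2, ContDiffAt ℝ (⊤ : ℕ∞) U v) →
      (∀ v ∈ halfBall n 2,
        zpart n v * lap n U v +
          (1 - s) * fderiv ℝ U v (EuclideanSpace.single (Fin.last n) 1) = 0) →
      (∀ v : Rn (n + 1), ‖v‖ ≤ 3 / 2 → zpart n v = 0 → U v = 0) →
      ∀ v ∈ halfBall n 1,
        zpart n v ^ (1 - s) * Real.sqrt (gradSq n U v) ≤
          C / s * sSup ((fun w => |U w|) '' halfBall n (6 / 5)) := by
  refine ⟨2 * (51200000 * (n + 1) ^ 2 * (4 * n + 10) ^ 2), by positivity, ?_⟩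
  rintro s hs U hUc ⟨M, hM⟩ hsm heq htr v hv
  have hU : IsZeroTraceSolution n s U := ⟨hUc, hsm, heq, htr⟩
  set K : ℝ := 51200000 * (n + 1) ^ 2 * (4 * n + 10) ^ 2 with hK
  have hK0 : 0 < K := by positivity
  set T : ℝ := sSup ((fun w => |U w|) '' halfBall n (6 / 5)) with hT
  have hbdd : BddAbove ((fun w => |U w|) '' halfBall n (6 / 5)) := by
    refine ⟨M, ?_⟩
    rintro _ ⟨w, hw, rfl⟩
    exact hM w ⟨hw.1.le.trans (by norm_num), hw.2.le⟩
  have hle : ∀ w ∈ halfBall n (6 / 5), |U w| ≤ T := fun w hw => le_csSup hbdd ⟨w, hw, rfl⟩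
  have hT0 : 0 ≤ T := (abs_nonneg _).trans (hle v ⟨hv.1.trans (by norm_num), hv.2⟩)
  have hKT : zpart n v ^ (1 - s) * Real.sqrt (gradSq n U v) ≤ K * T := by
    refine le_of_forall_pos_le_add fun ε hε => ?_
    have h := hU.weighted_gradient_le hs (N := T + ε / K) (by positivity)
      (fun w hw => (hle w hw).trans (le_add_of_nonneg_right (by positivity))) hv
    calc _ ≤ K * (T + ε / K) := h
      _ = K * T + ε := by field_simp
  have hs2 : K ≤ 2 * K / s := by
    rw [le_div_iff₀ hs.1]
    nlinarith [hs.2]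
  exact hKT.trans (mul_le_mul_of_nonneg_right hs2 hT0)

end
end

section
/- Local energy of the Caffarelli–Silvestre extension controlled by the Gagliardo energy (Euclidean version): let n ≥ 1, s₀ ∈ (0,2) and s ∈ (s₀,2). Let u : ℝ^n → [-1,1] be measurable and let U be its Caffarelli–Silvestre extension. Then ∫_{B₁^+} z^{1-s}·|∇U(x,z)|² dx dz ≤ C·∬_{(ℝ^n×ℝ^n)∖(B₂^c×B₂^c)} |u(x)-u(y)|²·|x-y|^{-(n+s)} dx dy, with C depending only on n and s₀ (both sides being allowed to equal +∞), where B₂ ⊆ ℝ^n is the ball of radius 2 centered at 0 and B₂^c := ℝ^n∖B₂. -/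
open MeasureTheory Real Set Metric

noncomputable section

/-- `y ↦ (|y|² + z²)^{-a/2}` is integrable on `ℝⁿ` for `a > n`, and its integral scales in `z`. -/
lemma integrable_norm_sq_add_rpow {n : ℕ} {a z : ℝ} (ha : (n : ℝ) < a) (hz : 0 < z) :
    Integrable (fun y : Rn n => (‖y‖ ^ 2 + z ^ 2) ^ (-a / 2)) ∧
      ∫ y : Rn n, (‖y‖ ^ 2 + z ^ 2) ^ (-a / 2) =
        z ^ ((n : ℝ) - a) * ∫ y : Rn n, (‖y‖ ^ 2 + 1) ^ (-a / 2) := by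
  have hscale : (fun y : Rn n => (‖y‖ ^ 2 + z ^ 2) ^ (-a / 2)) =
      fun y => z ^ (-a) * (fun w : Rn n => (‖w‖ ^ 2 + 1) ^ (-a / 2)) (z⁻¹ • y) := by
    funext y
    have h1 : ‖y‖ ^ 2 + z ^ 2 = z ^ 2 * (‖z⁻¹ • y‖ ^ 2 + 1) := by
      rw [norm_smul, norm_inv, Real.norm_of_nonneg hz.le]
      field_simp
    have h2 : (z ^ 2) ^ (-a / 2) = z ^ (-a) := by
      rw [← Real.rpow_natCast, ← Real.rpow_mul hz.le]
      congr 1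
      push_cast
      ring
    simp only
    rw [h1, Real.mul_rpow (by positivity) (by positivity), h2]
  have hInt : Integrable (fun w : Rn n => (‖w‖ ^ 2 + 1) ^ (-a / 2)) := by
    have := integrable_rpow_neg_one_add_norm_sq (E := Rn n) (μ := volume) (r := a) (by simpa using ha)
    simpa only [add_comm] using this
  rw [hscale]
  refine ⟨(hInt.comp_smul (inv_ne_zero hz.ne')).const_mul _, ?_⟩
  rw [integral_const_mul, Measure.integral_comp_inv_smul volume
    (fun w : Rn n => (‖w‖ ^ 2 + 1) ^ (-a / 2)) z, abs_of_pos (by positivity),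
    finrank_euclideanSpace_fin, smul_eq_mul, ← mul_assoc, ← Real.rpow_natCast,
    ← Real.rpow_add hz]
  congr 2
  ring

lemma integral_norm_sq_add_one_rpow_pos {n : ℕ} {a : ℝ} (ha : (n : ℝ) < a) :
    0 < ∫ y : Rn n, (‖y‖ ^ 2 + 1) ^ (-a / 2) := by
  have hInt := (integrable_norm_sq_add_rpow (n := n) ha one_pos).1
  simp only [one_pow] at hInt
  have hpos : ∀ y : Rn n, 0 < (‖y‖ ^ 2 + 1) ^ (-a / 2) := fun y => by positivity
  rw [integral_pos_iff_support_of_nonneg (fun y => (hpos y).le) hInt]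
  have : Function.support (fun y : Rn n => (‖y‖ ^ 2 + 1) ^ (-a / 2)) = univ :=
    eq_univ_of_forall fun y => (hpos y).ne'
  rw [this]
  exact isOpen_univ.measure_pos volume univ_nonempty

lemma sigmaC_pos {n : ℕ} {s : ℝ} (hs : 0 < s) : 0 < sigmaC n s :=
  inv_pos.2 (integral_norm_sq_add_one_rpow_pos (by linarith))

lemma sigmaC_le_sigmaC {n : ℕ} {s t : ℝ} (hs : 0 < s) (hst : s ≤ t) :
    sigmaC n s ≤ sigmaC n t := by
  have h : ∀ r : ℝ, 0 < r →
      Integrable fun y : Rn n => (‖y‖ ^ 2 + 1) ^ (-((n : ℝ) + r) / 2) := fun r hr => by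
    simpa using (integrable_norm_sq_add_rpow (n := n) (a := n + r) (by linarith) one_pos).1
  refine inv_anti₀ (integral_norm_sq_add_one_rpow_pos (by linarith)) ?_
  refine integral_mono (h t (by linarith)) (h s hs) fun y => ?_
  refine Real.rpow_le_rpow_of_exponent_le ?_ (by linarith)
  nlinarith [sq_nonneg ‖y‖]

lemma integrable_poissonKer {n : ℕ} {s z : ℝ} (hs : 0 < s) (hz : 0 < z) (x : Rn n) :
    Integrable fun y => poissonKer n s (x - y) z := by
  have := ((integrable_norm_sq_add_rpow (n := n) (a := n + s) (by linarith) hz).1.const_mul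
    (sigmaC n s * z ^ s)).comp_sub_left x
  exact this

lemma integral_poissonKer {n : ℕ} {s z : ℝ} (hs : 0 < s) (hz : 0 < z) (x : Rn n) :
    ∫ y, poissonKer n s (x - y) z = 1 := by
  rw [integral_sub_left_eq_self (fun y => poissonKer n s y z)]
  have hpos := integral_norm_sq_add_one_rpow_pos (n := n) (a := n + s) (by linarith)
  simp only [poissonKer]
  rw [integral_const_mul, (integrable_norm_sq_add_rpow (n := n) (a := n + s) (by linarith) hz).2,
    sigmaC]
  have : z ^ s * z ^ ((n : ℝ) - (n + s)) = 1 := by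
    rw [← Real.rpow_add hz]
    simp
  rw [mul_assoc, ← mul_assoc (z ^ s), this, one_mul]
  exact inv_mul_cancel₀ hpos.ne'

lemma poissonKer_nonneg {n : ℕ} {s z : ℝ} (hs : 0 < s) (hz : 0 < z) (x : Rn n) :
    0 ≤ poissonKer n s x z := by
  have := (sigmaC_pos (n := n) hs).le
  unfold poissonKer
  positivity

/-- Harnack-type comparison of the Poisson kernel at two points. -/
lemma poissonKer_le_mul {n : ℕ} {s z z' q : ℝ} {x x' : Rn n} (hs : 0 < s) (hs2 : s ≤ 2)
    (hz : 0 < z) (hz' : 0 < z') (hq : 1 ≤ q) (hzz : z' ≤ q * z)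
    (hxx : ‖x‖ ^ 2 + z ^ 2 ≤ q ^ 2 * (‖x'‖ ^ 2 + z' ^ 2)) :
    poissonKer n s x' z' ≤ q ^ (n + 4) * poissonKer n s x z := by
  have hσ := sigmaC_pos (n := n) hs
  have hq0 : 0 < q := by linarith
  have h1 : z' ^ s ≤ q ^ s * z ^ s := by
    rw [← Real.mul_rpow hq0.le hz.le]
    exact Real.rpow_le_rpow hz'.le hzz hs.le
  have h2 : (‖x'‖ ^ 2 + z' ^ 2) ^ (-((n : ℝ) + s) / 2) ≤
      q ^ ((n : ℝ) + s) * (‖x‖ ^ 2 + z ^ 2) ^ (-((n : ℝ) + s) / 2) := by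
    have h3 : q ^ ((n : ℝ) + s) = (q ^ 2)⁻¹ ^ (-((n : ℝ) + s) / 2) := by
      rw [← Real.rpow_natCast, ← Real.rpow_neg hq0.le, ← Real.rpow_mul hq0.le]
      congr 1
      push_cast
      ring
    rw [h3, ← Real.mul_rpow (by positivity) (by positivity)]
    refine Real.rpow_le_rpow_of_nonpos (by positivity) ?_ ?_
    · rwa [inv_mul_le_iff₀ (by positivity)]
    · have : (0 : ℝ) ≤ n := Nat.cast_nonneg n
      linarith
  have h4 : q ^ s * q ^ ((n : ℝ) + s) ≤ q ^ (n + 4) := by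
    rw [← Real.rpow_add hq0, ← Real.rpow_natCast]
    refine Real.rpow_le_rpow_of_exponent_le hq ?_
    push_cast
    linarith
  calc poissonKer n s x' z'
      ≤ sigmaC n s * (q ^ s * z ^ s) *
          (q ^ ((n : ℝ) + s) * (‖x‖ ^ 2 + z ^ 2) ^ (-((n : ℝ) + s) / 2)) := by
        unfold poissonKer
        gcongr
    _ = (q ^ s * q ^ ((n : ℝ) + s)) * poissonKer n s x z := by
        unfold poissonKer
        ring
    _ ≤ _ := mul_le_mul_of_nonneg_right h4 (poissonKer_nonneg hs hz x)

lemma one_add_pow_le {t : ℝ} (ht : 0 ≤ t) (ht1 : t ≤ 1) (m : ℕ) :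
    (1 + t) ^ m ≤ 1 + (2 ^ m - 1) * t := by
  induction m with
  | zero => simp
  | succ m ih =>
    have h1 : (1 : ℝ) ≤ 2 ^ m := one_le_pow₀ (by norm_num)
    rw [pow_succ, pow_succ]
    nlinarith [mul_nonneg (mul_nonneg (sub_nonneg.2 h1) ht) (sub_nonneg.2 ht1)]

/-- Lipschitz estimate for the Poisson kernel. -/
lemma abs_poissonKer_sub_le {n : ℕ} {s z z' d : ℝ} {x x' : Rn n} (hs : 0 < s) (hs2 : s ≤ 2)
    (hz : 0 < z) (hd : d ≤ z / 4) (hx : ‖x' - x‖ ≤ d) (hzd : |z' - z| ≤ d) :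
    |poissonKer n s x' z' - poissonKer n s x z| ≤
      2 ^ (n + 6) * d / z * poissonKer n s x z := by
  have hd0 : 0 ≤ d := (norm_nonneg _).trans hx
  obtain ⟨hz1, hz2⟩ := abs_le.1 hzd
  have hz' : 0 < z' := by linarith
  set τ := d / z with hτ
  have hdτ : d = τ * z := by rw [hτ]; field_simp
  have hτ0 : 0 ≤ τ := by positivity
  have hτ1 : 4 * τ ≤ 1 := by
    rw [hτ]
    rw [← mul_div_assoc, div_le_one hz]
    linarith
  -- comparison of squared distances to the boundary point
  have key : ∀ (a b c e δ : ℝ), 0 ≤ a → 0 ≤ b → 0 < c → 0 < e → 0 ≤ δ → b ≤ a + δ * c →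
      e ≤ c + δ * c → b ^ 2 + e ^ 2 ≤ (1 + 2 * δ) ^ 2 * (a ^ 2 + c ^ 2) := by
    intro a b c e δ ha hb hc he hδ h1 h2
    have h3 : b ^ 2 ≤ (a + δ * c) ^ 2 := by gcongr
    have h4 : e ^ 2 ≤ (c + δ * c) ^ 2 := by gcongr
    nlinarith [mul_nonneg hδ (sq_nonneg (a - c)), mul_nonneg hδ (sq_nonneg a),
      mul_nonneg hδ (sq_nonneg c), mul_nonneg (mul_nonneg hδ hδ) (sq_nonneg a)]
  have hn1 : ‖x'‖ ≤ ‖x‖ + d := by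
    have := norm_le_norm_add_norm_sub' x' x
    linarith
  have hn2 : ‖x‖ ≤ ‖x'‖ + d := by
    have := norm_le_norm_add_norm_sub' x x'
    rw [norm_sub_rev] at this
    linarith
  have hdz' : d ≤ 2 * τ * z' := by nlinarith
  have hP := poissonKer_nonneg (n := n) hs hz x
  have hP' := poissonKer_nonneg (n := n) hs hz' x'
  have hup : poissonKer n s x' z' ≤ (1 + 4 * τ) ^ (n + 4) * poissonKer n s x z := by
    refine poissonKer_le_mul hs hs2 hz hz' (by linarith) (by nlinarith) ?_
    have := key ‖x'‖ ‖x‖ z' z (2 * τ) (norm_nonneg _) (norm_nonneg _) hz' hz (by positivity)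
      (by linarith) (by linarith)
    convert this using 3
    ring
  have hlo : poissonKer n s x z ≤ (1 + 4 * τ) ^ (n + 4) * poissonKer n s x' z' := by
    refine poissonKer_le_mul hs hs2 hz' hz (by linarith) (by nlinarith) ?_
    have := key ‖x‖ ‖x'‖ z z' τ (norm_nonneg _) (norm_nonneg _) hz hz' (by positivity)
      (by linarith) (by linarith)
    refine this.trans ?_
    gcongr
    norm_num
  have hQ := one_add_pow_le (t := 4 * τ) (by positivity) hτ1 (n + 4)
  have hQ1 : 1 ≤ (1 + 4 * τ) ^ (n + 4) := one_le_pow₀ (by linarith)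
  set Q := (1 + 4 * τ) ^ (n + 4)
  have hQ2 : Q - 1 ≤ 2 ^ (n + 6) * τ := by
    have : (2 : ℝ) ^ (n + 6) = 2 ^ (n + 4) * 4 := by ring
    rw [this]
    linarith
  have hfin : |poissonKer n s x' z' - poissonKer n s x z| ≤ (Q - 1) * poissonKer n s x z := by
    rw [abs_le]
    refine ⟨?_, by linarith⟩
    by_cases hc : poissonKer n s x z ≤ poissonKer n s x' z'
    · nlinarith
    · nlinarith
  refine hfin.trans ?_
  rw [mul_div_assoc]
  gcongr

lemma norm_sq_eq_xpart_add_zpart {n : ℕ} (v : Rn (n + 1)) :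
    ‖v‖ ^ 2 = ‖xpart n v‖ ^ 2 + zpart n v ^ 2 := by
  rw [EuclideanSpace.norm_sq_eq, EuclideanSpace.norm_sq_eq, Fin.sum_univ_castSucc]
  simp [xpart, zpart]

lemma xpart_sub {n : ℕ} (v w : Rn (n + 1)) : xpart n (v - w) = xpart n v - xpart n w := by
  ext i
  simp [xpart]

lemma zpart_sub {n : ℕ} (v w : Rn (n + 1)) : zpart n (v - w) = zpart n v - zpart n w := by
  simp [zpart]

lemma norm_xpart_le {n : ℕ} (v : Rn (n + 1)) : ‖xpart n v‖ ≤ ‖v‖ := by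
  refine le_of_sq_le_sq ?_ (norm_nonneg v)
  rw [norm_sq_eq_xpart_add_zpart]
  nlinarith [sq_nonneg (zpart n v)]

lemma abs_zpart_le {n : ℕ} (v : Rn (n + 1)) : |zpart n v| ≤ ‖v‖ := by
  refine abs_le_of_sq_le_sq ?_ (norm_nonneg v)
  rw [norm_sq_eq_xpart_add_zpart]
  nlinarith [sq_nonneg ‖xpart n v‖]

lemma abs_csExt_sub_le {n : ℕ} {s : ℝ} (hs : 0 < s) (hs2 : s ≤ 2) {u : Rn n → ℝ}
    (hu : Measurable u) (hub : ∀ x, |u x| ≤ 1) {v v' : Rn (n + 1)} (hz : 0 < zpart n v)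
    (hd : ‖v' - v‖ ≤ zpart n v / 4) :
    |csExt n s u v' - csExt n s u v| ≤ 2 ^ (n + 6) * ‖v' - v‖ / zpart n v *
      ∫ y, poissonKer n s (xpart n v - y) (zpart n v) * |u (xpart n v) - u y| := by
  have hx : ‖xpart n v' - xpart n v‖ ≤ ‖v' - v‖ := xpart_sub v' v ▸ norm_xpart_le (v' - v)
  have hzd : |zpart n v' - zpart n v| ≤ ‖v' - v‖ := zpart_sub v' v ▸ abs_zpart_le (v' - v)
  have hz' : 0 < zpart n v' := by linarith [(abs_le.1 hzd).1]
  set x := xpart n v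
  set z := zpart n v
  have hI := integrable_poissonKer (n := n) hs hz x
  have hI' := integrable_poissonKer (n := n) hs hz' (xpart n v')
  have hIu : Integrable fun y => poissonKer n s (x - y) z * u y :=
    hI.mul_bdd (c := 1) hu.aestronglyMeasurable (Filter.Eventually.of_forall hub)
  have hIu' : Integrable fun y => poissonKer n s (xpart n v' - y) (zpart n v') * u y :=
    hI'.mul_bdd (c := 1) hu.aestronglyMeasurable (Filter.Eventually.of_forall hub)
  have hID : Integrable fun y => poissonKer n s (x - y) z * |u x - u y| := by
    refine hI.mul_bdd (c := 2) (by fun_prop) (Filter.Eventually.of_forall fun y => ?_)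
    rw [Real.norm_eq_abs, abs_abs]
    have := abs_sub (u x) (u y)
    linarith [hub x, hub y]
  have heq : csExt n s u v' - csExt n s u v =
      ∫ y, (poissonKer n s (xpart n v' - y) (zpart n v') - poissonKer n s (x - y) z) *
        (u y - u x) := by
    have h0 : ∫ y, (poissonKer n s (xpart n v' - y) (zpart n v') - poissonKer n s (x - y) z) *
        u x = 0 := by
      rw [integral_mul_const, integral_sub hI' hI, integral_poissonKer hs hz,
        integral_poissonKer hs hz']
      simp
    have h1 : csExt n s u v' - csExt n s u v =
        ∫ y, (poissonKer n s (xpart n v' - y) (zpart n v') - poissonKer n s (x - y) z) * u y := by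
      unfold csExt
      rw [← integral_sub hIu' hIu]
      simp only [sub_mul]
    simp only [mul_sub]
    have h2 : Integrable fun y =>
        (poissonKer n s (xpart n v' - y) (zpart n v') - poissonKer n s (x - y) z) * u y := by
      simp only [sub_mul]
      exact hIu'.sub hIu
    have h3 : Integrable fun y =>
        (poissonKer n s (xpart n v' - y) (zpart n v') - poissonKer n s (x - y) z) * u x :=
      (hI'.sub hI).mul_const _
    rw [integral_sub h2 h3, h0, h1, sub_zero]
  rw [heq, ← integral_const_mul, ← Real.norm_eq_abs]
  refine norm_integral_le_of_norm_le (hID.const_mul _) (Filter.Eventually.of_forall fun y => ?_)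
  rw [norm_mul, Real.norm_eq_abs, Real.norm_eq_abs, ← mul_assoc, abs_sub_comm (u y)]
  refine mul_le_mul_of_nonneg_right ?_ (abs_nonneg _)
  exact abs_poissonKer_sub_le hs hs2 hz hd (by rwa [sub_sub_sub_cancel_right]) hzd

lemma gradSq_csExt_le {n : ℕ} {s : ℝ} (hs : 0 < s) (hs2 : s ≤ 2) {u : Rn n → ℝ}
    (hu : Measurable u) (hub : ∀ x, |u x| ≤ 1) {v : Rn (n + 1)} (hz : 0 < zpart n v) :
    gradSq n (csExt n s u) v ≤ (n + 1) * (2 ^ (n + 6) / zpart n v *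
      ∫ y, poissonKer n s (xpart n v - y) (zpart n v) * |u (xpart n v) - u y|) ^ 2 := by
  set L := 2 ^ (n + 6) / zpart n v *
      ∫ y, poissonKer n s (xpart n v - y) (zpart n v) * |u (xpart n v) - u y| with hL
  have hL0 : 0 ≤ L := by
    refine mul_nonneg (by positivity) (integral_nonneg fun y => ?_)
    exact mul_nonneg (poissonKer_nonneg hs hz _) (abs_nonneg _)
  have hfd : ‖fderiv ℝ (csExt n s u) v‖ ≤ L := by
    refine norm_fderiv_le_of_lip' ℝ hL0 ?_
    filter_upwards [Metric.closedBall_mem_nhds v (show 0 < zpart n v / 4 by positivity)] with v' hv'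
    rw [mem_closedBall, dist_eq_norm] at hv'
    refine (abs_csExt_sub_le hs hs2 hu hub hz hv').trans_eq ?_
    rw [hL]
    ring
  calc gradSq n (csExt n s u) v ≤ ∑ _i : Fin (n + 1), L ^ 2 := by
        refine Finset.sum_le_sum fun i _ => ?_
        rw [← sq_abs, ← Real.norm_eq_abs]
        gcongr
        refine (ContinuousLinearMap.le_opNorm _ _).trans ?_
        simpa using hfd
    _ = _ := by simp

lemma ofReal_sq_integral_mul_le {α : Type*} [MeasurableSpace α] {μ : Measure α} {f g : α → ℝ}
    (hf : Measurable f) (hg : Measurable g) (hf0 : ∀ x, 0 ≤ f x) (hg0 : ∀ x, 0 ≤ g x)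
    (hfg : Integrable (fun x => f x * g x) μ) :
    ENNReal.ofReal ((∫ x, f x * g x ∂μ) ^ 2) ≤
      (∫⁻ x, ENNReal.ofReal (f x ^ 2) ∂μ) * ∫⁻ x, ENNReal.ofReal (g x ^ 2) ∂μ := by
  have h := ENNReal.lintegral_mul_le_Lp_mul_Lq μ Real.HolderConjugate.two_two
    hf.ennreal_ofReal.aemeasurable hg.ennreal_ofReal.aemeasurable
  rw [ENNReal.ofReal_pow (integral_nonneg fun x => mul_nonneg (hf0 x) (hg0 x)),
    ofReal_integral_eq_lintegral_ofReal hfg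
      (Filter.Eventually.of_forall fun x => mul_nonneg (hf0 x) (hg0 x))]
  simp only [Pi.mul_apply, ENNReal.rpow_two, ← ENNReal.ofReal_pow (hf0 _),
    ← ENNReal.ofReal_pow (hg0 _), ← ENNReal.ofReal_mul (hf0 _)] at h
  refine (pow_le_pow_left' h 2).trans_eq ?_
  rw [mul_pow, ← ENNReal.rpow_natCast, ← ENNReal.rpow_natCast, ← ENNReal.rpow_mul,
    ← ENNReal.rpow_mul]
  norm_num

lemma lintegral_rpow_mul_sq_add_sq_rpow_le {α b h : ℝ} (hα : 0 < α) (hb : α < b) (hh : 0 < h) :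
    ∫⁻ z in Ioi (0 : ℝ), ENNReal.ofReal (z ^ (α - 1) * (h ^ 2 + z ^ 2) ^ (-b / 2)) ≤
      ENNReal.ofReal ((1 / α + 1 / (b - α)) * h ^ (α - b)) := by
  have hsq : ∀ t : ℝ, 0 < t → (t ^ 2) ^ (-b / 2) = t ^ (-b) := fun t ht => by
    rw [← Real.rpow_natCast, ← Real.rpow_mul ht.le]
    congr 1
    push_cast
    ring
  have h1 : ∫⁻ z in Ioc (0 : ℝ) h, ENNReal.ofReal (z ^ (α - 1) * (h ^ 2 + z ^ 2) ^ (-b / 2)) ≤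
      ENNReal.ofReal (1 / α * h ^ (α - b)) := by
    have hInt : IntegrableOn (fun z : ℝ => z ^ (α - 1)) (Ioc 0 h) :=
      (intervalIntegrable_iff_integrableOn_Ioc_of_le hh.le).1
        (intervalIntegral.intervalIntegrable_rpow' (by linarith))
    calc _ ≤ ∫⁻ z in Ioc (0 : ℝ) h, ENNReal.ofReal (z ^ (α - 1) * h ^ (-b)) := by
          refine setLIntegral_mono' measurableSet_Ioc fun z hz => ?_
          have := Real.rpow_nonneg hz.1.le (α - 1)
          refine ENNReal.ofReal_le_ofReal (mul_le_mul_of_nonneg_left ?_ this)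
          rw [← hsq h hh]
          exact Real.rpow_le_rpow_of_nonpos (by positivity) (by nlinarith [sq_nonneg z])
            (by linarith)
      _ = ENNReal.ofReal (∫ z in Ioc (0 : ℝ) h, z ^ (α - 1) * h ^ (-b)) := by
          refine (ofReal_integral_eq_lintegral_ofReal (hInt.mul_const _) ?_).symm
          refine (ae_restrict_iff' measurableSet_Ioc).2 (Filter.Eventually.of_forall fun z hz => ?_)
          exact mul_nonneg (Real.rpow_nonneg hz.1.le _) (by positivity)
      _ = _ := by
          rw [integral_mul_const, ← intervalIntegral.integral_of_le hh.le,
            integral_rpow (Or.inl (by linarith)), sub_add_cancel, Real.zero_rpow hα.ne', sub_zero,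
            Real.rpow_sub hh, Real.rpow_neg hh.le]
          congr 1
          ring
  have h2 : ∫⁻ z in Ioi h, ENNReal.ofReal (z ^ (α - 1) * (h ^ 2 + z ^ 2) ^ (-b / 2)) ≤
      ENNReal.ofReal (1 / (b - α) * h ^ (α - b)) := by
    calc _ ≤ ∫⁻ z in Ioi h, ENNReal.ofReal (z ^ (α - b - 1)) := by
          refine setLIntegral_mono' measurableSet_Ioi fun z hz => ?_
          have hz0 : 0 < z := hh.trans hz
          refine ENNReal.ofReal_le_ofReal ?_
          calc _ ≤ z ^ (α - 1) * z ^ (-b) := by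
                gcongr
                rw [← hsq z hz0]
                exact Real.rpow_le_rpow_of_nonpos (by positivity) (by nlinarith [sq_nonneg h])
                  (by linarith)
            _ = _ := by
                rw [← Real.rpow_add hz0]
                congr 1
                ring
      _ = ENNReal.ofReal (∫ z in Ioi h, z ^ (α - b - 1)) := by
          refine (ofReal_integral_eq_lintegral_ofReal
            (integrableOn_Ioi_rpow_of_lt (by linarith) hh) ?_).symm
          refine (ae_restrict_iff' measurableSet_Ioi).2 (Filter.Eventually.of_forall fun z hz => ?_)
          exact Real.rpow_nonneg (hh.trans hz).le _
      _ = _ := by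
          rw [integral_Ioi_rpow_of_lt (by linarith) hh, sub_add_cancel, ← neg_sub b α, div_neg,
            neg_div, neg_neg]
          congr 1
          ring
  rw [← Ioc_union_Ioi_eq_Ioi hh.le]
  refine (lintegral_union_le _ _ _).trans ((add_le_add h1 h2).trans_eq ?_)
  have : 0 < b - α := by linarith
  rw [← ENNReal.ofReal_add (by positivity) (by positivity), add_mul]

lemma measurePreserving_xpart_zpart (n : ℕ) :
    MeasurePreserving (fun v : Rn (n + 1) => (xpart n v, zpart n v)) := by
  have h1 := PiLp.volume_preserving_ofLp (Fin (n + 1))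
  have h2 := volume_preserving_piFinSuccAbove (fun _ : Fin (n + 1) => ℝ) (Fin.last n)
  have h3 : MeasurePreserving (Prod.swap : ℝ × (Fin n → ℝ) → _) := Measure.measurePreserving_swap
  have h4 := (PiLp.volume_preserving_toLp (Fin n)).prod (MeasurePreserving.id (volume : Measure ℝ))
  have h5 := h4.comp (h3.comp (h2.comp h1))
  rw [← Measure.volume_eq_prod] at h5
  convert h5 using 1
  funext v
  refine Prod.ext ?_ ?_
  · ext i
    simp [xpart, MeasurableEquiv.piFinSuccAbove, Fin.insertNthEquiv]
    rfl
  · simp [zpart, MeasurableEquiv.piFinSuccAbove, Fin.insertNthEquiv]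

lemma ofReal_rpow_mul_gradSq_csExt_le {n : ℕ} {s ε : ℝ} (hε : 0 < ε) (hεs : ε < s) (hs2 : s ≤ 2)
    {u : Rn n → ℝ} (hu : Measurable u) (hub : ∀ x, |u x| ≤ 1) {v : Rn (n + 1)}
    (hz : 0 < zpart n v) :
    ENNReal.ofReal (zpart n v ^ (1 - s) * gradSq n (csExt n s u) v) ≤
      ENNReal.ofReal ((n + 1) * (2 ^ (n + 6) * sigmaC n 2) ^ 2 *
          ∫ y : Rn n, (‖y‖ ^ 2 + 1) ^ (-((n : ℝ) + ε) / 2)) *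
        ∫⁻ y, ENNReal.ofReal (zpart n v ^ (s - ε - 1) *
          (‖xpart n v - y‖ ^ 2 + zpart n v ^ 2) ^ (-((n : ℝ) + 2 * s - ε) / 2) *
            (u (xpart n v) - u y) ^ 2) := by
  have hs : 0 < s := hε.trans hεs
  have hgrad := gradSq_csExt_le hs hs2 hu hub hz
  have hPint := integrable_poissonKer (n := n) hs hz (xpart n v)
  set x := xpart n v
  set z := zpart n v
  set J := ∫ y : Rn n, (‖y‖ ^ 2 + 1) ^ (-((n : ℝ) + ε) / 2)
  have hJ : 0 < J := integral_norm_sq_add_one_rpow_pos (by linarith)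
  have hr : ∀ y : Rn n, 0 < ‖x - y‖ ^ 2 + z ^ 2 := fun y => by positivity
  set f : Rn n → ℝ := fun y => (‖x - y‖ ^ 2 + z ^ 2) ^ (-((n : ℝ) + ε) / 4) with hf
  set g : Rn n → ℝ := fun y =>
    (‖x - y‖ ^ 2 + z ^ 2) ^ (-((n : ℝ) + 2 * s - ε) / 4) * |u x - u y| with hg
  have hsqr : ∀ (y : Rn n) (a : ℝ), ((‖x - y‖ ^ 2 + z ^ 2) ^ (a / 4)) ^ 2 =
      (‖x - y‖ ^ 2 + z ^ 2) ^ (a / 2) := fun y a => by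
    rw [← Real.rpow_natCast, ← Real.rpow_mul (hr y).le]
    congr 1
    push_cast
    ring
  have hfg : ∀ y, poissonKer n s (x - y) z * |u x - u y| = sigmaC n s * z ^ s * (f y * g y) := by
    intro y
    have : (‖x - y‖ ^ 2 + z ^ 2) ^ (-((n : ℝ) + s) / 2) =
        (‖x - y‖ ^ 2 + z ^ 2) ^ (-((n : ℝ) + ε) / 4) *
          (‖x - y‖ ^ 2 + z ^ 2) ^ (-((n : ℝ) + 2 * s - ε) / 4) := by
      rw [← Real.rpow_add (hr y)]
      congr 1
      ring
    rw [poissonKer, this, hf, hg]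
    ring
  have hσ := sigmaC_pos (n := n) hs
  have hc : 0 < sigmaC n s * z ^ s := by positivity
  have hfgint : Integrable fun y => f y * g y := by
    have h1 : Integrable fun y => poissonKer n s (x - y) z * |u x - u y| := by
      refine hPint.mul_bdd (c := 2) (by fun_prop) (Filter.Eventually.of_forall fun y => ?_)
      rw [Real.norm_eq_abs, abs_abs]
      have := abs_sub (u x) (u y)
      linarith [hub x, hub y]
    simp only [hfg] at h1
    exact (integrable_const_mul_iff hc.ne'.isUnit _).1 h1
  have hCS := ofReal_sq_integral_mul_le (μ := (volume : Measure (Rn n))) (f := f) (g := g)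
    (by fun_prop) (by fun_prop) (fun y => by positivity) (fun y => by positivity) hfgint
  have hf2 : ∫⁻ y, ENNReal.ofReal (f y ^ 2) = ENNReal.ofReal (z ^ (-ε) * J) := by
    have h2 := integrable_norm_sq_add_rpow (n := n) (a := n + ε) (by linarith) hz
    simp only [hf, hsqr]
    rw [← ofReal_integral_eq_lintegral_ofReal (h2.1.comp_sub_left x)
      (Filter.Eventually.of_forall fun y => by positivity),
      integral_sub_left_eq_self (fun y : Rn n => (‖y‖ ^ 2 + z ^ 2) ^ (-((n : ℝ) + ε) / 2)), h2.2]
    congr 3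
    ring
  simp only [hfg] at hgrad
  rw [integral_const_mul] at hgrad
  set I := ∫ y, f y * g y
  have hreal : z ^ (1 - s) * gradSq n (csExt n s u) v ≤
      ((n + 1) * (2 ^ (n + 6) * sigmaC n 2) ^ 2 * z ^ (s - 1)) * I ^ 2 := by
    have hzz : z ^ (1 - s) * (z ^ s / z) ^ 2 = z ^ (s - 1) := by
      rw [← Real.rpow_sub_one hz.ne', ← Real.rpow_natCast, ← Real.rpow_mul hz.le,
        ← Real.rpow_add hz]
      congr 1
      push_cast
      ring
    calc _ ≤ z ^ (1 - s) * ((n + 1) * (2 ^ (n + 6) / z * (sigmaC n s * z ^ s * I)) ^ 2) := by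
          gcongr
      _ = (n + 1) * (2 ^ (n + 6) * sigmaC n s) ^ 2 * (z ^ (1 - s) * (z ^ s / z) ^ 2) * I ^ 2 := by
          ring
      _ ≤ _ := by
          rw [hzz]
          have := sigmaC_le_sigmaC (n := n) hs hs2
          gcongr
  have hzε : z ^ (s - 1) * z ^ (-ε) = z ^ (s - ε - 1) := by
    rw [← Real.rpow_add hz]
    congr 1
    ring
  set A : ℝ := (n + 1) * (2 ^ (n + 6) * sigmaC n 2) ^ 2 with hA
  have hA0 : 0 ≤ A := by positivity
  calc _ ≤ ENNReal.ofReal (A * z ^ (s - 1) * I ^ 2) := ENNReal.ofReal_le_ofReal hreal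
    _ = ENNReal.ofReal (A * z ^ (s - 1)) * ENNReal.ofReal (I ^ 2) :=
        ENNReal.ofReal_mul (by positivity)
    _ ≤ ENNReal.ofReal (A * z ^ (s - 1)) * (ENNReal.ofReal (z ^ (-ε) * J) *
          ∫⁻ y, ENNReal.ofReal (g y ^ 2)) := by
        rw [← hf2]
        gcongr
    _ = ENNReal.ofReal (A * J) * (ENNReal.ofReal (z ^ (s - ε - 1)) *
          ∫⁻ y, ENNReal.ofReal (g y ^ 2)) := by
        rw [← mul_assoc, ← mul_assoc, ← ENNReal.ofReal_mul (by positivity),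
          ← ENNReal.ofReal_mul (by positivity), ← hzε]
        congr 2
        ring
    _ = _ := by
        rw [← lintegral_const_mul _ (by fun_prop)]
        congr 1
        refine lintegral_congr fun y => ?_
        rw [← ENNReal.ofReal_mul (by positivity), hg, mul_pow, hsqr, sq_abs, mul_assoc]

/-- **Local energy of the Caffarelli–Silvestre extension controlled by the Gagliardo
energy** (Lemma B.2 of the paper, Euclidean version): for `s ∈ (s₀,2)` and measurable
`u : ℝ^n → [-1,1]`, the weighted Dirichlet energy of the extension on `B₁⁺` is bounded by
`C(n,s₀)` times the Gagliardo energy of `u` on `(ℝ^n×ℝ^n) ∖ (B₂ᶜ×B₂ᶜ)`. -/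
theorem extension_energy_controlled_by_gagliardo
    (n : ℕ) (hn : 1 ≤ n) (s₀ : ℝ) (hs₀ : s₀ ∈ Set.Ioo (0 : ℝ) 2) :
    ∃ C : ℝ, 0 < C ∧
    ∀ s : ℝ, s ∈ Set.Ioo s₀ 2 →
    ∀ u : Rn n → ℝ, Measurable u → (∀ x, u x ∈ Set.Icc (-1 : ℝ) 1) →
      (∫⁻ v in halfBall n 1,
          ENNReal.ofReal (zpart n v ^ (1 - s) * gradSq n (csExt n s u) v))
        ≤ ENNReal.ofReal C *
          ∫⁻ p in (((Metric.ball (0 : Rn n) 2)ᶜ ×ˢ (Metric.ball (0 : Rn n) 2)ᶜ)ᶜ :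
              Set (Rn n × Rn n)),
            ENNReal.ofReal ((u p.1 - u p.2) ^ 2 * ‖p.1 - p.2‖ ^ (-((n : ℝ) + s))) := by
  obtain ⟨hs₀0, -⟩ := hs₀
  set ε := s₀ / 2 with hε
  have hε0 : 0 < ε := by positivity
  set K := (n + 1) * (2 ^ (n + 6) * sigmaC n 2) ^ 2 *
    ∫ y : Rn n, (‖y‖ ^ 2 + 1) ^ (-((n : ℝ) + ε) / 2) with hK
  have hK0 : 0 < K := by
    have h1 := sigmaC_pos (n := n) (s := 2) two_pos
    have h2 := integral_norm_sq_add_one_rpow_pos (n := n) (a := n + ε) (by linarith)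
    positivity
  refine ⟨K * (3 / s₀), by positivity, fun s hs u hu hu1 => ?_⟩
  obtain ⟨hs1, hs2⟩ := hs
  have hub : ∀ x, |u x| ≤ 1 := fun x => abs_le.2 (hu1 x)
  let F : (Rn n × ℝ) → Rn n → ENNReal := fun p y => ENNReal.ofReal (p.2 ^ (s - ε - 1) *
    (‖p.1 - y‖ ^ 2 + p.2 ^ 2) ^ (-((n : ℝ) + 2 * s - ε) / 2) * (u p.1 - u y) ^ 2)
  have hF : Measurable (Function.uncurry F) := by
    simp only [F, Function.uncurry_def]
    fun_prop
  let G : Rn n × Rn n → ENNReal := fun p =>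
    ENNReal.ofReal ((u p.1 - u p.2) ^ 2 * ‖p.1 - p.2‖ ^ (-((n : ℝ) + s)))
  have hG : Measurable G := by
    simp only [G]
    fun_prop
  have hFG : ∀ x y, ∫⁻ z in Ioi (0 : ℝ), F (x, z) y ≤ ENNReal.ofReal (3 / s₀) * G (x, y) := by
    intro x y
    rcases eq_or_ne x y with rfl | hxy
    · simp [F]
    have hh : 0 < ‖x - y‖ := norm_pos_iff.2 (sub_ne_zero.2 hxy)
    have hn0 : (0 : ℝ) ≤ n := Nat.cast_nonneg n
    have key := lintegral_rpow_mul_sq_add_sq_rpow_le (α := s - ε) (b := n + 2 * s - ε)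
      (h := ‖x - y‖) (by linarith) (by linarith) hh
    have hconst : 1 / (s - ε) + 1 / ((n : ℝ) + 2 * s - ε - (s - ε)) ≤ 3 / s₀ := by
      have h1 : 1 / (s - ε) ≤ 1 / (s₀ / 2) :=
        one_div_le_one_div_of_le (by positivity) (by linarith)
      have h2 : 1 / ((n : ℝ) + 2 * s - ε - (s - ε)) ≤ 1 / s₀ :=
        one_div_le_one_div_of_le hs₀0 (by linarith)
      refine (add_le_add h1 h2).trans_eq ?_
      field_simp
      norm_num
    have hexp : s - ε - ((n : ℝ) + 2 * s - ε) = -((n : ℝ) + s) := by ring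
    rw [hexp] at key
    calc ∫⁻ z in Ioi (0 : ℝ), F (x, z) y
        = (∫⁻ z in Ioi (0 : ℝ), ENNReal.ofReal (z ^ (s - ε - 1) *
            (‖x - y‖ ^ 2 + z ^ 2) ^ (-((n : ℝ) + 2 * s - ε) / 2))) *
              ENNReal.ofReal ((u x - u y) ^ 2) := by
          rw [← lintegral_mul_const _ (by fun_prop)]
          refine lintegral_congr fun z => ?_
          simp only [F]
          rw [ENNReal.ofReal_mul' (sq_nonneg _)]
      _ ≤ ENNReal.ofReal (3 / s₀ * ‖x - y‖ ^ (-((n : ℝ) + s))) *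
            ENNReal.ofReal ((u x - u y) ^ 2) := by
          gcongr
          refine key.trans (ENNReal.ofReal_le_ofReal ?_)
          gcongr
      _ = _ := by
          simp only [G]
          rw [← ENNReal.ofReal_mul (by positivity), ← ENNReal.ofReal_mul (by positivity)]
          congr 1
          ring
  have hφ := measurePreserving_xpart_zpart n
  have hS : MeasurableSet (ball (0 : Rn n) 1 ×ˢ Ioi (0 : ℝ)) :=
    measurableSet_ball.prod measurableSet_Ioi
  calc ∫⁻ v in halfBall n 1, ENNReal.ofReal (zpart n v ^ (1 - s) * gradSq n (csExt n s u) v)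
      ≤ ∫⁻ v in (fun v => (xpart n v, zpart n v)) ⁻¹' (ball (0 : Rn n) 1 ×ˢ Ioi (0 : ℝ)),
          ENNReal.ofReal (zpart n v ^ (1 - s) * gradSq n (csExt n s u) v) := by
        refine lintegral_mono_set fun v hv => ⟨?_, hv.2⟩
        rw [mem_ball_zero_iff]
        exact (norm_xpart_le v).trans_lt hv.1
    _ ≤ ∫⁻ v in (fun v => (xpart n v, zpart n v)) ⁻¹' (ball (0 : Rn n) 1 ×ˢ Ioi (0 : ℝ)),
          ENNReal.ofReal K * ∫⁻ y, F (xpart n v, zpart n v) y :=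
        setLIntegral_mono' (hφ.measurable hS) fun v hv =>
          ofReal_rpow_mul_gradSq_csExt_le hε0 (by linarith) hs2.le hu hub hv.2
    _ = ∫⁻ p in ball (0 : Rn n) 1 ×ˢ Ioi (0 : ℝ), ENNReal.ofReal K * ∫⁻ y, F p y :=
        hφ.setLIntegral_comp_preimage hS (hF.lintegral_prod_right.const_mul _)
    _ = ENNReal.ofReal K * ∫⁻ x in ball (0 : Rn n) 1, ∫⁻ z in Ioi (0 : ℝ), ∫⁻ y, F (x, z) y := by
        rw [lintegral_const_mul _ hF.lintegral_prod_right, Measure.volume_eq_prod,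
          ← Measure.prod_restrict, lintegral_prod _ hF.lintegral_prod_right.aemeasurable]
    _ = ENNReal.ofReal K * ∫⁻ x in ball (0 : Rn n) 1, ∫⁻ y, ∫⁻ z in Ioi (0 : ℝ), F (x, z) y := by
        congr 1
        refine lintegral_congr fun x => lintegral_lintegral_swap ?_
        exact (hF.comp (g := Function.uncurry F) (f := fun q : ℝ × Rn n => ((x, q.1), q.2))
          (by fun_prop)).aemeasurable
    _ ≤ ENNReal.ofReal K * ∫⁻ x in ball (0 : Rn n) 1, ∫⁻ y,
          ENNReal.ofReal (3 / s₀) * G (x, y) := by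
        gcongr with x y
        exact hFG x y
    _ = ENNReal.ofReal (K * (3 / s₀)) * ∫⁻ p in ball (0 : Rn n) 1 ×ˢ univ, G p := by
        have h := lintegral_prod (μ := volume.restrict (ball (0 : Rn n) 1))
          (ν := (volume : Measure (Rn n)).restrict univ) (fun p => ENNReal.ofReal (3 / s₀) * G p)
          (by fun_prop)
        rw [Measure.restrict_univ] at h
        rw [← h, lintegral_const_mul _ hG, ENNReal.ofReal_mul hK0.le, mul_assoc,
          Measure.volume_eq_prod, ← Measure.prod_restrict, Measure.restrict_univ]
    _ ≤ _ := by
        gcongr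
        intro p hp hp'
        refine hp'.1 ?_
        exact ball_subset_ball (by norm_num) hp.1

end
end
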